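/- (Abstract Hadwiger-type theorem) Let n ≥ 2 and let G be a compact (equivalently, closed) subgroup of SO(n). Then the complex vector space Val^G of continuous, translation invariant, complex-valued valuations μ on ℝⁿ satisfying μ(gK) = μ(K) for all g ∈ G and all nonempty compact convex K is finite-dimensional if and only if G acts transitively on the unit sphere S^{n-1} = {x ∈ ℝⁿ : |x| = 1}. -/

import Mathlib

open MeasureTheory Metric Set
open scoped Pointwise ENNReal

noncomputable section

/-- Euclidean `n`-space. -/
abbrev En (n : ℕ) := EuclideanSpace ℝ (Fin n)

/-- The special orthogonal group `SO(n)`, as the subgroup of the (real) unitary group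
consisting of matrices of determinant one. -/
def SO (n : ℕ) : Subgroup (Matrix.unitaryGroup (Fin n) ℝ) where
  carrier := {g | Matrix.det (g : Matrix (Fin n) (Fin n) ℝ) = 1}
  one_mem' := by simp
  mul_mem' := by
    intro a b ha hb
    simp only [Set.mem_setOf_eq] at *
    rw [MulMemClass.coe_mul, Matrix.det_mul, ha, hb, mul_one]
  inv_mem' := by
    intro a ha
    simp only [Set.mem_setOf_eq] at *
    have h : ((a⁻¹ * a : Matrix.unitaryGroup (Fin n) ℝ) : Matrix (Fin n) (Fin n) ℝ) = 1 := by
      rw [inv_mul_cancel]; rfl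
    have h2 := congrArg Matrix.det h
    rw [MulMemClass.coe_mul, Matrix.det_mul, ha, mul_one, Matrix.det_one] at h2
    exact h2

/-- The linear action of an orthogonal matrix on `ℝⁿ`. -/
def matAct {n : ℕ} (g : Matrix.unitaryGroup (Fin n) ℝ) : En n →ₗ[ℝ] En n :=
  Matrix.toEuclideanLin (g : Matrix (Fin n) (Fin n) ℝ)

variable {V : Type*} [NormedAddCommGroup V] [NormedSpace ℝ V]

/-- `μ` is a (complex-valued) valuation: additivity on unions of convex bodies whose
union is again convex. -/
def IsValuationC (μ : ConvexBody V → ℂ) : Prop :=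
  ∀ K L M N : ConvexBody V,
    (M : Set V) = (K : Set V) ∪ (L : Set V) → (N : Set V) = (K : Set V) ∩ (L : Set V) →
      μ M + μ N = μ K + μ L

/-- `μ` is translation invariant. -/
def IsTranslationInvariantC (μ : ConvexBody V → ℂ) : Prop :=
  ∀ (x : V) (K L : ConvexBody V), (L : Set V) = x +ᵥ (K : Set V) → μ L = μ K

/-- Membership in `Val^G`: continuous, translation invariant, `G`-invariant valuations. -/
def MemValG {n : ℕ} (G : Subgroup (Matrix.unitaryGroup (Fin n) ℝ))
    (μ : ConvexBody (En n) → ℂ) : Prop :=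
  IsValuationC μ ∧ Continuous μ ∧ IsTranslationInvariantC μ ∧
    ∀ g ∈ G, ∀ K L : ConvexBody (En n),
      (L : Set (En n)) = (matAct g) '' (K : Set (En n)) → μ L = μ K

/-! ### Support functions -/

/-- support function of a convex body -/
def hs {n : ℕ} (K : ConvexBody (En n)) (u : En n) : ℝ :=
  sSup ((fun x => inner ℝ x u) '' (K : Set (En n)))

theorem hs_exists {n : ℕ} (K : ConvexBody (En n)) (u : En n) :
    ∃ x ∈ (K : Set (En n)), inner ℝ x u = hs K u := by
  have hc : IsCompact ((fun x : En n => inner ℝ x u) '' (K : Set (En n))) :=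
    K.isCompact.image (by fun_prop)
  have := hc.sSup_mem (K.nonempty.image _)
  obtain ⟨x, hx, h⟩ := this
  exact ⟨x, hx, h⟩

theorem le_hs {n : ℕ} (K : ConvexBody (En n)) (u : En n) {x : En n} (hx : x ∈ (K : Set (En n))) :
    inner ℝ x u ≤ hs K u := by
  have hc : IsCompact ((fun x : En n => inner ℝ x u) '' (K : Set (En n))) :=
    K.isCompact.image (by fun_prop)
  exact le_csSup hc.bddAbove ⟨x, hx, rfl⟩

theorem hs_le_iff {n : ℕ} (K : ConvexBody (En n)) (u : En n) (c : ℝ) :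
    hs K u ≤ c ↔ ∀ x ∈ (K : Set (En n)), inner ℝ x u ≤ c := by
  constructor
  · intro h x hx
    exact (le_hs K u hx).trans h
  · intro h
    obtain ⟨x, hx, h'⟩ := hs_exists K u
    rw [← h']; exact h x hx

theorem mem_body_iff {n : ℕ} (K : ConvexBody (En n)) (x : En n) :
    x ∈ (K : Set (En n)) ↔ ∀ u, inner ℝ x u ≤ hs K u := by
  constructor
  · intro hx u; exact le_hs K u hx
  · intro h
    by_contra hx
    obtain ⟨f, c, h1, h2⟩ := geometric_hahn_banach_closed_point K.convex K.isClosed hx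
    let u := (InnerProductSpace.toDual ℝ (En n)).symm f
    have hf : ∀ y, f y = inner ℝ y u := by
      intro y
      rw [real_inner_comm]
      exact (InnerProductSpace.toDual_symm_apply (𝕜 := ℝ) (x := y) (y := f)).symm
    have h3 : hs K u ≤ c := by
      rw [hs_le_iff]
      intro y hy
      rw [← hf]; exact (h1 y hy).le
    have := h u
    rw [← hf] at this
    linarith

theorem body_subset_iff {n : ℕ} (K L : ConvexBody (En n)) :
    (K : Set (En n)) ⊆ L ↔ ∀ u, hs K u ≤ hs L u := by
  constructor
  · intro h u
    rw [hs_le_iff]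
    intro x hx; exact le_hs L u (h hx)
  · intro h x hx
    rw [mem_body_iff]
    intro u
    exact (le_hs K u hx).trans (h u)

theorem hs_ext {n : ℕ} {K L : ConvexBody (En n)} (h : ∀ u, hs K u = hs L u) : K = L := by
  apply ConvexBody.ext
  apply Set.Subset.antisymm
  · rw [body_subset_iff]; intro u; exact (h u).le
  · rw [body_subset_iff]; intro u; exact (h u).ge

theorem hs_eq_of {n : ℕ} (K : ConvexBody (En n)) (u : En n) (c : ℝ)
    (h1 : ∀ x ∈ (K : Set (En n)), inner ℝ x u ≤ c) (h2 : ∃ x ∈ (K : Set (En n)), inner ℝ x u = c) :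
    hs K u = c := by
  apply le_antisymm
  · rw [hs_le_iff]; exact h1
  · obtain ⟨x, hx, h⟩ := h2
    rw [← h]; exact le_hs K u hx

theorem hs_add {n : ℕ} (K L : ConvexBody (En n)) (u : En n) : hs (K + L) u = hs K u + hs L u := by
  apply hs_eq_of
  · rintro x ⟨a, ha, b, hb, rfl⟩
    simp only [inner_add_left]
    exact add_le_add (le_hs K u ha) (le_hs L u hb)
  · obtain ⟨a, ha, h1⟩ := hs_exists K u
    obtain ⟨b, hb, h2⟩ := hs_exists L u
    exact ⟨a + b, ⟨a, ha, b, hb, rfl⟩, by rw [inner_add_left, h1, h2]⟩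

theorem hs_smul {n : ℕ} {c : ℝ} (hc : 0 ≤ c) (K : ConvexBody (En n)) (u : En n) :
    hs (c • K) u = c * hs K u := by
  apply hs_eq_of
  · rintro x ⟨a, ha, rfl⟩
    simp only [real_inner_smul_left]
    exact mul_le_mul_of_nonneg_left (le_hs K u ha) hc
  · obtain ⟨a, ha, h1⟩ := hs_exists K u
    exact ⟨c • a, ⟨a, ha, rfl⟩, by rw [real_inner_smul_left, h1]⟩

/-- a point as a convex body -/
def ptB {n : ℕ} (x : En n) : ConvexBody (En n) :=
  ⟨{x}, convex_singleton x, isCompact_singleton, Set.singleton_nonempty x⟩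

@[simp] theorem coe_ptB {n : ℕ} (x : En n) : (ptB x : Set (En n)) = {x} := rfl

theorem hs_ptB {n : ℕ} (x u : En n) : hs (ptB x) u = inner ℝ x u := by
  apply hs_eq_of
  · intro y hy
    simp only [coe_ptB, mem_singleton_iff] at hy
    rw [hy]
  · exact ⟨x, by simp, rfl⟩

theorem hs_zero {n : ℕ} (u : En n) : hs (0 : ConvexBody (En n)) u = 0 := by
  apply hs_eq_of
  · intro y hy
    simp only [ConvexBody.coe_zero, Set.mem_zero] at hy
    rw [hy]; simp
  · exact ⟨0, by simp, by simp⟩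

/-- closed unit ball as a convex body -/
def UB (n : ℕ) : ConvexBody (En n) :=
  ⟨closedBall 0 1, convex_closedBall 0 1, isCompact_closedBall 0 1, ⟨0, by simp⟩⟩

theorem hs_UB {n : ℕ} (u : En n) : hs (UB n) u = ‖u‖ := by
  apply hs_eq_of
  · intro y hy
    have hy' : ‖y‖ ≤ 1 := by simpa using (show y ∈ closedBall (0 : En n) 1 from hy)
    calc inner ℝ y u ≤ ‖y‖ * ‖u‖ := real_inner_le_norm y u
      _ ≤ 1 * ‖u‖ := by gcongr
      _ = ‖u‖ := one_mul _
  · by_cases hu : u = 0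
    · exact ⟨0, show (0 : En n) ∈ closedBall (0 : En n) 1 by simp, by simp [hu]⟩
    · refine ⟨‖u‖⁻¹ • u, show _ ∈ closedBall (0 : En n) 1 from ?_, ?_⟩
      · rw [mem_closedBall_zero_iff, norm_smul, norm_inv, norm_norm,
          inv_mul_cancel₀ (norm_ne_zero_iff.mpr hu)]
      · rw [real_inner_smul_left, real_inner_self_eq_norm_sq]
        have := norm_ne_zero_iff.mpr hu
        field_simp

theorem hs_add_arg {n : ℕ} (K : ConvexBody (En n)) (u v : En n) :
    hs K (u + v) ≤ hs K u + hs K v := by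
  rw [hs_le_iff]
  intro x hx
  rw [inner_add_right]
  exact add_le_add (le_hs K u hx) (le_hs K v hx)

theorem hs_smul_arg {n : ℕ} (K : ConvexBody (En n)) {c : ℝ} (hc : 0 ≤ c) (u : En n) :
    hs K (c • u) = c * hs K u := by
  apply hs_eq_of
  · intro x hx
    rw [real_inner_smul_right]
    exact mul_le_mul_of_nonneg_left (le_hs K u hx) hc
  · obtain ⟨x, hx, h⟩ := hs_exists K u
    exact ⟨x, hx, by rw [real_inner_smul_right, h]⟩

/-- sublinear functions -/
def Sublin {n : ℕ} (h : En n → ℝ) : Prop :=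
  (∀ c : ℝ, 0 < c → ∀ x, h (c • x) = c * h x) ∧ ∀ x y, h (x + y) ≤ h x + h y

theorem sublin_hs {n : ℕ} (K : ConvexBody (En n)) : Sublin (hs K) :=
  ⟨fun _ hc x => hs_smul_arg K hc.le x, hs_add_arg K⟩

theorem Sublin.zero {n : ℕ} {h : En n → ℝ} (hh : Sublin h) : h 0 = 0 := by
  have := hh.1 2 (by norm_num) 0
  rw [smul_zero] at this
  linarith

theorem Sublin.exists_inner {n : ℕ} {h : En n → ℝ} (hh : Sublin h) (u : En n) :
    ∃ x : En n, (∀ v, inner ℝ x v ≤ h v) ∧ inner ℝ x u = h u := by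
  by_cases hu : u = 0
  · let f : En n →ₗ.[ℝ] ℝ := ⟨⊥, 0⟩
    obtain ⟨g, hg1, hg2⟩ := exists_extension_of_le_sublinear f h hh.1 hh.2 (by
      rintro ⟨x, hx⟩
      have hx0 : x = 0 := (Submodule.mem_bot ℝ).mp hx
      subst hx0
      simp [f, hh.zero])
    let gc : En n →L[ℝ] ℝ := LinearMap.toContinuousLinearMap g
    refine ⟨(InnerProductSpace.toDual ℝ (En n)).symm gc, fun v => ?_, ?_⟩
    · rw [InnerProductSpace.toDual_symm_apply]; exact hg2 v
    · rw [hu, inner_zero_right, hh.zero]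
  · let f : En n →ₗ.[ℝ] ℝ := LinearPMap.mkSpanSingleton u (h u) hu
    obtain ⟨g, hg1, hg2⟩ := exists_extension_of_le_sublinear f h hh.1 hh.2 (by
      rintro ⟨x, hx⟩
      obtain ⟨c, rfl⟩ := Submodule.mem_span_singleton.mp hx
      have e : f ⟨c • u, hx⟩ = c • h u := LinearPMap.mkSpanSingleton'_apply u (h u) _ c hx
      rw [e]
      rcases lt_trichotomy c 0 with hc | hc | hc
      · have h1 := hh.2 (c • u) ((-c) • u)
        rw [← add_smul, add_neg_cancel, zero_smul, hh.zero, hh.1 (-c) (by linarith)] at h1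
        simp only [smul_eq_mul]
        linarith
      · subst hc; simp [hh.zero]
      · rw [hh.1 c hc]; simp)
    let gc : En n →L[ℝ] ℝ := LinearMap.toContinuousLinearMap g
    refine ⟨(InnerProductSpace.toDual ℝ (En n)).symm gc, fun v => ?_, ?_⟩
    · rw [InnerProductSpace.toDual_symm_apply]; exact hg2 v
    · rw [InnerProductSpace.toDual_symm_apply]
      have := hg1 ⟨u, Submodule.mem_span_singleton_self u⟩
      change g u = _
      rw [this]
      exact LinearPMap.mkSpanSingleton_apply ℝ ℝ hu (h u)

theorem Sublin.exists_bound {n : ℕ} {h : En n → ℝ} (hh : Sublin h) :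
    ∃ C, 0 ≤ C ∧ ∀ x : En n, h x ≤ C * ‖x‖ := by
  refine ⟨∑ i, (|h (EuclideanSpace.single i 1)| + |h (-EuclideanSpace.single i 1)|),
    Finset.sum_nonneg fun i _ => by positivity, fun x => ?_⟩
  have key : ∀ s : Finset (Fin n), h (∑ i ∈ s, (x i) • (EuclideanSpace.single i (1 : ℝ))) ≤
      ∑ i ∈ s, (|h (EuclideanSpace.single i 1)| + |h (-EuclideanSpace.single i 1)|) * ‖x‖ := by
    intro s
    induction s using Finset.induction_on with
    | empty => simp [hh.zero]
    | insert i s hi ih =>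
      rw [Finset.sum_insert hi, Finset.sum_insert hi]
      refine (hh.2 _ _).trans (add_le_add ?_ ih)
      have hx : |x i| ≤ ‖x‖ := by
        simpa using PiLp.norm_apply_le x i
      have a1 := abs_nonneg (h (EuclideanSpace.single i 1))
      have a2 := abs_nonneg (h (-EuclideanSpace.single i 1))
      rcases lt_trichotomy (x i) 0 with hc | hc | hc
      · have e : (x i) • (EuclideanSpace.single i (1 : ℝ)) =
            (-(x i)) • (-(EuclideanSpace.single i (1 : ℝ))) := by simp
        rw [e, hh.1 _ (by linarith)]
        rw [abs_of_neg hc] at hx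
        have := le_abs_self (h (-EuclideanSpace.single i 1))
        nlinarith
      · rw [hc, zero_smul, hh.zero]; positivity
      · rw [hh.1 _ hc]
        rw [abs_of_pos hc] at hx
        have := le_abs_self (h (EuclideanSpace.single i 1))
        nlinarith
  have hx : x = ∑ i, (x i) • (EuclideanSpace.single i (1 : ℝ)) := by
    conv_lhs => rw [← (EuclideanSpace.basisFun (Fin n) ℝ).sum_repr x]
    simp
  calc h x = h (∑ i, (x i) • (EuclideanSpace.single i (1 : ℝ))) := by rw [← hx]
    _ ≤ _ := key Finset.univ
    _ = _ := by rw [Finset.sum_mul]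

theorem Sublin.exists_body {n : ℕ} {h : En n → ℝ} (hh : Sublin h) :
    ∃ K : ConvexBody (En n), ∀ u, hs K u = h u := by
  obtain ⟨C, hC0, hC⟩ := hh.exists_bound
  let S : Set (En n) := {x | ∀ u, inner ℝ x u ≤ h u}
  have hconv : Convex ℝ S := by
    intro x hx y hy a b ha hb hab u
    rw [inner_add_left, real_inner_smul_left, real_inner_smul_left]
    calc _ ≤ a * h u + b * h u := add_le_add (mul_le_mul_of_nonneg_left (hx u) ha)
            (mul_le_mul_of_nonneg_left (hy u) hb)
      _ = h u := by rw [← add_mul, hab, one_mul]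
  have hcl : IsClosed S := by
    have : S = ⋂ u, {x : En n | inner ℝ x u ≤ h u} := by ext x; simp [S]
    rw [this]
    exact isClosed_iInter fun u => isClosed_le (by fun_prop) continuous_const
  have hbd : S ⊆ closedBall 0 C := by
    intro x hx
    rw [mem_closedBall_zero_iff]
    have h1 := (hx x).trans (hC x)
    rw [real_inner_self_eq_norm_sq] at h1
    by_cases h0 : ‖x‖ = 0
    · rw [h0]
      exact hC0
    · have : 0 < ‖x‖ := lt_of_le_of_ne (norm_nonneg x) (Ne.symm h0)
      nlinarith
  have hcomp : IsCompact S := (isCompact_closedBall 0 C).of_isClosed_subset hcl hbd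
  have hne : S.Nonempty := by
    obtain ⟨x, hx, _⟩ := hh.exists_inner 0
    exact ⟨x, hx⟩
  refine ⟨⟨S, hconv, hcomp, hne⟩, fun u => ?_⟩
  apply hs_eq_of
  · intro x hx; exact hx u
  · obtain ⟨x, hx, h1⟩ := hh.exists_inner u
    exact ⟨x, hx, h1⟩

theorem abs_hs_sub_le {n : ℕ} (K L : ConvexBody (En n)) (u : En n) :
    |hs K u - hs L u| ≤ dist K L * ‖u‖ := by
  have key : ∀ K L : ConvexBody (En n), hs K u - hs L u ≤ dist K L * ‖u‖ := by
    intro K L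
    apply le_of_forall_pos_le_add
    intro ε hε
    obtain ⟨x, hx, h1⟩ := hs_exists K u
    obtain ⟨δ, hpos, h5⟩ : ∃ δ : ℝ, 0 < δ ∧ δ * ‖u‖ ≤ ε := by
      refine ⟨ε / (‖u‖ + 1), by positivity, ?_⟩
      rw [div_mul_eq_mul_div, div_le_iff₀ (by positivity)]
      exact mul_le_mul_of_nonneg_left (le_add_of_nonneg_right zero_le_one) hε.le
    obtain ⟨y, hy, hxy⟩ := Metric.exists_dist_lt_of_hausdorffDist_lt (r := dist K L + δ)
      hx (by rw [ConvexBody.hausdorffDist_coe]; linarith) ConvexBody.hausdorffEDist_ne_top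
    have h2 := le_hs L u hy
    have h3 : inner ℝ x u - inner ℝ y u ≤ dist x y * ‖u‖ := by
      rw [← inner_sub_left, dist_eq_norm]; exact real_inner_le_norm _ _
    have h4 : dist x y * ‖u‖ ≤ (dist K L + δ) * ‖u‖ := by gcongr
    rw [add_mul] at h4
    linarith
  rw [abs_le]
  constructor
  · have := key L K
    rw [dist_comm] at this; linarith
  · exact key K L

theorem subset_thick {n : ℕ} {K L : ConvexBody (En n)} {ε : ℝ} (hε : 0 ≤ ε)
    (h : ∀ u, ‖u‖ = 1 → hs K u ≤ hs L u + ε) {x : En n} (hx : x ∈ (K : Set (En n))) :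
    ∃ y ∈ (L : Set (En n)), dist x y ≤ ε := by
  have h1 : (K : Set (En n)) ⊆ (L + ε • UB n : ConvexBody (En n)) := by
    rw [body_subset_iff]
    intro u
    rw [hs_add, hs_smul hε, hs_UB]
    by_cases hu : u = 0
    · subst hu; simp [(sublin_hs K).zero, (sublin_hs L).zero]
    · have hp : 0 < ‖u‖ := norm_pos_iff.mpr hu
      have h2 := h (‖u‖⁻¹ • u) (by
        rw [norm_smul, norm_inv, norm_norm, inv_mul_cancel₀ hp.ne'])
      rw [hs_smul_arg _ (by positivity), hs_smul_arg _ (by positivity)] at h2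
      have h3 := mul_le_mul_of_nonneg_left h2 hp.le
      field_simp at h3
      linarith
  obtain ⟨y, hy, z, ⟨b, hb, rfl⟩, rfl⟩ := h1 hx
  refine ⟨y, hy, ?_⟩
  have hb' : ‖b‖ ≤ 1 := by simpa using (show b ∈ closedBall (0 : En n) 1 from hb)
  simp only [dist_self_add_left, norm_smul, Real.norm_eq_abs, abs_of_nonneg hε]
  nlinarith

theorem dist_le_of_hs {n : ℕ} {K L : ConvexBody (En n)} {ε : ℝ} (hε : 0 ≤ ε)
    (h : ∀ u, ‖u‖ = 1 → |hs K u - hs L u| ≤ ε) : dist K L ≤ ε := by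
  rw [← ConvexBody.hausdorffDist_coe]
  apply Metric.hausdorffDist_le_of_mem_dist hε
  · intro x hx
    exact subset_thick hε (fun u hu => by have := abs_le.mp (h u hu); linarith) hx
  · intro x hx
    exact subset_thick hε (fun u hu => by have := abs_le.mp (h u hu); linarith) hx

/-! ### Polynomial functions on the half line -/

/-- `f` agrees on `[0,∞)` with a polynomial of degree at most `D` -/
def PolyOn (D : ℕ) (f : ℝ → ℝ) : Prop :=
  ∃ q : Polynomial ℝ, q.natDegree ≤ D ∧ ∀ t, 0 ≤ t → f t = q.eval t

/-- Lagrange basis for the nodes `0,…,D` -/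
def lag (D k : ℕ) : Polynomial ℝ := Lagrange.basis (Finset.range (D + 1)) (fun i : ℕ => (i : ℝ)) k

theorem lag_natDegree (D k : ℕ) (hk : k ∈ Finset.range (D + 1)) : (lag D k).natDegree ≤ D := by
  unfold lag
  rw [Lagrange.natDegree_basis _ hk]
  · simp
  · intro a _ b _ h; exact Nat.cast_injective h

theorem poly_eq_lag {D : ℕ} (q : Polynomial ℝ) (hq : q.natDegree ≤ D) (t : ℝ) :
    q.eval t = ∑ k ∈ Finset.range (D + 1), q.eval (k : ℝ) * (lag D k).eval t := by
  have h := Lagrange.eq_interpolate (s := Finset.range (D + 1)) (v := fun i : ℕ => (i : ℝ)) (f := q)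
    (by intro a _ b _ h; exact Nat.cast_injective h)
    (by
      rw [Finset.card_range]
      refine lt_of_le_of_lt Polynomial.degree_le_natDegree ?_
      exact_mod_cast Nat.lt_succ_of_le hq)
  conv_lhs => rw [h, Lagrange.interpolate_apply, Polynomial.eval_finsetSum]
  apply Finset.sum_congr rfl
  intro k _
  simp [lag]

theorem PolyOn.eq_lag {D : ℕ} {f : ℝ → ℝ} (h : PolyOn D f) {t : ℝ} (ht : 0 ≤ t) :
    f t = ∑ k ∈ Finset.range (D + 1), f (k : ℝ) * (lag D k).eval t := by
  obtain ⟨q, hq, h⟩ := h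
  rw [h t ht, poly_eq_lag q hq]
  apply Finset.sum_congr rfl
  intro k _
  rw [h k (by positivity)]

theorem lag_sum_polyOn (D : ℕ) (c : ℕ → ℝ) :
    PolyOn D (fun t => ∑ k ∈ Finset.range (D + 1), c k * (lag D k).eval t) := by
  refine ⟨∑ k ∈ Finset.range (D + 1), Polynomial.C (c k) * lag D k, ?_, ?_⟩
  · apply Polynomial.natDegree_sum_le_of_forall_le
    intro k hk
    exact (Polynomial.natDegree_C_mul_le _ _).trans (lag_natDegree D k hk)
  · intro t _
    rw [Polynomial.eval_finsetSum]
    simp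

theorem PolyOn.congr {D : ℕ} {f g : ℝ → ℝ} (h : PolyOn D f) (hfg : ∀ t, 0 ≤ t → g t = f t) :
    PolyOn D g := by
  obtain ⟨q, hq, h⟩ := h
  exact ⟨q, hq, fun t ht => (hfg t ht).trans (h t ht)⟩

theorem PolyOn.add {D : ℕ} {f g : ℝ → ℝ} (hf : PolyOn D f) (hg : PolyOn D g) :
    PolyOn D (fun t => f t + g t) := by
  obtain ⟨p, hp, h1⟩ := hf
  obtain ⟨q, hq, h2⟩ := hg
  refine ⟨p + q, (Polynomial.natDegree_add_le _ _).trans (max_le hp hq), fun t ht => ?_⟩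
  simp [h1 t ht, h2 t ht]

theorem PolyOn.const_mul {D : ℕ} {f : ℝ → ℝ} (c : ℝ) (hf : PolyOn D f) :
    PolyOn D (fun t => c * f t) := by
  obtain ⟨p, hp, h1⟩ := hf
  refine ⟨Polynomial.C c * p, (Polynomial.natDegree_C_mul_le _ _).trans hp, fun t ht => ?_⟩
  simp [h1 t ht]

theorem PolyOn.mul {D E : ℕ} {f g : ℝ → ℝ} (hf : PolyOn D f) (hg : PolyOn E g) :
    PolyOn (D + E) (fun t => f t * g t) := by
  obtain ⟨p, hp, h1⟩ := hf
  obtain ⟨q, hq, h2⟩ := hg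
  refine ⟨p * q, Polynomial.natDegree_mul_le.trans (add_le_add hp hq), fun t ht => ?_⟩
  simp [h1 t ht, h2 t ht]

theorem PolyOn.const (D : ℕ) (c : ℝ) : PolyOn D (fun _ => c) :=
  ⟨Polynomial.C c, by simp, fun t _ => by simp⟩

theorem PolyOn.sum {ι : Type*} (s : Finset ι) {D : ℕ} {f : ι → ℝ → ℝ}
    (h : ∀ i ∈ s, PolyOn D (f i)) : PolyOn D (fun t => ∑ i ∈ s, f i t) := by
  classical
  induction s using Finset.induction_on with
  | empty => simpa using PolyOn.const D 0
  | insert i s hi ih =>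
    have h1 := (h i (Finset.mem_insert_self i s)).add
      (ih fun j hj => h j (Finset.mem_insert_of_mem hj))
    exact h1.congr fun t _ => Finset.sum_insert hi

theorem PolyOn.mono {D E : ℕ} (hDE : D ≤ E) {f : ℝ → ℝ} (h : PolyOn D f) : PolyOn E f := by
  obtain ⟨q, hq, h⟩ := h
  exact ⟨q, hq.trans hDE, h⟩

theorem lag_polyOn (D k : ℕ) (hk : k ∈ Finset.range (D + 1)) :
    PolyOn D (fun t => (lag D k).eval t) :=
  ⟨lag D k, lag_natDegree D k hk, fun _ _ => rfl⟩

/-- degree reduction through growth -/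
theorem PolyOn.reduce {D E : ℕ} {f : ℝ → ℝ} (h : PolyOn E f) (C : ℝ)
    (hC : ∀ t, 1 ≤ t → |f t| ≤ C * t ^ D) : PolyOn D f := by
  obtain ⟨q, hq, h⟩ := h
  refine ⟨q, ?_, h⟩
  by_contra hcon
  push Not at hcon
  have hd : (Polynomial.X ^ D : Polynomial ℝ).degree < q.degree := by
    rw [Polynomial.degree_X_pow]
    exact Polynomial.coe_lt_degree.mpr hcon
  have h1 := Polynomial.abs_div_tendsto_atTop_atTop_of_degree_gt q (Polynomial.X ^ D) hd
    (by simp)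
  obtain ⟨t, ht1, ht2⟩ := ((h1.eventually_gt_atTop C).and (Filter.eventually_ge_atTop 1)).exists
  have h2 := hC t ht2
  rw [h t (by linarith)] at h2
  simp only [Polynomial.eval_pow, Polynomial.eval_X, abs_div] at ht1
  have hp : 0 < t ^ D := by positivity
  rw [abs_of_pos hp, lt_div_iff₀ hp] at ht1
  linarith

theorem seq_poly {D : ℕ} (g : ℕ → ℝ) (p : Polynomial ℝ) (hp : p.natDegree ≤ D)
    (h : ∀ j : ℕ, g (j + 1) - g j = p.eval (j : ℝ)) :
    ∃ q : Polynomial ℝ, q.natDegree ≤ D + 1 ∧ ∀ j : ℕ, g j = q.eval (j : ℝ) := by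
  have h0 : ∀ k, D + 2 ≤ k → (fwdDiff 1)^[k] g 0 = 0 := by
    intro k hk
    obtain ⟨m, rfl⟩ : ∃ m, k = m + 1 := ⟨k - 1, by omega⟩
    rw [Function.iterate_succ_apply]
    have e1 : fwdDiff 1 g = fun j : ℕ => p.eval (j : ℝ) := by
      funext j; rw [← h j]; rfl
    have e2 := Polynomial.fwdDiff_iter_eq_zero_of_degree_lt (P := p) (n := m) (by omega)
    have e3 := congrFun e2 0
    rw [fwdDiff_iter_eq_sum_shift] at e3
    rw [e1, fwdDiff_iter_eq_sum_shift]
    simpa using e3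
  refine ⟨∑ k ∈ Finset.range (D + 2), Polynomial.C ((fwdDiff 1)^[k] g 0 / (k.factorial : ℝ)) *
    descPochhammer ℝ k, ?_, ?_⟩
  · apply Polynomial.natDegree_sum_le_of_forall_le
    intro k hk
    refine (Polynomial.natDegree_C_mul_le _ _).trans ?_
    rw [descPochhammer_natDegree]
    rw [Finset.mem_range] at hk; omega
  · intro j
    have e := shift_eq_sum_fwdDiff_iter (1 : ℕ) g j 0
    simp only [zero_add, smul_eq_mul, mul_one, nsmul_eq_mul] at e
    rw [e, Polynomial.eval_finsetSum]
    have key : ∀ N, ∀ a : ℕ → ℝ, (∀ k, N ≤ k → a k = 0) → ∀ M, N ≤ M →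
        ∑ k ∈ Finset.range M, a k = ∑ k ∈ Finset.range N, a k := by
      intro N a ha M hM
      symm
      apply Finset.sum_subset (Finset.range_mono hM)
      intro k _ hk
      exact ha k (by simpa using hk)
    have hterm : ∀ k, ((j.choose k : ℕ) : ℝ) * (fwdDiff 1)^[k] g 0 =
        Polynomial.eval (j : ℝ) (Polynomial.C ((fwdDiff 1)^[k] g 0 / (k.factorial : ℝ)) *
          descPochhammer ℝ k) := by
      intro k
      rw [Polynomial.eval_mul, Polynomial.eval_C, descPochhammer_eval_eq_descFactorial,
        Nat.descFactorial_eq_factorial_mul_choose]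
      have : (k.factorial : ℝ) ≠ 0 := by exact_mod_cast Nat.factorial_ne_zero k
      push_cast
      field_simp
    have k1 := key (j + 1) (fun k => ((j.choose k : ℕ) : ℝ) * (fwdDiff 1)^[k] g 0)
      (by intro k hk; simp [Nat.choose_eq_zero_of_lt (show j < k by omega)]) (j + 1 + (D + 2)) (by omega)
    have k2 := key (D + 2) (fun k => ((j.choose k : ℕ) : ℝ) * (fwdDiff 1)^[k] g 0)
      (by intro k hk; simp [h0 k hk]) (j + 1 + (D + 2)) (by omega)
    rw [← k1, k2]
    exact Finset.sum_congr rfl fun k _ => hterm k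

theorem polyOn_of_diff {D : ℕ} {f : ℝ → ℝ} (hf : ContinuousOn f (Set.Ici 0))
    (h : ∀ b, 0 < b → PolyOn D (fun a => f (a + b) - f a)) : PolyOn (D + 1) f := by
  have key : ∀ m j : ℕ, 0 < m → f ((j : ℝ) / m) =
      ∑ k ∈ Finset.range (D + 1 + 1), f (k : ℝ) * (lag (D + 1) k).eval ((j : ℝ) / m) := by
    intro m j hm
    have hm' : (0 : ℝ) < m := by exact_mod_cast hm
    obtain ⟨p, hp, hpe⟩ := h (1 / m) (by positivity)
    obtain ⟨q, hq, hqe⟩ := seq_poly (D := D) (fun j : ℕ => f ((j : ℝ) / m))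
      (p.comp (Polynomial.C (1 / (m : ℝ)) * Polynomial.X)) (by
        refine Polynomial.natDegree_comp_le.trans ?_
        have := (Polynomial.natDegree_C_mul_le (1 / (m : ℝ)) Polynomial.X).trans Polynomial.natDegree_X_le
        nlinarith) (by
        intro j
        have := hpe (j / m) (by positivity)
        simp only [Polynomial.eval_comp, Polynomial.eval_mul, Polynomial.eval_C, Polynomial.eval_X]
        rw [show 1 / (m : ℝ) * j = j / m by ring, ← this]
        congr 2
        push_cast; ring)
    have e := poly_eq_lag (q.comp (Polynomial.C (m : ℝ) * Polynomial.X)) (D := D + 1) (by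
        refine Polynomial.natDegree_comp_le.trans ?_
        have := (Polynomial.natDegree_C_mul_le (m : ℝ) Polynomial.X).trans Polynomial.natDegree_X_le
        nlinarith) ((j : ℝ) / m)
    simp only [Polynomial.eval_comp, Polynomial.eval_mul, Polynomial.eval_C, Polynomial.eval_X] at e
    rw [show (m : ℝ) * (j / m) = j by field_simp, ← hqe] at e
    rw [e]
    apply Finset.sum_congr rfl
    intro k _
    have := hqe (m * k)
    push_cast at this
    rw [← this, show (m : ℝ) * k / m = k by field_simp]
  refine (lag_sum_polyOn (D + 1) fun k => f k).congr fun t ht => ?_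
  have hc : Continuous fun t : ℝ => ∑ k ∈ Finset.range (D + 1 + 1),
      f (k : ℝ) * (lag (D + 1) k).eval t := by
    apply continuous_finsetSum
    intro k _
    exact continuous_const.mul (Polynomial.continuous _)
  have hseq : Filter.Tendsto (fun m : ℕ => ((⌊t * m⌋₊ : ℕ) : ℝ) / m) Filter.atTop (nhds t) :=
    (tendsto_nat_floor_mul_div_atTop ht).comp tendsto_natCast_atTop_atTop
  have h1 : Filter.Tendsto (fun m : ℕ => f (((⌊t * m⌋₊ : ℕ) : ℝ) / m)) Filter.atTop
      (nhds (f t)) := by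
    have := hf t ht
    refine this.tendsto.comp (tendsto_nhdsWithin_iff.mpr ⟨hseq, ?_⟩)
    filter_upwards with m
    exact Set.mem_Ici.mpr (by positivity)
  have h2 := (hc.tendsto t).comp hseq
  refine tendsto_nhds_unique h1 (h2.congr' ?_)
  filter_upwards [Filter.eventually_gt_atTop 0] with m hm
  exact (key m _ hm).symm

/-! ### Real valued valuations -/

/-- continuous translation invariant real valued valuations -/
structure IsVal {n : ℕ} (μ : ConvexBody (En n) → ℝ) : Prop where
  val : ∀ K L M N : ConvexBody (En n),
    (M : Set (En n)) = (K : Set (En n)) ∪ (L : Set (En n)) →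
    (N : Set (En n)) = (K : Set (En n)) ∩ (L : Set (En n)) → μ M + μ N = μ K + μ L
  cont : Continuous μ
  trans : ∀ (x : En n) (K : ConvexBody (En n)), μ (K + ptB x) = μ K

theorem seg_inter {n : ℕ} {A B : Set (En n)} (hA : IsClosed A) (hB : IsClosed B) {a b : En n}
    (ha : a ∈ A) (hb : b ∈ B) (h : segment ℝ a b ⊆ A ∪ B) :
    ∃ c ∈ segment ℝ a b, c ∈ A ∧ c ∈ B := by
  have hc : IsPreconnected (segment ℝ a b) := (convex_segment a b).isPreconnected
  rw [isPreconnected_closed_iff] at hc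
  obtain ⟨c, h1, h2⟩ := hc A B hA hB h ⟨a, left_mem_segment ℝ a b, ha⟩
    ⟨b, right_mem_segment ℝ a b, hb⟩
  exact ⟨c, h1, h2⟩

theorem hs_union {n : ℕ} {K L M : ConvexBody (En n)}
    (hM : (M : Set (En n)) = (K : Set (En n)) ∪ (L : Set (En n))) (u : En n) :
    hs M u = max (hs K u) (hs L u) := by
  apply le_antisymm
  · rw [hs_le_iff]
    intro x hx
    rw [hM] at hx
    rcases hx with hx | hx
    · exact le_max_of_le_left (le_hs K u hx)
    · exact le_max_of_le_right (le_hs L u hx)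
  · apply max_le
    · exact (body_subset_iff K M).mp (by rw [hM]; exact subset_union_left) u
    · exact (body_subset_iff L M).mp (by rw [hM]; exact subset_union_right) u

theorem hs_inter {n : ℕ} {K L M N : ConvexBody (En n)}
    (hM : (M : Set (En n)) = (K : Set (En n)) ∪ (L : Set (En n)))
    (hN : (N : Set (En n)) = (K : Set (En n)) ∩ (L : Set (En n))) (u : En n) :
    hs N u = min (hs K u) (hs L u) := by
  apply le_antisymm
  · apply le_min
    · exact (body_subset_iff N K).mp (by rw [hN]; exact inter_subset_left) u
    · exact (body_subset_iff N L).mp (by rw [hN]; exact inter_subset_right) u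
  · obtain ⟨a, ha, h1⟩ := hs_exists K u
    obtain ⟨b, hb, h2⟩ := hs_exists L u
    obtain ⟨c, ⟨s, t, hs0, ht0, hst, rfl⟩, hcK, hcL⟩ := seg_inter K.isClosed L.isClosed ha hb (by
      rw [← hM]
      exact M.convex.segment_subset (by rw [hM]; exact Or.inl ha) (by rw [hM]; exact Or.inr hb))
    have h3 : inner ℝ (s • a + t • b) u ≤ hs N u := le_hs N u (by rw [hN]; exact ⟨hcK, hcL⟩)
    refine le_trans ?_ h3
    rw [inner_add_left, real_inner_smul_left, real_inner_smul_left, h1, h2]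
    have e1 := mul_le_mul_of_nonneg_left (min_le_left (hs K u) (hs L u)) hs0
    have e2 := mul_le_mul_of_nonneg_left (min_le_right (hs K u) (hs L u)) ht0
    calc min (hs K u) (hs L u) = s * min (hs K u) (hs L u) + t * min (hs K u) (hs L u) := by
          rw [← add_mul, hst, one_mul]
      _ ≤ _ := add_le_add e1 e2

theorem hs_lip {n : ℕ} (K : ConvexBody (En n)) {R : ℝ}
    (hK : (K : Set (En n)) ⊆ closedBall 0 R) (u v : En n) : |hs K u - hs K v| ≤ R * ‖u - v‖ := by
  have key : ∀ u v : En n, hs K u - hs K v ≤ R * ‖u - v‖ := by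
    intro u v
    obtain ⟨x, hx, h1⟩ := hs_exists K u
    have h2 := le_hs K v hx
    have h3 : ‖x‖ ≤ R := by simpa using hK hx
    have h4 := real_inner_le_norm x (u - v)
    rw [inner_sub_right] at h4
    have h5 : ‖x‖ * ‖u - v‖ ≤ R * ‖u - v‖ := by gcongr
    linarith
  rw [abs_le]
  constructor
  · have := key v u
    rw [norm_sub_rev] at this; linarith
  · exact key u v

theorem body_bdd {n : ℕ} (K : ConvexBody (En n)) :
    ∃ R, 0 ≤ R ∧ (K : Set (En n)) ⊆ closedBall 0 R := by
  obtain ⟨R, hR⟩ := K.isBounded.subset_closedBall 0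
  exact ⟨max R 0, le_max_right _ _, hR.trans (closedBall_subset_closedBall (le_max_left _ _))⟩

theorem continuous_hs {n : ℕ} (K : ConvexBody (En n)) : Continuous (hs K) := by
  obtain ⟨R, hR0, hR⟩ := body_bdd K
  apply LipschitzWith.continuous (K := ⟨R, hR0⟩)
  apply LipschitzWith.of_dist_le_mul
  intro u v
  rw [Real.dist_eq, dist_eq_norm]
  exact hs_lip K hR u v

/-- the geometric part of locality -/
theorem union_of_max_min {n : ℕ} {K0 K1 K2 K3 : ConvexBody (En n)}
    (hmax : ∀ u, hs K3 u = max (hs K1 u) (hs K2 u))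
    (hmin : ∀ u, hs K0 u = min (hs K1 u) (hs K2 u)) :
    (K3 : Set (En n)) = (K1 : Set (En n)) ∪ (K2 : Set (En n)) ∧
    (K0 : Set (En n)) = (K1 : Set (En n)) ∩ (K2 : Set (En n)) := by
  constructor
  · apply Subset.antisymm
    · intro x hx
      by_contra hcon
      rw [mem_union, not_or, mem_body_iff, mem_body_iff] at hcon
      push Not at hcon
      obtain ⟨⟨u1, h1⟩, ⟨u2, h2⟩⟩ := hcon
      have hx3 : ∀ u, inner ℝ x u ≤ hs K3 u := (mem_body_iff K3 x).mp hx
      have hneg : ∀ u ∈ segment ℝ u1 u2, hs K0 u < inner ℝ x u := by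
        rintro u ⟨s, t, hs0, ht0, hst, rfl⟩
        have e1 : hs K0 u1 < inner ℝ x u1 := lt_of_le_of_lt (by rw [hmin]; exact min_le_left _ _) h1
        have e2 : hs K0 u2 < inner ℝ x u2 := lt_of_le_of_lt (by rw [hmin]; exact min_le_right _ _) h2
        have e3 := hs_add_arg K0 (s • u1) (t • u2)
        rw [hs_smul_arg _ hs0, hs_smul_arg _ ht0] at e3
        rw [inner_add_right, real_inner_smul_right, real_inner_smul_right]
        rcases hs0.lt_or_eq with hs' | hs'
        · have := mul_lt_mul_of_pos_left e1 hs'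
          have := mul_le_mul_of_nonneg_left e2.le ht0
          linarith
        · have ht' : t = 1 := by linarith
          subst ht'
          rw [← hs'] at e3 ⊢
          linarith
      have hc1 : IsClosed {u | inner ℝ x u ≤ hs K1 u} :=
        isClosed_le (by fun_prop) (continuous_hs K1)
      have hc2 : IsClosed {u | inner ℝ x u ≤ hs K2 u} :=
        isClosed_le (by fun_prop) (continuous_hs K2)
      obtain ⟨c, hc, hcA, hcB⟩ := seg_inter (a := u1) (b := u2) hc2 hc1
        (by
          have := hx3 u1
          rw [hmax] at this
          rcases le_max_iff.mp this with h | h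
          · exact absurd h (not_le.mpr h1)
          · exact h)
        (by
          have := hx3 u2
          rw [hmax] at this
          rcases le_max_iff.mp this with h | h
          · exact h
          · exact absurd h (not_le.mpr h2))
        (by
          intro u _
          have := hx3 u
          rw [hmax] at this
          rcases le_max_iff.mp this with h | h
          · exact Or.inr h
          · exact Or.inl h)
      have h5 := hneg c hc
      rw [hmin] at h5
      exact absurd (le_min hcB hcA) (not_le.mpr h5)
    · apply union_subset
      · rw [body_subset_iff]; intro u; rw [hmax]; exact le_max_left _ _
      · rw [body_subset_iff]; intro u; rw [hmax]; exact le_max_right _ _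
  · apply Subset.antisymm
    · apply subset_inter
      · rw [body_subset_iff]; intro u; rw [hmin]; exact min_le_left _ _
      · rw [body_subset_iff]; intro u; rw [hmin]; exact min_le_right _ _
    · rintro x ⟨h1, h2⟩
      rw [mem_body_iff]
      intro u
      rw [hmin]
      exact le_min (le_hs K1 u h1) (le_hs K2 u h2)

theorem IsVal.max_min {n : ℕ} {μ : ConvexBody (En n) → ℝ} (hμ : IsVal μ)
    {K0 K1 K2 K3 : ConvexBody (En n)}
    (hmax : ∀ u, hs K3 u = max (hs K1 u) (hs K2 u))
    (hmin : ∀ u, hs K0 u = min (hs K1 u) (hs K2 u)) : μ K3 + μ K0 = μ K1 + μ K2 := by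
  obtain ⟨h1, h2⟩ := union_of_max_min hmax hmin
  exact hμ.val K1 K2 K3 K0 h1 h2

theorem dist_add_left_body {n : ℕ} (K A B : ConvexBody (En n)) : dist (K + A) (K + B) ≤ dist A B := by
  apply dist_le_of_hs dist_nonneg
  intro u hu
  rw [hs_add, hs_add, add_sub_add_left_eq_sub]
  simpa [hu] using abs_hs_sub_le A B u

theorem IsVal.shift {n : ℕ} {μ : ConvexBody (En n) → ℝ} (hμ : IsVal μ) (K : ConvexBody (En n)) :
    IsVal (fun A => μ (K + A)) where
  val := by
    intro A B M N hM hN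
    apply hμ.max_min
    · intro u; rw [hs_add, hs_add, hs_add, hs_union hM, max_add_add_left]
    · intro u; rw [hs_add, hs_add, hs_add, hs_inter hM hN, min_add_add_left]
  cont := by
    refine hμ.cont.comp ?_
    apply LipschitzWith.continuous (K := 1)
    apply LipschitzWith.of_dist_le_mul
    intro A B
    simpa using dist_add_left_body K A B
  trans := by
    intro x A
    rw [← add_assoc, hμ.trans]

theorem IsVal.bdd {n : ℕ} {μ : ConvexBody (En n) → ℝ} (hμ : IsVal μ) (R : ℝ) (hR : 0 ≤ R) :
    ∃ C, ∀ K : ConvexBody (En n), (K : Set (En n)) ⊆ closedBall 0 R → |μ K| ≤ C := by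
  have hcomp : IsCompact (Set.pi Set.univ fun u : En n => Set.Icc (-(R * ‖u‖)) (R * ‖u‖)) :=
    isCompact_univ_pi fun u => isCompact_Icc
  have key : ∃ C, ∀ K : ConvexBody (En n), (K : Set (En n)) ⊆ closedBall 0 R →
      hs K ∈ (Set.pi Set.univ fun u : En n => Set.Icc (-(R * ‖u‖)) (R * ‖u‖)) → |μ K| ≤ C := by
    refine hcomp.induction_on (p := fun s => ∃ C, ∀ K : ConvexBody (En n),
      (K : Set (En n)) ⊆ closedBall 0 R → hs K ∈ s → |μ K| ≤ C) ?_ ?_ ?_ ?_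
    · exact ⟨0, fun K _ h => absurd h (Set.notMem_empty _)⟩
    · rintro s t hst ⟨C, hC⟩
      exact ⟨C, fun K hK h => hC K hK (hst h)⟩
    · rintro s t ⟨C, hC⟩ ⟨C', hC'⟩
      refine ⟨max C C', fun K hK h => ?_⟩
      rcases h with h | h
      · exact le_max_of_le_left (hC K hK h)
      · exact le_max_of_le_right (hC' K hK h)
    · intro h _
      by_cases hsub : Sublin h
      · obtain ⟨L, hL⟩ := hsub.exists_body
        have hc := Metric.continuous_iff.mp hμ.cont L 1 one_pos
        obtain ⟨δ, hδ, hcl⟩ := hc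
        obtain ⟨RL, hRL0, hRL⟩ := body_bdd L
        obtain ⟨ε, hε, hε2⟩ : ∃ ε : ℝ, 0 < ε ∧ ε + R * ε + RL * ε < δ := by
          refine ⟨δ / (2 * (1 + R + RL)), by positivity, ?_⟩
          rw [show δ / (2 * (1 + R + RL)) + R * (δ / (2 * (1 + R + RL))) +
            RL * (δ / (2 * (1 + R + RL))) = δ / 2 by field_simp]
          linarith
        obtain ⟨F, hF1, hF2, hF3⟩ := (isCompact_sphere (0 : En n) 1).finite_cover_balls hε
        refine ⟨⋂ v ∈ F, {h' : En n → ℝ | |h' v - h v| < ε}, ?_, |μ L| + 1, ?_⟩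
        · apply mem_nhdsWithin_of_mem_nhds
          rw [Filter.biInter_mem hF2]
          intro v _
          apply IsOpen.mem_nhds
          · exact isOpen_lt (by fun_prop) continuous_const
          · simpa using hε
        · intro K hK hKm
          have hd : dist K L < δ := by
            refine lt_of_le_of_lt (dist_le_of_hs (ε := ε + R * ε + RL * ε) (by positivity) ?_) hε2
            intro u hu
            have := hF3 (show u ∈ sphere (0 : En n) 1 by simpa using hu)
            simp only [mem_iUnion, mem_ball, exists_prop] at this
            obtain ⟨v, hv, huv⟩ := this
            rw [dist_eq_norm] at huv
            simp only [mem_iInter] at hKm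
            have e1 : |hs K v - h v| < ε := hKm v hv
            have e2 := hs_lip K hK u v
            have e3 := hs_lip L hRL u v
            rw [← hL] at e1
            have e4 : R * ‖u - v‖ ≤ R * ε := by gcongr
            have e5 : RL * ‖u - v‖ ≤ RL * ε := by gcongr
            rw [abs_le] at *
            rw [abs_lt] at e1
            constructor <;> linarith [e1.1, e1.2, e2.1, e2.2, e3.1, e3.2]
          have h3 := hcl K hd
          rw [Real.dist_eq] at h3
          have h4 := abs_sub_abs_le_abs_sub (μ K) (μ L)
          linarith
      · unfold Sublin at hsub
        rw [not_and_or] at hsub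
        push Not at hsub
        rcases hsub with ⟨c, hc, x, hx⟩ | ⟨x, y, hxy⟩
        · refine ⟨{h' | h' (c • x) ≠ c * h' x}, ?_, 0, ?_⟩
          · apply mem_nhdsWithin_of_mem_nhds
            exact IsOpen.mem_nhds (isOpen_ne_fun (by fun_prop) (by fun_prop)) hx
          · intro K _ hK
            exact absurd (hs_smul_arg K hc.le x) hK
        · refine ⟨{h' | h' x + h' y < h' (x + y)}, ?_, 0, ?_⟩
          · apply mem_nhdsWithin_of_mem_nhds
            exact IsOpen.mem_nhds (isOpen_lt (by fun_prop) (by fun_prop)) hxy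
          · intro K _ hK
            exact absurd (hs_add_arg K x y) (not_le.mpr hK)
  obtain ⟨C, hC⟩ := key
  refine ⟨C, fun K hK => hC K hK ?_⟩
  intro u _
  have := hs_lip K hK u 0
  rw [(sublin_hs K).zero, sub_zero, sub_zero, abs_le] at this
  exact this

/-! ### Growth of valuations -/

/-- a body intersected with a closed convex set -/
def interB {n : ℕ} (K : ConvexBody (En n)) (S : Set (En n)) (h1 : Convex ℝ S) (h2 : IsClosed S)
    (h3 : ((K : Set (En n)) ∩ S).Nonempty) : ConvexBody (En n) :=
  ⟨(K : Set (En n)) ∩ S, K.convex.inter h1, K.isCompact.inter_right h2, h3⟩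

theorem coe_interB {n : ℕ} (K : ConvexBody (En n)) (S : Set (En n)) (h1 : Convex ℝ S)
    (h2 : IsClosed S) (h3 : ((K : Set (En n)) ∩ S).Nonempty) :
    (interB K S h1 h2 h3 : Set (En n)) = (K : Set (En n)) ∩ S := rfl

theorem cut_bound {n : ℕ} {μ : ConvexBody (En n) → ℝ} (hμ : IsVal μ) (K : ConvexBody (En n))
    (i : Fin n) (c C : ℝ)
    (h1 : ∀ L : ConvexBody (En n), (L : Set (En n)) ⊆ (K : Set (En n)) ∩ {x | x i ≤ c} → |μ L| ≤ C)
    (h2 : ∀ L : ConvexBody (En n), (L : Set (En n)) ⊆ (K : Set (En n)) ∩ {x | c ≤ x i} → |μ L| ≤ C) :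
    |μ K| ≤ 3 * C := by
  have lin : IsLinearMap ℝ (fun x : En n => x i) := ⟨fun _ _ => rfl, fun _ _ => rfl⟩
  have c1 : Convex ℝ {x : En n | x i ≤ c} := convex_halfSpace_le lin c
  have c2 : Convex ℝ {x : En n | c ≤ x i} := convex_halfSpace_ge lin c
  have k1 : IsClosed {x : En n | x i ≤ c} := isClosed_le (by fun_prop) continuous_const
  have k2 : IsClosed {x : En n | c ≤ x i} := isClosed_le continuous_const (by fun_prop)
  have ub : ∀ S T : Set (En n), (K : Set (En n)) ∩ S = ∅ → S ∪ T = univ →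
      (K : Set (En n)) ⊆ (K : Set (En n)) ∩ T := by
    intro S T hS hST x hx
    refine ⟨hx, ?_⟩
    have : x ∈ S ∪ T := by rw [hST]; trivial
    rcases this with h | h
    · exact absurd (show x ∈ (K : Set (En n)) ∩ S from ⟨hx, h⟩) (by rw [hS]; simp)
    · exact h
  have hun : {x : En n | x i ≤ c} ∪ {x : En n | c ≤ x i} = univ := by
    ext x; simp [le_total]
  rcases Set.eq_empty_or_nonempty ((K : Set (En n)) ∩ {x | x i ≤ c}) with e1 | e1
  · have := h2 K (ub _ _ e1 hun)
    have := abs_nonneg (μ K)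
    linarith
  rcases Set.eq_empty_or_nonempty ((K : Set (En n)) ∩ {x | c ≤ x i}) with e2 | e2
  · have := h1 K (ub _ _ e2 (by rw [union_comm]; exact hun))
    have := abs_nonneg (μ K)
    linarith
  have hcov : (K : Set (En n)) = ((K : Set (En n)) ∩ {x | x i ≤ c}) ∪
      ((K : Set (En n)) ∩ {x | c ≤ x i}) := by
    rw [← inter_union_distrib_left, hun, inter_univ]
  have e3 : ((K : Set (En n)) ∩ ({x : En n | x i ≤ c} ∩ {x : En n | c ≤ x i})).Nonempty := by
    obtain ⟨a, ha⟩ := e1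
    obtain ⟨b, hb⟩ := e2
    obtain ⟨x, _, hx1, hx2⟩ := seg_inter (K.isClosed.inter k1) (K.isClosed.inter k2) ha hb (by
      rw [← hcov]; exact K.convex.segment_subset ha.1 hb.1)
    exact ⟨x, hx1.1, hx1.2, hx2.2⟩
  have hv := hμ.val (interB K _ c1 k1 e1) (interB K _ c2 k2 e2) K
    (interB K _ (c1.inter c2) (k1.inter k2) e3) (by rw [coe_interB, coe_interB]; exact hcov)
    (by rw [coe_interB, coe_interB, coe_interB, inter_inter_distrib_left])
  have b1 := h1 (interB K _ c1 k1 e1) (by rw [coe_interB])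
  have b2 := h2 (interB K _ c2 k2 e2) (by rw [coe_interB])
  have b3 := h1 (interB K _ (c1.inter c2) (k1.inter k2) e3) (by
    rw [coe_interB]; exact inter_subset_inter_right _ inter_subset_left)
  rw [abs_le] at *
  constructor <;> linarith [b1.1, b1.2, b2.1, b2.2, b3.1, b3.2]

theorem box_bound {n : ℕ} {μ : ConvexBody (En n) → ℝ} (hμ : IsVal μ) :
    ∃ C, 0 ≤ C ∧ ∀ (m : ℕ) (e : Fin n → ℕ) (a : En n) (K : ConvexBody (En n)), ∑ i, e i = m →
      (∀ x ∈ (K : Set (En n)), ∀ i, a i ≤ x i ∧ x i ≤ a i + 2 ^ e i) → |μ K| ≤ C * 3 ^ m := by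
  obtain ⟨C, hC⟩ := hμ.bdd (n : ℝ) (by positivity)
  refine ⟨max C 0, le_max_right _ _, ?_⟩
  intro m
  induction m with
  | zero =>
    intro e a K he hK
    rw [pow_zero, mul_one]
    rw [← hμ.trans (-a) K]
    refine (hC _ ?_).trans (le_max_left _ _)
    rintro x ⟨y, hy, z, hz, rfl⟩
    simp only [coe_ptB, mem_singleton_iff] at hz
    subst hz
    rw [mem_closedBall_zero_iff]
    have h1 : ∀ i, |(y + -a) i| ≤ 1 := by
      intro i
      have h2 := hK y hy i
      have he0 : e i = 0 := by
        have := Finset.sum_eq_zero_iff.mp he i (Finset.mem_univ i); exact this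
      rw [he0, pow_zero] at h2
      have : (y + -a) i = y i - a i := by simp [sub_eq_add_neg]
      rw [this, abs_le]
      constructor <;> linarith [h2.1, h2.2]
    have hx : (y + -a) = ∑ i, ((y + -a) i) • (EuclideanSpace.single i (1 : ℝ)) := by
      conv_lhs => rw [← (EuclideanSpace.basisFun (Fin n) ℝ).sum_repr (y + -a)]
      simp
    change ‖y + -a‖ ≤ _
    rw [hx]
    refine (norm_sum_le _ _).trans ?_
    calc _ ≤ ∑ i : Fin n, (1 : ℝ) := by
            apply Finset.sum_le_sum
            intro i _
            rw [norm_smul, Real.norm_eq_abs]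
            simpa using h1 i
      _ = n := by simp
  | succ m ih =>
    intro e a K he hK
    obtain ⟨i, hi⟩ : ∃ i, 0 < e i := by
      by_contra hcon
      push Not at hcon
      have : ∑ i, e i = 0 := Finset.sum_eq_zero fun i _ => by have := hcon i; omega
      omega
    let e' := Function.update e i (e i - 1)
    have he' : ∑ j, e' j = m := by
      have h1 := Finset.add_sum_erase Finset.univ e (Finset.mem_univ i)
      have h2 := Finset.add_sum_erase Finset.univ e' (Finset.mem_univ i)
      have h3 : ∑ j ∈ Finset.univ.erase i, e' j = ∑ j ∈ Finset.univ.erase i, e j := by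
        apply Finset.sum_congr rfl
        intro j hj
        exact Function.update_of_ne (Finset.ne_of_mem_erase hj) _ _
      have h4 : e' i = e i - 1 := Function.update_self _ _ _
      omega
    have hpow : (2 : ℝ) ^ e i = 2 * 2 ^ (e i - 1) := by
      rw [← pow_succ', Nat.sub_add_cancel hi]
    have := cut_bound hμ K i (a i + 2 ^ (e i - 1)) (max C 0 * 3 ^ m) (by
      intro L hL
      apply ih e' a L he'
      intro x hx j
      have hx' := hL hx
      by_cases hj : j = i
      · subst hj
        simp only [e', Function.update_self]
        exact ⟨(hK x hx'.1 j).1, hx'.2⟩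
      · simp only [e', Function.update_of_ne hj]
        exact hK x hx'.1 j) (by
      intro L hL
      apply ih e' (a + EuclideanSpace.single i ((2 : ℝ) ^ (e i - 1))) L he'
      intro x hx j
      have hx' := hL hx
      by_cases hj : j = i
      · subst hj
        simp only [e', Function.update_self, PiLp.add_apply, PiLp.single_apply, if_true]
        have h1 := (hK x hx'.1 j).2
        have h2 : a j + 2 ^ (e j - 1) ≤ x j := hx'.2
        constructor <;> linarith
      · simp only [e', Function.update_of_ne hj, PiLp.add_apply, PiLp.single_apply, hj, if_false,
          add_zero]
        exact hK x hx'.1 j)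
    rw [pow_succ]
    linarith

theorem IsVal.growth {n : ℕ} {μ : ConvexBody (En n) → ℝ} (hμ : IsVal μ) :
    ∃ C, 0 ≤ C ∧ ∀ (R : ℝ) (K : ConvexBody (En n)), 0 ≤ R →
      (K : Set (En n)) ⊆ closedBall 0 R → |μ K| ≤ C * (1 + R) ^ (2 * n) := by
  obtain ⟨C, hC0, hC⟩ := box_bound hμ
  refine ⟨C * 4 ^ (2 * n), by positivity, fun R K hR hK => ?_⟩
  obtain ⟨m, hm1, hm2⟩ := exists_nat_pow_near (x := 1 + R) (y := 2) (by linarith) (by norm_num)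
  have h1 := hC (n * (m + 2)) (fun _ => m + 2) (WithLp.toLp 2 fun _ => -(2 : ℝ) ^ (m + 1)) K
    (by simp) (by
      intro x hx i
      have h2 : ‖x‖ ≤ R := by simpa using hK hx
      have h3 : |x i| ≤ ‖x‖ := by simpa using PiLp.norm_apply_le x i
      rw [abs_le] at h3
      have h4 : (2 : ℝ) ^ (m + 2) = 2 * 2 ^ (m + 1) := by ring
      simp only
      rw [h4]
      constructor <;> linarith [h3.1, h3.2])
  refine h1.trans ?_
  rw [mul_assoc]
  apply mul_le_mul_of_nonneg_left _ hC0
  calc (3 : ℝ) ^ (n * (m + 2)) ≤ 4 ^ (n * (m + 2)) := by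
        apply pow_le_pow_left₀ <;> norm_num
    _ = (4 * 2 ^ m) ^ (2 * n) := by
        rw [show (4 : ℝ) = 2 ^ 2 by norm_num, ← pow_mul, ← pow_add, ← pow_mul]
        congr 1; ring
    _ ≤ (4 * (1 + R)) ^ (2 * n) := by gcongr
    _ = _ := by rw [mul_pow]

/-! ### Polynomiality -/

/-- `t ↦ ν (t L)` is polynomial for all valuations -/
def Good {n : ℕ} (L : ConvexBody (En n)) : Prop :=
  ∀ ν : ConvexBody (En n) → ℝ, IsVal ν → PolyOn (2 * n) (fun t => ν (t • L))

theorem smul_body_subset {n : ℕ} (L : ConvexBody (En n)) {R t : ℝ} (ht : 0 ≤ t)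
    (hL : (L : Set (En n)) ⊆ closedBall 0 R) :
    ((t • L : ConvexBody (En n)) : Set (En n)) ⊆ closedBall 0 (t * R) := by
  rintro x ⟨y, hy, rfl⟩
  have h1 : ‖y‖ ≤ R := by simpa using hL hy
  rw [mem_closedBall_zero_iff, norm_smul, Real.norm_eq_abs, abs_of_nonneg ht]
  gcongr

theorem good_of_poly {n : ℕ} {L : ConvexBody (En n)}
    (h : ∀ ν : ConvexBody (En n) → ℝ, IsVal ν → ∃ E, PolyOn E (fun t => ν (t • L))) : Good L := by
  intro ν hν
  obtain ⟨E, hE⟩ := h ν hν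
  obtain ⟨C, hC0, hC⟩ := hν.growth
  obtain ⟨R, hR0, hR⟩ := body_bdd L
  refine hE.reduce (C * (1 + R) ^ (2 * n)) fun t ht => ?_
  refine (hC (t * R) _ (by positivity) (smul_body_subset L (by linarith) hR)).trans ?_
  rw [mul_assoc, ← mul_pow]
  gcongr
  nlinarith

theorem good_zero {n : ℕ} : Good (0 : ConvexBody (En n)) := by
  intro ν _
  exact (PolyOn.const _ (ν 0)).congr fun t ht => by
    have e : t • (0 : ConvexBody (En n)) = 0 := by
      apply hs_ext; intro u; rw [hs_smul ht, hs_zero, mul_zero]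
    simp only [e]

theorem good_translate {n : ℕ} {L : ConvexBody (En n)} (h : Good L) (x : En n) :
    Good (L + ptB x) := by
  intro ν hν
  refine (h ν hν).congr fun t ht => ?_
  have e : t • (L + ptB x) = t • L + ptB (t • x) := by
    apply hs_ext; intro u
    rw [hs_smul ht, hs_add, hs_add, hs_smul ht, hs_ptB, hs_ptB, real_inner_smul_left]; ring
  rw [e, hν.trans]

theorem dist_smul_body {n : ℕ} (T : ConvexBody (En n)) {R : ℝ} (hR : 0 ≤ R)
    (hT : (T : Set (En n)) ⊆ closedBall 0 R) {a b : ℝ} (ha : 0 ≤ a) (hb : 0 ≤ b) :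
    dist (a • T) (b • T) ≤ |a - b| * R := by
  apply dist_le_of_hs (by positivity)
  intro u hu
  rw [hs_smul ha, hs_smul hb, ← sub_mul, abs_mul]
  have := hs_lip T hT u 0
  rw [(sublin_hs T).zero, sub_zero, sub_zero, hu, mul_one] at this
  gcongr

theorem continuousOn_smul_body {n : ℕ} (T : ConvexBody (En n)) :
    ContinuousOn (fun t : ℝ => t • T) (Set.Ici 0) := by
  obtain ⟨R, hR0, hR⟩ := body_bdd T
  apply LipschitzOnWith.continuousOn (K := ⟨R, hR0⟩)
  apply LipschitzOnWith.of_dist_le_mul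
  intro a ha b hb
  rw [Real.dist_eq, mul_comm]
  exact dist_smul_body T hR0 hR ha hb

theorem good_cone {n : ℕ} {F T : ConvexBody (En n)} (hF : Good F)
    (hT : ∀ u, hs T u = max 0 (hs F u)) : Good T := by
  apply good_of_poly
  intro ν hν
  refine ⟨2 * n + 1, polyOn_of_diff ?_ ?_⟩
  · exact hν.cont.comp_continuousOn (continuousOn_smul_body T)
  · intro b hb
    have h1 := (hF _ (hν.shift (b • T))).add ((hF ν hν).const_mul (-1))
    refine h1.congr fun a ha => ?_
    have key : ν ((a + b) • T) + ν (a • F) = ν (a • T) + ν (b • T + a • F) := by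
      apply hν.max_min
      · intro u
        rw [hs_add, hs_smul ha, hs_smul hb.le, hs_smul ha, hs_smul (by positivity), hT]
        rcases le_total 0 (hs F u) with h | h
        · rw [max_eq_right h, max_eq_right]
          · ring
          · nlinarith
        · rw [max_eq_left h, max_eq_left]
          · ring
          · nlinarith
      · intro u
        rw [hs_add, hs_smul ha, hs_smul hb.le, hs_smul ha, hT]
        rcases le_total 0 (hs F u) with h | h
        · rw [max_eq_right h, min_eq_left]
          nlinarith
        · rw [max_eq_left h, min_eq_right]
          · ring
          · nlinarith
    linarith

theorem good_lim {n : ℕ} {L : ConvexBody (En n)}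
    (h : ∀ ε > 0, ∃ M : ConvexBody (En n), Good M ∧ dist M L ≤ ε) : Good L := by
  choose! M hM1 hM2 using h
  have hlim : Filter.Tendsto (fun m : ℕ => M (1 / ((m : ℝ) + 1))) Filter.atTop (nhds L) := by
    rw [tendsto_iff_dist_tendsto_zero]
    refine squeeze_zero (fun _ => dist_nonneg) (fun m => hM2 _ (by positivity)) ?_
    exact tendsto_one_div_add_atTop_nhds_zero_nat
  have hsm : ∀ t : ℝ, 0 ≤ t → Continuous fun K : ConvexBody (En n) => t • K := by
    intro t ht
    apply LipschitzWith.continuous (K := ⟨t, ht⟩)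
    apply LipschitzWith.of_dist_le_mul
    intro A B
    apply dist_le_of_hs (mul_nonneg ht dist_nonneg)
    intro u hu
    rw [hs_smul ht, hs_smul ht, ← mul_sub, abs_mul, abs_of_nonneg ht]
    have := abs_hs_sub_le A B u
    rw [hu, mul_one] at this
    exact mul_le_mul_of_nonneg_left this ht
  intro ν hν
  refine (lag_sum_polyOn (2 * n) fun k => ν ((k : ℝ) • L)).congr fun t ht => ?_
  have h1 : ∀ s : ℝ, 0 ≤ s → Filter.Tendsto (fun m : ℕ => ν (s • M (1 / ((m : ℝ) + 1))))
      Filter.atTop (nhds (ν (s • L))) := fun s hs0 =>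
    ((hν.cont.comp (hsm s hs0)).tendsto L).comp hlim
  refine tendsto_nhds_unique (h1 t ht) ?_
  have h2 : Filter.Tendsto (fun m : ℕ => ∑ k ∈ Finset.range (2 * n + 1),
      ν ((k : ℝ) • M (1 / ((m : ℝ) + 1))) * (lag (2 * n) k).eval t) Filter.atTop
      (nhds (∑ k ∈ Finset.range (2 * n + 1), ν ((k : ℝ) • L) * (lag (2 * n) k).eval t)) :=
    tendsto_finsetSum _ fun k _ => (h1 k (by positivity)).mul_const _
  refine h2.congr fun m => ?_
  exact ((hM1 (1 / ((m : ℝ) + 1)) (by positivity) ν hν).eq_lag ht).symm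

theorem hs_hull_le {n : ℕ} {K : ConvexBody (En n)} {S : Set (En n)}
    (hK : (K : Set (En n)) = convexHull ℝ S) (u : En n) (c : ℝ) :
    hs K u ≤ c ↔ ∀ x ∈ S, inner ℝ x u ≤ c := by
  rw [hs_le_iff, hK]
  constructor
  · intro h x hx; exact h x (subset_convexHull ℝ S hx)
  · intro h x hx
    have lin : IsLinearMap ℝ (fun x : En n => inner ℝ x u) :=
      ⟨fun _ _ => inner_add_left _ _ _, fun _ _ => real_inner_smul_left _ _ _⟩
    exact convexHull_min (t := {x | inner ℝ x u ≤ c}) h (convex_halfSpace_le lin c) hx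

/-- convex hull of finitely many points -/
def hullB {n : ℕ} (s : Finset (En n)) (h : s.Nonempty) : ConvexBody (En n) :=
  ⟨convexHull ℝ (s : Set (En n)), convex_convexHull ℝ _, Set.Finite.isCompact_convexHull (𝕜 := ℝ) s.finite_toSet,
    by simpa using h⟩

theorem good_hull {n : ℕ} (s : Finset (En n)) (h : s.Nonempty) : Good (hullB s h) := by
  classical
  induction s using Finset.induction_on with
  | empty => exact absurd h (by simp)
  | insert v s hv ih =>
    by_cases hs' : s.Nonempty
    · have h1 : Good (hullB (insert v s) h + ptB (-v)) := by
        apply good_cone (good_translate (ih hs') (-v))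
        intro u
        rw [hs_add, hs_add, hs_ptB]
        have : hs (hullB (insert v s) h) u = max (inner ℝ v u) (hs (hullB s hs') u) := by
          apply eq_of_forall_ge_iff
          intro c
          rw [hs_hull_le (S := ((insert v s : Finset (En n)) : Set (En n))) rfl, max_le_iff,
            hs_hull_le (K := hullB s hs') (S := (s : Set (En n))) rfl]
          simp
        rw [this, inner_neg_left, ← max_add_add_right, add_neg_cancel]
      have h2 := good_translate h1 v
      have e : hullB (insert v s) h + ptB (-v) + ptB v = hullB (insert v s) h := by
        apply hs_ext; intro u
        rw [hs_add, hs_add, hs_ptB, hs_ptB, inner_neg_left]; ring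
      rwa [e] at h2
    · rw [Finset.not_nonempty_iff_eq_empty] at hs'
      subst hs'
      have h2 := good_translate good_zero v
      have e : (0 : ConvexBody (En n)) + ptB v = hullB (insert v ∅) h := by
        apply ConvexBody.ext
        rw [zero_add]
        change {v} = convexHull ℝ ((insert v ∅ : Finset (En n)) : Set (En n))
        simp
      rwa [e] at h2

theorem exists_hull_near {n : ℕ} (L : ConvexBody (En n)) {ε : ℝ} (hε : 0 < ε) :
    ∃ (s : Finset (En n)) (h : s.Nonempty), dist (hullB s h) L ≤ ε := by
  classical
  obtain ⟨F, hF1, hF2, hF3⟩ := L.isCompact.finite_cover_balls hε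
  have hne : hF2.toFinset.Nonempty := by
    obtain ⟨x, hx⟩ := L.nonempty
    have := hF3 hx
    simp only [mem_iUnion, exists_prop] at this
    obtain ⟨v, hv, _⟩ := this
    exact ⟨v, by simpa using hv⟩
  refine ⟨hF2.toFinset, hne, ?_⟩
  rw [← ConvexBody.hausdorffDist_coe]
  have hcoe : (hullB hF2.toFinset hne : Set (En n)) = convexHull ℝ F := by
    change convexHull ℝ ((hF2.toFinset : Finset (En n)) : Set (En n)) = _
    simp
  apply Metric.hausdorffDist_le_of_mem_dist hε.le
  · intro x hx
    rw [hcoe] at hx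
    exact ⟨x, convexHull_min hF1 L.convex hx, by simpa using hε.le⟩
  · intro x hx
    have := hF3 hx
    simp only [mem_iUnion, exists_prop, mem_ball] at this
    obtain ⟨v, hv, hd⟩ := this
    exact ⟨v, by rw [hcoe]; exact subset_convexHull ℝ F hv, hd.le⟩

theorem good_all {n : ℕ} (L : ConvexBody (En n)) : Good L := by
  apply good_lim
  intro ε hε
  obtain ⟨s, h, hd⟩ := exists_hull_near L hε
  exact ⟨_, good_hull s h, hd⟩

theorem IsVal.poly {n : ℕ} {μ : ConvexBody (En n) → ℝ} (hμ : IsVal μ) (K L : ConvexBody (En n)) :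
    PolyOn (2 * n) (fun t => μ (K + t • L)) := good_all L _ (hμ.shift K)

/-! ### Extension of valuations to functions on the sphere -/

/-- `K` has support function `r + f` on the unit sphere -/
def SRep {n : ℕ} (f : En n → ℝ) (r : ℝ) (K : ConvexBody (En n)) : Prop :=
  ∀ u, ‖u‖ = 1 → hs K u = r + f u

/-- functions which are support functions up to a constant -/
def Nice {n : ℕ} (f : En n → ℝ) : Prop := ∃ r K, SRep f r K

theorem hs_ext_sphere {n : ℕ} {K L : ConvexBody (En n)} (h : ∀ u, ‖u‖ = 1 → hs K u = hs L u) :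
    K = L := by
  apply dist_le_zero.mp
  apply dist_le_of_hs le_rfl
  intro u hu
  rw [h u hu, sub_self, abs_zero]

theorem SRep.unique {n : ℕ} {f : En n → ℝ} {r : ℝ} {K L : ConvexBody (En n)} (h1 : SRep f r K)
    (h2 : SRep f r L) : K = L :=
  hs_ext_sphere fun u hu => (h1 u hu).trans (h2 u hu).symm

theorem SRep.add_ball {n : ℕ} {f : En n → ℝ} {r : ℝ} {K : ConvexBody (En n)} (h : SRep f r K) {t : ℝ}
    (ht : 0 ≤ t) : SRep f (r + t) (K + t • UB n) := by
  intro u hu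
  rw [hs_add, hs_smul ht, hs_UB, h u hu, hu]; ring

theorem SRep.add {n : ℕ} {f g : En n → ℝ} {r s : ℝ} {K L : ConvexBody (En n)} (h : SRep f r K)
    (h' : SRep g s L) : SRep (fun u => f u + g u) (r + s) (K + L) := by
  intro u hu
  rw [hs_add, h u hu, h' u hu]; ring

theorem SRep.smul {n : ℕ} {f : En n → ℝ} {r : ℝ} {K : ConvexBody (En n)} (h : SRep f r K) {t : ℝ}
    (ht : 0 ≤ t) : SRep (fun u => t * f u) (t * r) (t • K) := by
  intro u hu
  rw [hs_smul ht, h u hu]; ring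

theorem poly_eq_of_ge {p q : Polynomial ℝ} (r0 : ℝ) (h : ∀ r, r0 ≤ r → p.eval r = q.eval r) :
    p = q := by
  apply Polynomial.eq_of_infinite_eval_eq
  exact (Set.Ici_infinite r0).mono fun r hr => h r hr

theorem natDegree_comp_shift (p : Polynomial ℝ) (c : ℝ) :
    (p.comp (Polynomial.X + Polynomial.C c)).natDegree ≤ p.natDegree := by
  refine Polynomial.natDegree_comp_le.trans ?_
  rw [Polynomial.natDegree_X_add_C, mul_one]

theorem Nice.exists_poly {n : ℕ} {μ : ConvexBody (En n) → ℝ} (hμ : IsVal μ) {f : En n → ℝ}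
    (hf : Nice f) :
    ∃ q : Polynomial ℝ, q.natDegree ≤ 2 * n ∧ ∀ r K, SRep f r K → μ K = q.eval r := by
  obtain ⟨r, K, h⟩ := hf
  obtain ⟨p, hp, hpe⟩ := hμ.poly K (UB n)
  refine ⟨p.comp (Polynomial.X + Polynomial.C (-r)), (natDegree_comp_shift p _).trans hp, ?_⟩
  intro r' K' h'
  simp only [Polynomial.eval_comp, Polynomial.eval_add, Polynomial.eval_X, Polynomial.eval_C]
  rcases le_total r r' with hr | hr
  · have h1 := h.add_ball (sub_nonneg.mpr hr)
    rw [show r + (r' - r) = r' by ring] at h1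
    rw [h'.unique h1, ← sub_eq_add_neg, ← hpe _ (sub_nonneg.mpr hr)]
  · obtain ⟨p', hp', hpe'⟩ := hμ.poly K' (UB n)
    have h1 := h'.add_ball (sub_nonneg.mpr hr)
    rw [show r' + (r - r') = r by ring] at h1
    have h2 := h1.unique h
    have e : p'.comp (Polynomial.X + Polynomial.C (r - r')) = p := by
      apply poly_eq_of_ge 0
      intro t ht
      rw [← hpe t ht, ← h2]
      simp only [Polynomial.eval_comp, Polynomial.eval_add, Polynomial.eval_X, Polynomial.eval_C]
      rw [← hpe' _ (by linarith)]
      show μ _ = μ _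
      congr 1
      apply hs_ext; intro u
      rw [hs_add, hs_add, hs_add, hs_smul (by linarith), hs_smul (by linarith), hs_smul ht]; ring
    rw [← e]
    simp only [Polynomial.eval_comp, Polynomial.eval_add, Polynomial.eval_X, Polynomial.eval_C]
    rw [show r' + -r + (r - r') = 0 by ring, ← hpe' 0 le_rfl]
    congr 1
    apply hs_ext; intro u
    rw [hs_add, hs_smul le_rfl]; ring

theorem Nice.large {n : ℕ} {f : En n → ℝ} (hf : Nice f) : ∃ r0, ∀ r, r0 ≤ r → ∃ K, SRep f r K := by
  obtain ⟨r0, K, h⟩ := hf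
  refine ⟨r0, fun r hr => ⟨K + (r - r0) • UB n, ?_⟩⟩
  have := h.add_ball (sub_nonneg.mpr hr)
  rwa [show r0 + (r - r0) = r by ring] at this

open Classical in
/-- extension of a valuation to nice functions on the sphere -/
def extV {n : ℕ} (μ : ConvexBody (En n) → ℝ) (f : En n → ℝ) : ℝ :=
  if h : ∃ q : Polynomial ℝ, q.natDegree ≤ 2 * n ∧ ∀ r K, SRep f r K → μ K = q.eval r then
    h.choose.eval 0 else 0

theorem extV_eq {n : ℕ} {μ : ConvexBody (En n) → ℝ} (hμ : IsVal μ) {f : En n → ℝ}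
    (hf : Nice f) (q : Polynomial ℝ) (r0 : ℝ) (hq : ∀ r K, r0 ≤ r → SRep f r K → μ K = q.eval r) :
    extV μ f = q.eval 0 := by
  have h := hf.exists_poly hμ
  unfold extV
  rw [dif_pos h]
  have h2 := h.choose_spec.2
  have : h.choose = q := by
    obtain ⟨r1, h1⟩ := hf.large
    apply poly_eq_of_ge (max r0 r1)
    intro r hr
    obtain ⟨K, hK⟩ := h1 r ((le_max_right _ _).trans hr)
    rw [← h2 r K hK, hq r K ((le_max_left _ _).trans hr) hK]
  rw [this]

theorem extV_poly {n : ℕ} {μ : ConvexBody (En n) → ℝ} (hμ : IsVal μ) {f : En n → ℝ}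
    (hf : Nice f) : ∃ q : Polynomial ℝ, q.natDegree ≤ 2 * n ∧
      (∀ r K, SRep f r K → μ K = q.eval r) ∧ extV μ f = q.eval 0 := by
  obtain ⟨q, h1, h2⟩ := hf.exists_poly hμ
  exact ⟨q, h1, h2, extV_eq hμ hf q 0 fun r K _ h => h2 r K h⟩

theorem extV_body {n : ℕ} {μ : ConvexBody (En n) → ℝ} (hμ : IsVal μ) (K : ConvexBody (En n)) :
    extV μ (hs K) = μ K := by
  have hrep : SRep (hs K) 0 K := fun u _ => (zero_add _).symm
  obtain ⟨q, h1, h2, h3⟩ := extV_poly hμ ⟨0, K, hrep⟩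
  rw [h3, h2 0 K hrep]

theorem extV_congr {n : ℕ} (μ : ConvexBody (En n) → ℝ) {f g : En n → ℝ}
    (h : ∀ u, ‖u‖ = 1 → f u = g u) : extV μ f = extV μ g := by
  have : SRep f = SRep g := by
    funext r K
    apply propext
    constructor
    · intro h1 u hu; rw [h1 u hu, h u hu]
    · intro h1 u hu; rw [h1 u hu, h u hu]
  unfold extV
  rw [this]

theorem extV_linear {n : ℕ} {μ ν : ConvexBody (En n) → ℝ} (hμ : IsVal μ) (hν : IsVal ν) (a b : ℝ)
    (h : IsVal (fun K => a * μ K + b * ν K)) {f : En n → ℝ} (hf : Nice f) :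
    extV (fun K => a * μ K + b * ν K) f = a * extV μ f + b * extV ν f := by
  obtain ⟨p, _, p2, p3⟩ := extV_poly hμ hf
  obtain ⟨q, _, q2, q3⟩ := extV_poly hν hf
  rw [extV_eq h hf (Polynomial.C a * p + Polynomial.C b * q) 0, p3, q3]
  · simp
  · intro r K _ hK
    simp [p2 r K hK, q2 r K hK]

/-- polynomial along a scaled family of balls -/
theorem extV_rep {n : ℕ} {μ : ConvexBody (En n) → ℝ} (hμ : IsVal μ) {f : En n → ℝ} {r : ℝ}
    {K : ConvexBody (En n)} (h : SRep f r K) {c : ℝ} (hc : 0 < c) :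
    extV μ f = ∑ k ∈ Finset.range (2 * n + 1),
      μ (K + ((k : ℝ) * c) • UB n) * (lag (2 * n) k).eval (-r / c) := by
  obtain ⟨q, h1, h2, h3⟩ := extV_poly hμ ⟨r, K, h⟩
  have e := poly_eq_lag (D := 2 * n) (q.comp (Polynomial.C c * Polynomial.X + Polynomial.C r)) (by
    refine Polynomial.natDegree_comp_le.trans ?_
    have : (Polynomial.C c * Polynomial.X + Polynomial.C r).natDegree ≤ 1 :=
      Polynomial.natDegree_linear_le
    nlinarith) (-r / c)
  simp only [Polynomial.eval_comp, Polynomial.eval_add, Polynomial.eval_mul, Polynomial.eval_X,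
    Polynomial.eval_C] at e
  rw [show c * (-r / c) + r = 0 by field_simp; ring] at e
  rw [h3, e]
  apply Finset.sum_congr rfl
  intro k _
  have := h.add_ball (t := (k : ℝ) * c) (by positivity)
  rw [h2 _ _ this]
  congr 2; ring

theorem extV_line {n : ℕ} {μ : ConvexBody (En n) → ℝ} (hμ : IsVal μ) {f g : En n → ℝ}
    (hf : Nice f) (hg : Nice g) : PolyOn (4 * n) (fun t => extV μ (fun u => f u + t * g u)) := by
  obtain ⟨r0, E0, h0⟩ := hf
  obtain ⟨r1, E1, h1⟩ := hg
  have h2 : PolyOn (4 * n) (fun t => ∑ k ∈ Finset.range (2 * n + 1),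
      μ ((E0 + (k : ℝ) • UB n) + t • E1) * (lag (2 * n) k).eval (-(r0 + t * r1))) := by
    apply PolyOn.sum
    intro k hk
    have h3 := (hμ.poly (E0 + (k : ℝ) • UB n) E1).mul (g := fun t =>
      (lag (2 * n) k).eval (-(r0 + t * r1))) (E := 2 * n) (by
        refine ⟨(lag (2 * n) k).comp (Polynomial.C (-r1) * Polynomial.X + Polynomial.C (-r0)), ?_, ?_⟩
        · refine Polynomial.natDegree_comp_le.trans ?_
          have : (Polynomial.C (-r1) * Polynomial.X + Polynomial.C (-r0)).natDegree ≤ 1 :=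
            Polynomial.natDegree_linear_le
          have := lag_natDegree _ _ hk
          nlinarith
        · intro t _
          simp only [Polynomial.eval_comp, Polynomial.eval_add, Polynomial.eval_mul,
            Polynomial.eval_X, Polynomial.eval_C]
          congr 1; ring)
    rw [show 4 * n = 2 * n + 2 * n by ring]
    exact h3
  refine h2.congr fun t ht => ?_
  rw [extV_rep hμ (h0.add (h1.smul ht)) one_pos]
  apply Finset.sum_congr rfl
  intro k _
  rw [mul_one, div_one]
  congr 2
  rw [add_assoc, add_assoc, add_comm (t • E1)]

theorem extV_local {n : ℕ} {μ : ConvexBody (En n) → ℝ} (hμ : IsVal μ) {h f g : En n → ℝ}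
    (n0 : Nice h) (n1 : Nice fun u => h u + f u) (n2 : Nice fun u => h u + g u)
    (n3 : Nice fun u => h u + f u + g u) (hf : ∀ u, ‖u‖ = 1 → 0 ≤ f u)
    (hg : ∀ u, ‖u‖ = 1 → 0 ≤ g u) (hfg : ∀ u, ‖u‖ = 1 → f u * g u = 0) :
    extV μ (fun u => h u + f u + g u) + extV μ h =
      extV μ (fun u => h u + f u) + extV μ (fun u => h u + g u) := by
  obtain ⟨q0, _, p0, e0⟩ := extV_poly hμ n0
  obtain ⟨q1, _, p1, e1⟩ := extV_poly hμ n1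
  obtain ⟨q2, _, p2, e2⟩ := extV_poly hμ n2
  obtain ⟨q3, _, p3, e3⟩ := extV_poly hμ n3
  obtain ⟨r0, l0⟩ := n0.large
  obtain ⟨r1, l1⟩ := n1.large
  obtain ⟨r2, l2⟩ := n2.large
  obtain ⟨r3, l3⟩ := n3.large
  have key : q3 + q0 = q1 + q2 := by
    apply poly_eq_of_ge (max (max r0 r1) (max r2 r3))
    intro r hr
    simp only [max_le_iff] at hr
    obtain ⟨K0, k0⟩ := l0 r hr.1.1
    obtain ⟨K1, k1⟩ := l1 r hr.1.2
    obtain ⟨K2, k2⟩ := l2 r hr.2.1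
    obtain ⟨K3, k3⟩ := l3 r hr.2.2
    rw [Polynomial.eval_add, Polynomial.eval_add, ← p0 r K0 k0, ← p1 r K1 k1, ← p2 r K2 k2,
      ← p3 r K3 k3]
    have ext : ∀ (φ ψ : En n → ℝ), (∀ c : ℝ, 0 ≤ c → ∀ x, φ (c • x) = c * φ x) →
        (∀ c : ℝ, 0 ≤ c → ∀ x, ψ (c • x) = c * ψ x) → (∀ u, ‖u‖ = 1 → φ u = ψ u) →
        ∀ u, φ u = ψ u := by
      intro φ ψ h1 h2 h3 u
      by_cases hu : u = 0
      · have a1 := h1 0 le_rfl 0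
        have a2 := h2 0 le_rfl 0
        rw [smul_zero, zero_mul] at a1 a2
        rw [hu, a1, a2]
      · have hp : ‖u‖ ≠ 0 := norm_ne_zero_iff.mpr hu
        have e : u = ‖u‖ • (‖u‖⁻¹ • u) := by rw [smul_smul, mul_inv_cancel₀ hp, one_smul]
        rw [e, h1 _ (norm_nonneg u), h2 _ (norm_nonneg u), h3]
        rw [norm_smul, norm_inv, norm_norm, inv_mul_cancel₀ hp]
    apply hμ.max_min
    · apply ext
      · intro c hc x; exact hs_smul_arg K3 hc x
      · intro c hc x
        rw [hs_smul_arg K1 hc, hs_smul_arg K2 hc, mul_max_of_nonneg _ _ hc]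
      · intro u hu
        rw [k3 u hu, k1 u hu, k2 u hu]
        rcases mul_eq_zero.mp (hfg u hu) with h0 | h0 <;> dsimp only
        · rw [h0, max_eq_right] <;> linarith [hg u hu]
        · rw [h0, max_eq_left] <;> linarith [hf u hu]
    · apply ext
      · intro c hc x; exact hs_smul_arg K0 hc x
      · intro c hc x
        rw [hs_smul_arg K1 hc, hs_smul_arg K2 hc, mul_min_of_nonneg _ _ hc]
      · intro u hu
        rw [k0 u hu, k1 u hu, k2 u hu]
        rcases mul_eq_zero.mp (hfg u hu) with h0 | h0 <;> dsimp only
        · rw [h0, min_eq_left] <;> linarith [hg u hu]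
        · rw [h0, min_eq_right] <;> linarith [hf u hu]
  rw [e0, e1, e2, e3, ← Polynomial.eval_add, ← Polynomial.eval_add, key]

/-- invariance of a valuation under a linear isometry, in terms of support functions -/
def InvUnder {n : ℕ} (μ : ConvexBody (En n) → ℝ) (g : En n ≃ₗᵢ[ℝ] En n) : Prop :=
  ∀ K L : ConvexBody (En n), (∀ u, hs L u = hs K (g u)) → μ L = μ K

theorem SRep.comp {n : ℕ} {f : En n → ℝ} {r : ℝ} {K : ConvexBody (En n)} (h : SRep f r K)
    (g : En n ≃ₗᵢ[ℝ] En n) : ∃ L, (∀ u, hs L u = hs K (g u)) ∧ SRep (fun u => f (g u)) r L := by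
  have : Sublin fun u => hs K (g u) := by
    constructor
    · intro c hc x
      simp only [map_smul]
      exact hs_smul_arg K hc.le _
    · intro x y
      simp only [map_add]
      exact hs_add_arg K _ _
  obtain ⟨L, hL⟩ := this.exists_body
  refine ⟨L, hL, fun u hu => ?_⟩
  rw [hL, h (g u) (by rw [g.norm_map, hu])]

theorem extV_comp {n : ℕ} {μ : ConvexBody (En n) → ℝ} (hμ : IsVal μ) {g : En n ≃ₗᵢ[ℝ] En n}
    (hg : InvUnder μ g) {f : En n → ℝ} (hf : Nice f) :
    extV μ (fun u => f (g u)) = extV μ f := by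
  obtain ⟨q, _, p2, e⟩ := extV_poly hμ hf
  obtain ⟨r0, hr0⟩ := hf.large
  have hn : Nice fun u => f (g u) := by
    obtain ⟨r, K, h⟩ := hf
    obtain ⟨L, _, hL⟩ := h.comp g
    exact ⟨r, L, hL⟩
  rw [e]
  apply extV_eq hμ hn q r0
  intro r L hr hL
  obtain ⟨K, hK⟩ := hr0 r hr
  obtain ⟨L', h1, h2⟩ := hK.comp g
  rw [hL.unique h2, hg K L' h1, p2 r K hK]

/-! ### Quantitative second order regularity on the sphere -/

/-- second order regularity at scale `1/l` with constant `C` -/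
def QR {n : ℕ} (l : ℝ) (f : En n → ℝ) (C : ℝ) : Prop :=
  0 ≤ C ∧ ∀ w, ‖w‖ = 1 → |f w| ≤ C ∧ ∃ v : En n, ‖v‖ ≤ C * l ∧ ∀ u, ‖u‖ = 1 →
    |f u - f w - inner ℝ v (u - w)| ≤ C * l ^ 2 * ‖u - w‖ ^ 2

/-- regular functions -/
def QB {n : ℕ} (f : En n → ℝ) : Prop := ∃ C, QR 1 f C

theorem QR.mono {n : ℕ} {l : ℝ} {f : En n → ℝ} {C C' : ℝ} (h : QR l f C) (hC : C ≤ C')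
    (hl : 0 ≤ l) : QR l f C' := by
  refine ⟨h.1.trans hC, fun w hw => ?_⟩
  obtain ⟨h1, v, h2, h3⟩ := h.2 w hw
  refine ⟨h1.trans hC, v, h2.trans (by gcongr), fun u hu => (h3 u hu).trans (by gcongr)⟩

theorem QR.congr {n : ℕ} {l : ℝ} {f g : En n → ℝ} {C : ℝ} (h : QR l f C)
    (hfg : ∀ u, ‖u‖ = 1 → g u = f u) : QR l g C := by
  refine ⟨h.1, fun w hw => ?_⟩
  obtain ⟨h1, v, h2, h3⟩ := h.2 w hw
  refine ⟨by rwa [hfg w hw], v, h2, fun u hu => ?_⟩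
  rw [hfg w hw, hfg u hu]; exact h3 u hu

theorem QR.to_one {n : ℕ} {l : ℝ} {f : En n → ℝ} {C : ℝ} (h : QR l f C) (hl : 1 ≤ l) :
    QR 1 f (C * l ^ 2) := by
  have hl2 : l ≤ l ^ 2 := by nlinarith
  have hC := h.1
  refine ⟨by positivity, fun w hw => ?_⟩
  obtain ⟨h1, v, h2, h3⟩ := h.2 w hw
  refine ⟨h1.trans ?_, v, h2.trans ?_, fun u hu => (h3 u hu).trans ?_⟩
  · nlinarith
  · rw [mul_one]; gcongr
  · rw [one_pow, mul_one]

theorem QR.add {n : ℕ} {l : ℝ} {f g : En n → ℝ} {C D : ℝ} (h : QR l f C) (h' : QR l g D) :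
    QR l (f + g) (C + D) := by
  refine ⟨add_nonneg h.1 h'.1, fun w hw => ?_⟩
  obtain ⟨h1, v, h2, h3⟩ := h.2 w hw
  obtain ⟨h1', v', h2', h3'⟩ := h'.2 w hw
  refine ⟨(abs_add_le _ _).trans (add_le_add h1 h1'), v + v', ?_, fun u hu => ?_⟩
  · rw [add_mul]; exact (norm_add_le _ _).trans (add_le_add h2 h2')
  · rw [inner_add_left]
    have := (abs_add_le _ _).trans (add_le_add (h3 u hu) (h3' u hu))
    refine le_trans (le_of_eq ?_) (this.trans (le_of_eq ?_))
    · congr 1; simp only [Pi.add_apply]; ring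
    · ring

theorem QR.smul {n : ℕ} {l : ℝ} {f : En n → ℝ} {C : ℝ} (h : QR l f C) (a : ℝ) :
    QR l (a • f) (|a| * C) := by
  refine ⟨mul_nonneg (abs_nonneg _) h.1, fun w hw => ?_⟩
  obtain ⟨h1, v, h2, h3⟩ := h.2 w hw
  refine ⟨?_, a • v, ?_, fun u hu => ?_⟩
  · rw [Pi.smul_apply, smul_eq_mul, abs_mul]; gcongr
  · rw [norm_smul, Real.norm_eq_abs, mul_assoc]; gcongr
  · rw [real_inner_smul_left, Pi.smul_apply, Pi.smul_apply, smul_eq_mul, smul_eq_mul,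
      show a * f u - a * f w - a * inner ℝ v (u - w) = a * (f u - f w - inner ℝ v (u - w)) by ring,
      abs_mul, mul_assoc, mul_assoc, ← mul_assoc C]
    gcongr; exact h3 u hu

theorem QR.const {n : ℕ} (l : ℝ) (hl : 0 ≤ l) (c : ℝ) : QR l (fun _ : En n => c) |c| := by
  refine ⟨abs_nonneg _, fun w hw => ⟨le_rfl, 0, ?_, fun u hu => ?_⟩⟩
  · rw [norm_zero]; positivity
  · simp only [sub_self, inner_zero_left, abs_zero]; positivity

theorem QR.lip {n : ℕ} {l : ℝ} {f : En n → ℝ} {C : ℝ} (h : QR l f C) (hl : 0 ≤ l) {u w : En n}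
    (hu : ‖u‖ = 1) (hw : ‖w‖ = 1) : |f u - f w| ≤ 2 * C * (l * ‖u - w‖) := by
  obtain ⟨h1, v, h2, h3⟩ := h.2 w hw
  have hC := h.1
  by_cases hd : l * ‖u - w‖ ≤ 1
  · have h4 := h3 u hu
    have h5 : |inner ℝ v (u - w)| ≤ C * l * ‖u - w‖ :=
      (abs_real_inner_le_norm _ _).trans (by gcongr)
    have h6 : C * l ^ 2 * ‖u - w‖ ^ 2 ≤ C * (l * ‖u - w‖) := by
      have : 0 ≤ l * ‖u - w‖ := by positivity
      have := mul_le_mul_of_nonneg_left hd (mul_nonneg hC this)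
      nlinarith
    have := abs_add_le (f u - f w - inner ℝ v (u - w)) (inner ℝ v (u - w))
    rw [sub_add_cancel] at this
    nlinarith
  · have h4 := (h.2 u hu).1
    have : |f u - f w| ≤ 2 * C := (abs_sub _ _).trans (by linarith)
    push Not at hd
    nlinarith

theorem QR.mul {n : ℕ} {l : ℝ} {f g : En n → ℝ} {C D : ℝ} (h : QR l f C) (h' : QR l g D)
    (hl : 0 ≤ l) : QR l (f * g) (6 * C * D) := by
  have hC := h.1
  have hD := h'.1
  refine ⟨by positivity, fun w hw => ?_⟩
  obtain ⟨h1, v, h2, h3⟩ := h.2 w hw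
  obtain ⟨h1', v', h2', h3'⟩ := h'.2 w hw
  refine ⟨?_, f w • v' + g w • v, ?_, fun u hu => ?_⟩
  · rw [Pi.mul_apply, abs_mul]
    have : |f w| * |g w| ≤ C * D := by gcongr
    have : 0 ≤ C * D := by positivity
    linarith
  · refine (norm_add_le _ _).trans ?_
    rw [norm_smul, norm_smul, Real.norm_eq_abs, Real.norm_eq_abs]
    have e1 : |f w| * ‖v'‖ ≤ C * (D * l) := by gcongr
    have e2 : |g w| * ‖v‖ ≤ D * (C * l) := by gcongr
    have : 0 ≤ C * D * l := by positivity
    linarith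
  · rw [inner_add_left, real_inner_smul_left, real_inner_smul_left, Pi.mul_apply, Pi.mul_apply]
    have e : f u * g u - f w * g w - (f w * inner ℝ v' (u - w) + g w * inner ℝ v (u - w)) =
      f w * (g u - g w - inner ℝ v' (u - w)) + g w * (f u - f w - inner ℝ v (u - w)) +
      (f u - f w) * (g u - g w) := by ring
    rw [e]
    refine (abs_add_le _ _).trans ?_
    have a1 := abs_add_le (f w * (g u - g w - inner ℝ v' (u - w)))
      (g w * (f u - f w - inner ℝ v (u - w)))
    have a2 : |f w * (g u - g w - inner ℝ v' (u - w))| ≤ C * (D * l ^ 2 * ‖u - w‖ ^ 2) := by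
      rw [abs_mul]; exact mul_le_mul h1 (h3' u hu) (abs_nonneg _) hC
    have a3 : |g w * (f u - f w - inner ℝ v (u - w))| ≤ D * (C * l ^ 2 * ‖u - w‖ ^ 2) := by
      rw [abs_mul]; exact mul_le_mul h1' (h3 u hu) (abs_nonneg _) hD
    have a4 : |(f u - f w) * (g u - g w)| ≤ (2 * C * (l * ‖u - w‖)) * (2 * D * (l * ‖u - w‖)) := by
      rw [abs_mul]
      exact mul_le_mul (h.lip hl hu hw) (h'.lip hl hu hw) (abs_nonneg _) (by positivity)
    nlinarith

theorem QR.comp {n : ℕ} {l : ℝ} {f : En n → ℝ} {C : ℝ} (h : QR l f C) (g : En n ≃ₗᵢ[ℝ] En n) :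
    QR l (fun u => f (g u)) C := by
  refine ⟨h.1, fun w hw => ?_⟩
  obtain ⟨h1, v, h2, h3⟩ := h.2 (g w) (by rw [g.norm_map, hw])
  refine ⟨h1, g.symm v, by rw [g.symm.norm_map]; exact h2, fun u hu => ?_⟩
  have := h3 (g u) (by rw [g.norm_map, hu])
  rw [← map_sub, g.norm_map] at this
  convert this using 3
  rw [← g.inner_map_map, g.apply_symm_apply]

theorem QR.sum {n : ℕ} {l : ℝ} (hl : 0 ≤ l) {ι : Type*} (s : Finset ι) (f : ι → En n → ℝ) (C : ι → ℝ)
    (h : ∀ i ∈ s, QR l (f i) (C i)) : QR l (∑ i ∈ s, f i) (∑ i ∈ s, C i) := by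
  classical
  induction s using Finset.induction_on with
  | empty =>
    simp only [Finset.sum_empty]
    have := QR.const (n := n) l hl 0
    rwa [abs_zero] at this
  | insert a s ha ih =>
    rw [Finset.sum_insert ha, Finset.sum_insert ha]
    exact (h a (Finset.mem_insert_self _ _)).add
      (ih fun i hi => h i (Finset.mem_insert_of_mem hi))

theorem QB.add {n : ℕ} {f g : En n → ℝ} (hf : QB f) (hg : QB g) : QB (f + g) := by
  obtain ⟨C, hC⟩ := hf
  obtain ⟨D, hD⟩ := hg
  exact ⟨_, hC.add hD⟩

theorem QB.mul {n : ℕ} {f g : En n → ℝ} (hf : QB f) (hg : QB g) : QB (f * g) := by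
  obtain ⟨C, hC⟩ := hf
  obtain ⟨D, hD⟩ := hg
  exact ⟨_, hC.mul hD zero_le_one⟩

theorem QB.smul {n : ℕ} {f : En n → ℝ} (hf : QB f) (a : ℝ) : QB (a • f) := by
  obtain ⟨C, hC⟩ := hf
  exact ⟨_, hC.smul a⟩

theorem QB.neg {n : ℕ} {f : En n → ℝ} (hf : QB f) : QB (-f) := by
  rw [← neg_one_smul ℝ]; exact hf.smul _

theorem QB.sub {n : ℕ} {f g : En n → ℝ} (hf : QB f) (hg : QB g) : QB (f - g) := by
  rw [sub_eq_add_neg]; exact hf.add hg.neg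

theorem QB.const {n : ℕ} (c : ℝ) : QB (fun _ : En n => c) := ⟨_, QR.const 1 zero_le_one c⟩

theorem QB.sum {n : ℕ} {ι : Type*} (s : Finset ι) (f : ι → En n → ℝ)
    (h : ∀ i ∈ s, QB (f i)) : QB (∑ i ∈ s, f i) := by
  classical
  induction s using Finset.induction_on with
  | empty => exact QB.const 0
  | insert a s ha ih =>
    rw [Finset.sum_insert ha]
    exact (h a (Finset.mem_insert_self _ _)).add
      (ih fun i hi => h i (Finset.mem_insert_of_mem hi))

theorem QR.sublin {n : ℕ} {f : En n → ℝ} {C r : ℝ} (h : QR 1 f C) (hr : 4 * C ≤ r) :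
    Sublin fun x : En n => r * ‖x‖ + ‖x‖ * f (‖x‖⁻¹ • x) := by
  have hC := h.1
  have unit : ∀ x : En n, x ≠ 0 → ‖‖x‖⁻¹ • x‖ = 1 := fun x hx => by
    rw [norm_smul, norm_inv, norm_norm, inv_mul_cancel₀ (norm_ne_zero_iff.mpr hx)]
  have nonneg : ∀ x : En n, 0 ≤ r * ‖x‖ + ‖x‖ * f (‖x‖⁻¹ • x) := by
    intro x
    by_cases hx : x = 0
    · simp [hx]
    · have := neg_le_of_abs_le (h.2 _ (unit x hx)).1
      have := norm_nonneg x
      nlinarith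
  constructor
  · intro c hc x
    dsimp only
    rw [norm_smul, Real.norm_eq_abs, abs_of_pos hc, mul_inv, smul_smul,
      show c⁻¹ * ‖x‖⁻¹ * c = ‖x‖⁻¹ by field_simp]
    ring
  · intro x y
    dsimp only
    by_cases hx : x = 0
    · simp [hx]
    by_cases hy : y = 0
    · simp [hy]
    by_cases hz : x + y = 0
    · rw [hz, norm_zero, mul_zero, zero_mul, add_zero]
      exact add_nonneg (nonneg x) (nonneg y)
    have hu := unit x hx
    have hv := unit y hy
    have hw := unit _ hz
    have ex : x = ‖x‖ • (‖x‖⁻¹ • x) := by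
      rw [smul_smul, mul_inv_cancel₀ (norm_ne_zero_iff.mpr hx), one_smul]
    have ey : y = ‖y‖ • (‖y‖⁻¹ • y) := by
      rw [smul_smul, mul_inv_cancel₀ (norm_ne_zero_iff.mpr hy), one_smul]
    have ez : x + y = ‖x + y‖ • (‖x + y‖⁻¹ • (x + y)) := by
      rw [smul_smul, mul_inv_cancel₀ (norm_ne_zero_iff.mpr hz), one_smul]
    have htri := norm_add_le x y
    have hs0 := norm_nonneg x
    have ht0 := norm_nonneg y
    generalize ‖x‖⁻¹ • x = u at *
    generalize ‖y‖⁻¹ • y = v at *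
    generalize ‖x + y‖⁻¹ • (x + y) = w at *
    generalize ‖x‖ = s at *
    generalize ‖y‖ = t at *
    generalize ‖x + y‖ = z at *
    obtain ⟨h1, a, h2, h3⟩ := h.2 w hw
    have hu3 := neg_le_of_abs_le (h3 u hu)
    have hv3 := neg_le_of_abs_le (h3 v hv)
    have hrel : s • u + t • v = z • w := by rw [← ex, ← ey, ← ez]
    have r1 : s * inner ℝ a u + t * inner ℝ a v = z * inner ℝ a w := by
      rw [← real_inner_smul_right, ← real_inner_smul_right, ← real_inner_smul_right, ← inner_add_right,
        hrel]
    have r2 : s * inner ℝ u w + t * inner ℝ v w = z := by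
      rw [← real_inner_smul_left, ← real_inner_smul_left, ← inner_add_left, hrel,
        real_inner_smul_left, real_inner_self_eq_norm_sq, hw]; ring
    have n1 := norm_sub_sq_real u w
    have n2 := norm_sub_sq_real v w
    rw [hu, hw] at n1
    rw [hv, hw] at n2
    rw [n1, inner_sub_right] at hu3
    rw [n2, inner_sub_right] at hv3
    have b1 := neg_le_of_abs_le h1
    have b2 : inner ℝ a w ≤ C := by
      have := real_inner_le_norm a w
      rw [hw] at this
      linarith
    have c1 := mul_le_mul_of_nonneg_left hu3 hs0
    have c2 := mul_le_mul_of_nonneg_left hv3 ht0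
    have c3 : 0 ≤ (s + t - z) * (r + f w - inner ℝ a w - 2 * C) :=
      mul_nonneg (by linarith) (by linarith)
    have c4 : s * (C * inner ℝ u w) + t * (C * inner ℝ v w) = C * z := by rw [← r2]; ring
    nlinarith

theorem QR.exists_rep {n : ℕ} {f : En n → ℝ} {C r : ℝ} (h : QR 1 f C) (hr : 4 * C ≤ r) :
    ∃ K : ConvexBody (En n), SRep f r K ∧ (K : Set (En n)) ⊆ closedBall 0 (r + C) := by
  obtain ⟨K, hK⟩ := (h.sublin hr).exists_body
  have hrep : SRep f r K := by
    intro u hu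
    rw [hK, hu, inv_one, one_smul, mul_one, one_mul]
  refine ⟨K, hrep, fun x hx => ?_⟩
  have hC := h.1
  rw [mem_closedBall_zero_iff]
  by_cases hx0 : x = 0
  · rw [hx0, norm_zero]; linarith
  have hn : ‖x‖ ≠ 0 := norm_ne_zero_iff.mpr hx0
  have hu : ‖‖x‖⁻¹ • x‖ = 1 := by rw [norm_smul, norm_inv, norm_norm, inv_mul_cancel₀ hn]
  have h1 := le_hs K (‖x‖⁻¹ • x) hx
  rw [hrep _ hu, real_inner_smul_right, real_inner_self_eq_norm_sq] at h1
  have h2 := le_of_abs_le (h.2 _ hu).1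
  have : ‖x‖⁻¹ * ‖x‖ ^ 2 = ‖x‖ := by field_simp
  linarith

theorem QB.nice {n : ℕ} {f : En n → ℝ} (h : QB f) : Nice f := by
  obtain ⟨C, hC⟩ := h
  obtain ⟨K, hK, _⟩ := hC.exists_rep le_rfl
  exact ⟨_, K, hK⟩

/-! ### Estimates and locality for the extended valuation -/

theorem extV_growth {n : ℕ} {μ : ConvexBody (En n) → ℝ} (hμ : IsVal μ) :
    ∃ A, 0 ≤ A ∧ ∀ (f : En n → ℝ) (C : ℝ), QR 1 f C → |extV μ f| ≤ A * (1 + C) ^ (2 * n) := by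
  obtain ⟨B, hB0, hB⟩ := hμ.growth
  refine ⟨∑ k ∈ Finset.range (2 * n + 1), B * (8 * n + 6) ^ (2 * n) *
    |(lag (2 * n) k).eval (-1)|, by positivity, fun f C hf => ?_⟩
  have hC := hf.1
  obtain ⟨K, hK, hKb⟩ := hf.exists_rep (r := 4 * C + 1) (by linarith)
  have hr : 0 < 4 * C + 1 := by linarith
  rw [extV_rep hμ hK hr, neg_div, div_self hr.ne', Finset.sum_mul]
  refine (Finset.abs_sum_le_sum_abs _ _).trans (Finset.sum_le_sum fun k hk => ?_)
  rw [abs_mul, mul_right_comm]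
  gcongr
  have hk2 : (k : ℝ) ≤ 2 * n := by
    have := Finset.mem_range.mp hk
    exact_mod_cast Nat.lt_succ_iff.mp this
  refine (hB (4 * C + 1 + C + 2 * n * (4 * C + 1)) _ (by positivity) ?_).trans ?_
  · intro x hx
    rw [ConvexBody.coe_add, ConvexBody.coe_smul] at hx
    obtain ⟨y, hy, z, hz, rfl⟩ := hx
    obtain ⟨w, hw, rfl⟩ := hz
    change y + ((k : ℝ) * (4 * C + 1)) • w ∈ _
    have h1 := hKb hy
    have h2 : ‖w‖ ≤ 1 := by
      have := le_hs (UB n) w hw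
      rw [hs_UB, real_inner_self_eq_norm_sq] at this
      nlinarith [norm_nonneg w]
    rw [mem_closedBall_zero_iff] at h1 ⊢
    refine (norm_add_le _ _).trans (add_le_add h1 ?_)
    rw [norm_smul, Real.norm_eq_abs, abs_of_nonneg (by positivity)]
    calc (k : ℝ) * (4 * C + 1) * ‖w‖ ≤ (k : ℝ) * (4 * C + 1) * 1 := by gcongr
      _ ≤ _ := by rw [mul_one]; gcongr
  · rw [mul_assoc B, ← mul_pow]
    have hn : (0 : ℝ) ≤ n := Nat.cast_nonneg n
    gcongr
    nlinarith [mul_nonneg hn hC]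

theorem extV_all {n : ℕ} {μ : ConvexBody (En n) → ℝ} (hμ : IsVal μ) {f g : En n → ℝ}
    (hf : QB f) (hg : QB g) (t : ℝ) : extV μ (f + t • g) =
      ∑ k ∈ Finset.range (4 * n + 1), extV μ (f + (k : ℝ) • g) * (lag (4 * n) k).eval t := by
  obtain ⟨T, hT, hTt⟩ : ∃ T : ℝ, 0 ≤ T ∧ 0 ≤ t + T := ⟨|t|, abs_nonneg _, by
    linarith [neg_abs_le t]⟩
  obtain ⟨q, hq, he⟩ := extV_line hμ (hf.sub (hg.smul T)).nice hg.nice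
  have key : ∀ s : ℝ, 0 ≤ s + T →
      extV μ (f + s • g) = (q.comp (Polynomial.X + Polynomial.C T)).eval s := by
    intro s hs
    simp only [Polynomial.eval_comp, Polynomial.eval_add, Polynomial.eval_X, Polynomial.eval_C]
    rw [← he _ hs]
    congr 1
    funext u
    simp only [Pi.add_apply, Pi.sub_apply, Pi.smul_apply, smul_eq_mul]
    ring
  rw [key t hTt, poly_eq_lag _ ((natDegree_comp_shift q T).trans hq)]
  apply Finset.sum_congr rfl
  intro k _
  rw [key k (by positivity)]

theorem poly_lip (p : Polynomial ℝ) : ∃ A, 0 ≤ A ∧ ∀ ε : ℝ, 0 ≤ ε → ε ≤ 1 →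
    |p.eval ε - p.eval 0| ≤ A * ε := by
  obtain ⟨A, hA⟩ := isCompact_Icc.exists_bound_of_continuousOn (s := Set.Icc (0 : ℝ) 1)
    (f := fun x => p.divX.eval x) p.divX.continuous.continuousOn
  refine ⟨|A|, abs_nonneg _, fun ε h0 h1 => ?_⟩
  have e : ∀ x : ℝ, p.eval x = x * p.divX.eval x + p.coeff 0 := by
    intro x
    have := congrArg (Polynomial.eval x) (Polynomial.X_mul_divX_add p)
    rw [← this]
    simp only [Polynomial.eval_add, Polynomial.eval_mul, Polynomial.eval_X, Polynomial.eval_C]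
  rw [e ε, e 0, zero_mul, zero_add, add_sub_cancel_right, abs_mul, abs_of_nonneg h0, mul_comm]
  exact mul_le_mul_of_nonneg_right ((hA ε ⟨h0, h1⟩).trans (le_abs_self A)) h0

theorem extV_lip {n : ℕ} {μ : ConvexBody (En n) → ℝ} (hμ : IsVal μ) :
    ∃ A, 0 ≤ A ∧ ∀ (f e : En n → ℝ) (C ε : ℝ), QR 1 f C → QR 1 e ε → 0 < ε → ε ≤ 1 →
      |extV μ (f + e) - extV μ f| ≤ A * (1 + C) ^ (2 * n) * ε := by
  obtain ⟨A, hA0, hA⟩ := extV_growth hμ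
  choose Λ hΛ0 hΛ using fun k => poly_lip (lag (4 * n) k)
  refine ⟨∑ k ∈ Finset.range (4 * n + 1), A * (4 * n + 1) ^ (2 * n) * Λ k,
    Finset.sum_nonneg fun k _ => mul_nonneg (by positivity) (hΛ0 k), ?_⟩
  intro f e C ε hf he h0 h1
  have hC := hf.1
  have he' : QR 1 (ε⁻¹ • e) 1 := by
    have := he.smul ε⁻¹
    rwa [abs_of_pos (by positivity), inv_mul_cancel₀ h0.ne'] at this
  have e1 := extV_all hμ ⟨C, hf⟩ ⟨1, he'⟩ ε
  have e2 := extV_all hμ ⟨C, hf⟩ ⟨1, he'⟩ 0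
  rw [smul_smul, mul_inv_cancel₀ h0.ne', one_smul] at e1
  rw [zero_smul, add_zero] at e2
  rw [e1, e2, ← Finset.sum_sub_distrib, Finset.sum_mul, Finset.sum_mul]
  refine (Finset.abs_sum_le_sum_abs _ _).trans (Finset.sum_le_sum fun k hk => ?_)
  rw [← mul_sub, abs_mul]
  have hk2 : (k : ℝ) ≤ 4 * n := by
    have := Finset.mem_range.mp hk
    exact_mod_cast Nat.lt_succ_iff.mp this
  have b1 := hΛ k ε h0.le h1
  have b2 := hA _ _ (hf.add (he'.smul k))
  rw [abs_of_nonneg (Nat.cast_nonneg k : (0 : ℝ) ≤ k), mul_one] at b2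
  have b3 : A * (1 + (C + k)) ^ (2 * n) ≤ A * ((4 * n + 1) * (1 + C)) ^ (2 * n) := by
    gcongr
    nlinarith
  rw [mul_pow] at b3
  calc _ ≤ (A * ((4 * n + 1) ^ (2 * n) * (1 + C) ^ (2 * n))) * (Λ k * ε) :=
        mul_le_mul (b2.trans b3) b1 (abs_nonneg _) (by positivity)
    _ = _ := by ring

/-- second difference of the extended valuation -/
theorem extV_local' {n : ℕ} {μ : ConvexBody (En n) → ℝ} (hμ : IsVal μ) {h p q p' q' : En n → ℝ}
    (bh : QB h) (bp : QB p) (bq : QB q) (bp' : QB p') (bq' : QB q')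
    (hp : ∀ u, ‖u‖ = 1 → 0 ≤ p u) (hq : ∀ u, ‖u‖ = 1 → 0 ≤ q u)
    (hp' : ∀ u, ‖u‖ = 1 → 0 ≤ p' u) (hq' : ∀ u, ‖u‖ = 1 → 0 ≤ q' u)
    (h1 : ∀ u, ‖u‖ = 1 → p u * p' u = 0) (h2 : ∀ u, ‖u‖ = 1 → p u * q' u = 0)
    (h3 : ∀ u, ‖u‖ = 1 → q u * p' u = 0) (h4 : ∀ u, ‖u‖ = 1 → q u * q' u = 0) :
    extV μ (h + (p - q) + (p' - q')) + extV μ h =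
      extV μ (h + (p - q)) + extV μ (h + (p' - q')) := by
  have loc : ∀ h f g : En n → ℝ, QB h → QB f → QB g → (∀ u, ‖u‖ = 1 → 0 ≤ f u) →
      (∀ u, ‖u‖ = 1 → 0 ≤ g u) → (∀ u, ‖u‖ = 1 → f u * g u = 0) →
      extV μ (h + f + g) + extV μ h = extV μ (h + f) + extV μ (h + g) :=
    fun h f g bh bf bg a b c => extV_local hμ bh.nice (bh.add bf).nice (bh.add bg).nice
      ((bh.add bf).add bg).nice a b c
  have b0 := (bh.sub bq).sub bq'
  have l1 := loc (h - q - q') p p' b0 bp bp' hp hp' h1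
  have l2 := loc (h - q - q') p q' b0 bp bq' hp hq' h2
  have l3 := loc (h - q - q') q p' b0 bq bp' hq hp' h3
  have l4 := loc (h - q - q') q q' b0 bq bq' hq hq' h4
  rw [show h + (p - q) + (p' - q') = h - q - q' + p + p' by abel,
    show h + (p - q) = h - q - q' + p + q' by abel,
    show h + (p' - q') = h - q - q' + q + p' by abel]
  rw [show extV μ h = extV μ (h - q - q' + q + q') by congr 1; abel]
  linarith

theorem extV_local_mul {n : ℕ} {μ : ConvexBody (En n) → ℝ} (hμ : IsVal μ) {h F φ ψ : En n → ℝ}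
    (bh : QB h) (bF : QB F) (bφ : QB φ) (bψ : QB ψ)
    (hφ : ∀ u, ‖u‖ = 1 → 0 ≤ φ u) (hψ : ∀ u, ‖u‖ = 1 → 0 ≤ ψ u)
    (h1 : ∀ u, ‖u‖ = 1 → φ u * ψ u = 0) :
    extV μ (h + φ * F + ψ * F) + extV μ h = extV μ (h + φ * F) + extV μ (h + ψ * F) := by
  obtain ⟨C, hC⟩ := bF
  have bF : QB F := ⟨C, hC⟩
  set c : En n → ℝ := fun _ => C
  have bc : QB c := QB.const C
  have e : ∀ φ : En n → ℝ, φ * F = φ * (F + c) - φ * c := fun φ => by ring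
  rw [e φ, e ψ]
  have n1 : ∀ u, ‖u‖ = 1 → 0 ≤ F u + C := fun u hu => by
    linarith [neg_le_of_abs_le (hC.2 u hu).1]
  have n2 : 0 ≤ C := hC.1
  have z : ∀ u, ‖u‖ = 1 → ∀ a b : ℝ, (φ u * a) * (ψ u * b) = 0 := fun u hu a b => by
    rw [mul_mul_mul_comm, h1 u hu, zero_mul]
  apply extV_local' hμ bh (bφ.mul (bF.add bc)) (bφ.mul bc) (bψ.mul (bF.add bc)) (bψ.mul bc)
  · intro u hu; exact mul_nonneg (hφ u hu) (n1 u hu)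
  · intro u hu; exact mul_nonneg (hφ u hu) n2
  · intro u hu; exact mul_nonneg (hψ u hu) (n1 u hu)
  · intro u hu; exact mul_nonneg (hψ u hu) n2
  · intro u hu; exact z u hu _ _
  · intro u hu; exact z u hu _ _
  · intro u hu; exact z u hu _ _
  · intro u hu; exact z u hu _ _

theorem extV_chain {n : ℕ} {μ : ConvexBody (En n) → ℝ} (hμ : IsVal μ) {φ : ℕ → En n → ℝ}
    (bφ : ∀ j, QB (φ j)) (hφ : ∀ j u, ‖u‖ = 1 → 0 ≤ φ j u)
    (hφφ : ∀ j k u, j + 2 ≤ k → ‖u‖ = 1 → φ j u * φ k u = 0) {F : En n → ℝ} (bF : QB F) (N : ℕ) :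
    extV μ ((∑ j ∈ Finset.range (N + 1), φ j) * F) = extV μ (φ 0 * F) +
      ∑ j ∈ Finset.range N, (extV μ ((φ j + φ (j + 1)) * F) - extV μ (φ j * F)) := by
  induction N with
  | zero => simp
  | succ N ih =>
    rw [Finset.sum_range_succ (fun j => extV μ ((φ j + φ (j + 1)) * F) - extV μ (φ j * F)),
      ← add_assoc, ← ih]
    have := extV_local_mul hμ (h := φ N * F) (φ := ∑ j ∈ Finset.range N, φ j) (ψ := φ (N + 1))
      ((bφ N).mul bF) bF (QB.sum _ _ fun j _ => bφ j) (bφ _)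
      (fun u hu => by rw [Finset.sum_apply]; exact Finset.sum_nonneg fun j _ => hφ j u hu)
      (hφ _) (fun u hu => by
        rw [Finset.sum_apply, Finset.sum_mul]
        apply Finset.sum_eq_zero
        intro j hj
        exact hφφ j _ u (by have := Finset.mem_range.mp hj; omega) hu)
    rw [show (∑ j ∈ Finset.range (N + 1 + 1), φ j) * F =
      φ N * F + (∑ j ∈ Finset.range N, φ j) * F + φ (N + 1) * F by
        rw [Finset.sum_range_succ, Finset.sum_range_succ]; ring,
      show (∑ j ∈ Finset.range (N + 1), φ j) * F =
        φ N * F + (∑ j ∈ Finset.range N, φ j) * F by rw [Finset.sum_range_succ]; ring,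
      show (φ N + φ (N + 1)) * F = φ N * F + φ (N + 1) * F by ring]
    linarith

/-! ### One variable functions and localization -/

theorem taylor_two {S : Set ℝ} (hS : Convex ℝ S) {f f' : ℝ → ℝ} {C : ℝ} (hC : 0 ≤ C)
    (h : ∀ x ∈ S, HasDerivWithinAt f (f' x) S x)
    (h' : ∀ x ∈ S, ∀ y ∈ S, |f' x - f' y| ≤ C * |x - y|) {s t : ℝ} (hs : s ∈ S) (ht : t ∈ S) :
    |f t - f s - f' s * (t - s)| ≤ C * (t - s) ^ 2 := by
  have hsub : uIcc s t ⊆ S := by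
    rw [← segment_eq_uIcc]; exact hS.segment_subset hs ht
  have key := Convex.norm_image_sub_le_of_norm_hasDerivWithin_le (s := uIcc s t)
    (f := fun x => f x - f' s * x) (f' := fun x => f' x - f' s) (C := C * |t - s|) (x := s) (y := t)
    (fun x hx => by
      have := ((h x (hsub hx)).mono hsub).sub ((hasDerivWithinAt_id x (uIcc s t)).const_mul (f' s))
      rwa [mul_one] at this)
    (fun x hx => by
      refine (h' x (hsub hx) s hs).trans ?_
      gcongr 1
      have := Set.abs_sub_left_of_mem_uIcc hx
      exact this)
    (convex_uIcc s t) left_mem_uIcc right_mem_uIcc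
  rw [Real.norm_eq_abs, Real.norm_eq_abs, mul_assoc, ← abs_mul, ← sq, abs_of_nonneg (sq_nonneg (t - s))]
    at key
  rwa [show f t - f s - f' s * (t - s) = f t - f' s * t - (f s - f' s * s) by ring]

theorem bump_bound {ψ : ℝ → ℝ} (h : ContDiff ℝ 2 ψ) (hc : HasCompactSupport ψ) :
    ∃ C, 0 ≤ C ∧ ∀ s, |ψ s| ≤ C ∧ |deriv ψ s| ≤ C ∧
      ∀ t, |ψ t - ψ s - deriv ψ s * (t - s)| ≤ C * (t - s) ^ 2 := by
  have hd : ContDiff ℝ 1 (deriv ψ) := by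
    have : ContDiff ℝ (1 + 1) ψ := by exact_mod_cast h
    exact (contDiff_succ_iff_deriv.mp this).2.2
  have hdd : Continuous (deriv (deriv ψ)) := hd.continuous_deriv le_rfl
  obtain ⟨A, hA⟩ := hc.exists_bound_of_continuous h.continuous
  obtain ⟨B, hB⟩ := hc.deriv.exists_bound_of_continuous hd.continuous
  obtain ⟨D, hD⟩ := hc.deriv.deriv.exists_bound_of_continuous hdd
  have hA0 := (norm_nonneg _).trans (hA 0)
  have hB0 := (norm_nonneg _).trans (hB 0)
  have hD0 := (norm_nonneg _).trans (hD 0)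
  refine ⟨A + B + D, by positivity, fun s => ⟨(hA s).trans (by linarith), (hB s).trans (by linarith),
    fun t => ?_⟩⟩
  have := taylor_two (S := univ) convex_univ (f := ψ) (f' := deriv ψ) hD0
    (fun x _ => ((h.differentiable (by norm_num)) x).hasDerivAt.hasDerivWithinAt)
    (fun x _ y _ => by
      have := Convex.norm_image_sub_le_of_norm_hasDerivWithin_le (s := univ) (f := deriv ψ)
        (f' := deriv (deriv ψ)) (C := D) (x := y) (y := x)
        (fun x _ => ((hd.differentiable (by norm_num)) x).hasDerivAt.hasDerivWithinAt)
        (fun x _ => hD x) convex_univ (mem_univ _) (mem_univ _)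
      exact this) (mem_univ s) (mem_univ t)
  refine this.trans ?_
  gcongr
  linarith

theorem QR.of_bump {n : ℕ} {ψ : ℝ → ℝ} {C : ℝ} (hC : 0 ≤ C) (h : ∀ s, |ψ s| ≤ C ∧ |deriv ψ s| ≤ C ∧
      ∀ t, |ψ t - ψ s - deriv ψ s * (t - s)| ≤ C * (t - s) ^ 2) {l : ℝ} (hl : 0 ≤ l) (b : ℝ)
    (c : Fin n) : QR l (fun x : En n => ψ (l * x c + b)) C := by
  refine ⟨hC, fun w hw => ?_⟩
  obtain ⟨h1, h2, h3⟩ := h (l * w c + b)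
  refine ⟨h1, (deriv ψ (l * w c + b) * l) • EuclideanSpace.single c (1 : ℝ), ?_, fun u hu => ?_⟩
  · rw [norm_smul, EuclideanSpace.norm_single, norm_one, mul_one, Real.norm_eq_abs, abs_mul,
      abs_of_nonneg hl]
    gcongr
  · have e : inner ℝ ((deriv ψ (l * w c + b) * l) • EuclideanSpace.single c (1 : ℝ)) (u - w) =
        deriv ψ (l * w c + b) * (l * u c + b - (l * w c + b)) := by
      rw [real_inner_smul_left, EuclideanSpace.inner_single_left]
      simp
      ring
    rw [e]
    refine (h3 _).trans ?_
    rw [show l * u c + b - (l * w c + b) = l * (u c - w c) by ring, mul_pow, mul_assoc]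
    have : (u c - w c) ^ 2 ≤ ‖u - w‖ ^ 2 := by
      have := PiLp.norm_apply_le (u - w) c
      rw [PiLp.sub_apply, Real.norm_eq_abs] at this
      rw [← sq_abs]
      gcongr
    gcongr

/-- the basic bump -/
def bmp (x : ℝ) : ℝ := Real.smoothTransition (x + 1) - Real.smoothTransition x

theorem bmp_contDiff : ContDiff ℝ 2 bmp := by
  unfold bmp
  have h : ContDiff ℝ 2 Real.smoothTransition := Real.smoothTransition.contDiff (n := 2)
  exact (h.comp (contDiff_id.add contDiff_const)).sub h

theorem bmp_nonneg (x : ℝ) : 0 ≤ bmp x :=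
  sub_nonneg.mpr (Real.smoothTransition.monotone (by linarith))

theorem bmp_supp {x : ℝ} (h : bmp x ≠ 0) : -1 < x ∧ x < 1 := by
  unfold bmp at h
  constructor
  · by_contra h1
    push Not at h1
    rw [Real.smoothTransition.zero_of_nonpos (by linarith),
      Real.smoothTransition.zero_of_nonpos (by linarith)] at h
    simp at h
  · by_contra h1
    push Not at h1
    rw [Real.smoothTransition.one_of_one_le (by linarith),
      Real.smoothTransition.one_of_one_le (by linarith)] at h
    simp at h

theorem bmp_compact : HasCompactSupport bmp := by
  apply HasCompactSupport.intro (isCompact_Icc (a := (-1 : ℝ)) (b := 1))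
  intro x hx
  by_contra h
  have := bmp_supp h
  exact hx ⟨this.1.le, this.2.le⟩

theorem bmp_sum (y : ℝ) (N : ℕ) (h0 : 0 ≤ y) (h1 : y ≤ N) :
    ∑ j ∈ Finset.range (N + 1), bmp (y - j) = 1 := by
  have key : ∀ m : ℕ, ∑ j ∈ Finset.range m, bmp (y - j) =
      Real.smoothTransition (y + 1) - Real.smoothTransition (y + 1 - m) := by
    intro m
    induction m with
    | zero => simp
    | succ m ih =>
      rw [Finset.sum_range_succ, ih]
      unfold bmp
      push_cast
      rw [show y - (m : ℝ) + 1 = y + 1 - m by ring, show y + 1 - ((m : ℝ) + 1) = y - m by ring]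
      ring
  rw [key, Real.smoothTransition.one_of_one_le (by linarith),
    Real.smoothTransition.zero_of_nonpos (by push_cast; linarith), sub_zero]

/-- localization data -/
def LocData {n : ℕ} (μ : ConvexBody (En n) → ℝ) (S : Finset (Fin n)) : Prop :=
  ∃ C : ℝ, 0 ≤ C ∧ ∀ l : ℕ, 1 ≤ l → ∃ (ι : Type) (_ : Fintype ι) (s : ι → ℝ) (χ : ι → En n → ℝ),
    (Fintype.card ι : ℝ) ≤ C * (l : ℝ) ^ S.card ∧ (∀ i, |s i| ≤ 1) ∧ (∀ i, QR l (χ i) C) ∧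
    (∀ i x y, χ i x ≠ 0 → χ i y ≠ 0 → ∀ c ∈ S, |x c - y c| ≤ 3 / l) ∧
    ∀ F, QB F → extV μ F = ∑ i, s i * extV μ (χ i * F)

theorem QR.toQB {n : ℕ} {l : ℝ} (hl : 1 ≤ l) {f : En n → ℝ} {C : ℝ} (h : QR l f C) : QB f :=
  ⟨_, h.to_one hl⟩

theorem locData_single {n : ℕ} {μ : ConvexBody (En n) → ℝ} (hμ : IsVal μ) (c : Fin n) :
    LocData μ {c} := by
  obtain ⟨C, hC0, hC⟩ := bump_bound bmp_contDiff bmp_compact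
  refine ⟨2 * C + 5, by positivity, fun l hl => ?_⟩
  have hl1 : (1 : ℝ) ≤ l := by exact_mod_cast hl
  set φ : ℕ → En n → ℝ := fun j x => bmp (l * x c + ((l : ℝ) - j)) with hφ
  have qφ : ∀ j, QR l (φ j) C := fun j => QR.of_bump hC0 hC (by linarith) _ c
  have sφ : ∀ j x, φ j x ≠ 0 → (j : ℝ) - 1 < l * x c + l ∧ l * x c + l < j + 1 := by
    intro j x h
    have := bmp_supp h
    constructor <;> linarith [this.1, this.2]
  have nφ : ∀ j x, 0 ≤ φ j x := fun j x => bmp_nonneg _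
  have one : ∀ x : En n, ‖x‖ = 1 → ∑ j ∈ Finset.range (2 * l + 1), φ j x = 1 := by
    intro x hx
    have := PiLp.norm_apply_le x c
    rw [hx, Real.norm_eq_abs] at this
    have h3 := abs_le.mp this
    rw [← bmp_sum (l * x c + l) (2 * l) (by nlinarith [h3.1]) (by push_cast; nlinarith [h3.2])]
    apply Finset.sum_congr rfl
    intro j _
    rw [hφ]; dsimp only
    congr 1; ring
  refine ⟨Option (Fin (2 * l) ⊕ Fin (2 * l)), inferInstance,
    fun i => match i with
      | none => 1
      | some (Sum.inl _) => 1
      | some (Sum.inr _) => -1,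
    fun i => match i with
      | none => φ 0
      | some (Sum.inl j) => φ j + φ (j + 1)
      | some (Sum.inr j) => φ j, ?_, ?_, ?_, ?_, ?_⟩
  · simp only [Fintype.card_option, Fintype.card_sum, Fintype.card_fin, Finset.card_singleton]
    push_cast
    nlinarith [mul_nonneg hC0 (zero_le_one.trans hl1)]
  · rintro (_ | j | j) <;> simp
  · rintro (_ | j | j)
    · exact (qφ _).mono (by linarith) (by linarith)
    · exact ((qφ _).add (qφ _)).mono (by linarith) (by linarith)
    · exact (qφ _).mono (by linarith) (by linarith)
  · have main : ∀ (j : ℝ) (x y : En n), j - 1 < l * x c + l → l * x c + l < j + 2 →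
        j - 1 < l * y c + l → l * y c + l < j + 2 → |x c - y c| ≤ 3 / l := by
      intro j x y h1 h2 h3 h4
      rw [le_div_iff₀ (by linarith), ← abs_of_pos (show (0 : ℝ) < l by linarith), ← abs_mul, abs_le]
      constructor <;> nlinarith
    have two : ∀ (j : ℕ) (x : En n), (φ j + φ (j + 1)) x ≠ 0 →
        (j : ℝ) - 1 < l * x c + l ∧ l * x c + l < j + 2 := by
      intro j x h
      by_cases h0 : φ j x = 0
      · have : φ (j + 1) x ≠ 0 := by
          intro h1; apply h; rw [Pi.add_apply, h0, h1, add_zero]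
        have := sφ _ _ this
        push_cast at this
        constructor <;> linarith [this.1, this.2]
      · have := sφ _ _ h0
        constructor <;> linarith [this.1, this.2]
    rintro (_ | j | j) x y hx hy c' hc'
    · rw [Finset.mem_singleton.mp hc']
      have h1 := sφ _ _ hx
      have h2 := sφ _ _ hy
      exact main _ x y h1.1 (by linarith [h1.2]) h2.1 (by linarith [h2.2])
    · rw [Finset.mem_singleton.mp hc']
      have h1 := two _ _ hx
      have h2 := two _ _ hy
      exact main _ x y h1.1 h1.2 h2.1 h2.2
    · rw [Finset.mem_singleton.mp hc']
      have h1 := sφ _ _ hx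
      have h2 := sφ _ _ hy
      exact main _ x y h1.1 (by linarith [h1.2]) h2.1 (by linarith [h2.2])
  · intro F bF
    have := extV_chain hμ (φ := φ) (fun j => (qφ j).toQB hl1) (fun j u _ => nφ j u)
      (fun j k u hjk hu => by
        by_contra h
        have h1 := sφ _ _ (left_ne_zero_of_mul h)
        have h2 := sφ _ _ (right_ne_zero_of_mul h)
        have : (j : ℝ) + 2 ≤ k := by exact_mod_cast hjk
        linarith [h1.2, h2.1]) bF (2 * l)
    rw [Fintype.sum_option, Fintype.sum_sum_type]
    simp only [one_mul, neg_one_mul]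
    rw [Finset.sum_neg_distrib, ← sub_eq_add_neg, ← Finset.sum_sub_distrib,
      Fin.sum_univ_eq_sum_range (fun j => extV μ ((φ j + φ (j + 1)) * F) - extV μ (φ j * F)),
      ← this]
    apply extV_congr
    intro u hu
    rw [Pi.mul_apply, Finset.sum_apply, one u hu, one_mul]

theorem locData_all {n : ℕ} {μ : ConvexBody (En n) → ℝ} (hμ : IsVal μ) (S : Finset (Fin n)) :
    LocData μ S := by
  classical
  induction S using Finset.induction_on with
  | empty =>
    refine ⟨1, zero_le_one, fun l hl => ⟨Unit, inferInstance, fun _ => 1, fun _ => 1, ?_, ?_, ?_, ?_,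
      ?_⟩⟩
    · simp
    · simp
    · intro i
      have := QR.const (n := n) l (Nat.cast_nonneg l) 1
      rwa [abs_one] at this
    · simp
    · intro F _; simp
  | insert a S ha ih =>
    obtain ⟨C, hC, h⟩ := ih
    obtain ⟨D, hD, h'⟩ := locData_single hμ a
    refine ⟨6 * C * D, by positivity, fun l hl => ?_⟩
    obtain ⟨ι, _, s, χ, h1, h2, h3, h4, h5⟩ := h l hl
    obtain ⟨ι', _, s', χ', h1', h2', h3', h4', h5'⟩ := h' l hl
    have hl1 : (1 : ℝ) ≤ l := by exact_mod_cast hl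
    refine ⟨ι × ι', inferInstance, fun i => s i.1 * s' i.2, fun i => χ i.1 * χ' i.2, ?_, ?_, ?_, ?_,
      ?_⟩
    · rw [Fintype.card_prod, Finset.card_insert_of_notMem ha]
      push_cast
      rw [Finset.card_singleton, pow_one] at h1'
      calc (Fintype.card ι : ℝ) * Fintype.card ι' ≤ (C * l ^ S.card) * (D * l) := by gcongr
        _ = (C * D) * l ^ (S.card + 1) := by ring
        _ ≤ _ := by
          gcongr
          nlinarith [mul_nonneg hC hD]
    · intro i
      rw [abs_mul]
      exact mul_le_one₀ (h2 _) (abs_nonneg _) (h2' _)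
    · intro i
      exact (h3 _).mul (h3' _) (by linarith)
    · intro i x y hx hy c hc
      rcases Finset.mem_insert.mp hc with rfl | hc
      · exact h4' i.2 x y (right_ne_zero_of_mul hx) (right_ne_zero_of_mul hy) c
          (Finset.mem_singleton_self _)
      · exact h4 i.1 x y (left_ne_zero_of_mul hx) (left_ne_zero_of_mul hy) c hc
    · intro F bF
      rw [h5 F bF, Fintype.sum_prod_type]
      apply Finset.sum_congr rfl
      intro i _
      rw [h5' _ (((h3 i).toQB hl1).mul bF), Finset.mul_sum]
      apply Finset.sum_congr rfl
      intro j _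
      rw [mul_assoc, show χ' j * (χ i * F) = χ i * χ' j * F by ring]

/-! ### Localization at a point -/

theorem norm_le_sum_coord {n : ℕ} (x : En n) : ‖x‖ ≤ ∑ c, |x c| := by
  have h : x = ∑ c, x c • EuclideanSpace.single c (1 : ℝ) := by
    have := (EuclideanSpace.basisFun (Fin n) ℝ).sum_repr x
    simpa using this.symm
  conv_lhs => rw [h]
  refine (norm_sum_le _ _).trans (Finset.sum_le_sum fun c _ => ?_)
  rw [norm_smul]; simp

theorem loc_group {n : ℕ} {μ : ConvexBody (En n) → ℝ} (hμ : IsVal μ)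
    (T : Set (En n ≃ₗᵢ[ℝ] En n)) (hinv : ∀ g ∈ T, InvUnder μ g) (o : En n)
    (htrans : ∀ x, ‖x‖ = 1 → ∃ g ∈ T, g o = x) (hne : T.Nonempty) :
    ∃ C : ℝ, 0 ≤ C ∧ ∀ l : ℕ, 1 ≤ l → ∃ (ι : Type) (_ : Fintype ι) (s : ι → ℝ) (χ : ι → En n → ℝ)
      (g : ι → En n ≃ₗᵢ[ℝ] En n), (∀ i, g i ∈ T) ∧
    (Fintype.card ι : ℝ) ≤ C * (l : ℝ) ^ n ∧ (∀ i, |s i| ≤ 1) ∧ (∀ i, QR l (χ i) C) ∧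
    (∀ i x, ‖x‖ = 1 → χ i x ≠ 0 → ∀ c, |x c - o c| ≤ 3 * n / l) ∧
    ∀ F, QB F → extV μ F = ∑ i, s i * extV μ (χ i * fun x => F (g i x)) := by
  obtain ⟨C, hC, h⟩ := locData_all hμ Finset.univ
  refine ⟨C, hC, fun l hl => ?_⟩
  obtain ⟨ι, _, s, χ, h1, h2, h3, h4, h5⟩ := h l hl
  have hl1 : (1 : ℝ) ≤ l := by exact_mod_cast hl
  have ex : ∀ i, ∃ g ∈ T, ∀ x, ‖x‖ = 1 → χ i (g x) ≠ 0 → ∀ c, |x c - o c| ≤ 3 * n / l := by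
    intro i
    by_cases hi : ∃ y, ‖y‖ = 1 ∧ χ i y ≠ 0
    · obtain ⟨y, hy, hy0⟩ := hi
      obtain ⟨g, hg, hgo⟩ := htrans y hy
      refine ⟨g, hg, fun x hx hx0 c => ?_⟩
      have h6 : ‖g x - g o‖ ≤ 3 * n / l := by
        refine (norm_le_sum_coord _).trans ?_
        calc ∑ c, |(g x - g o) c| ≤ ∑ c : Fin n, (3 / (l : ℝ)) := by
              apply Finset.sum_le_sum
              intro c _
              rw [PiLp.sub_apply, hgo]
              exact h4 i _ _ hx0 hy0 c (Finset.mem_univ c)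
          _ = 3 * n / l := by
              rw [Finset.sum_const, Finset.card_univ, Fintype.card_fin, nsmul_eq_mul]; ring
      rw [← map_sub, g.norm_map] at h6
      have := PiLp.norm_apply_le (x - o) c
      rw [PiLp.sub_apply, Real.norm_eq_abs] at this
      exact this.trans h6
    · obtain ⟨g, hg⟩ := hne
      refine ⟨g, hg, fun x hx hx0 => ?_⟩
      exact absurd ⟨g x, by rw [g.norm_map, hx], hx0⟩ hi
  choose g hg hg' using ex
  rw [Finset.card_univ, Fintype.card_fin] at h1
  refine ⟨ι, inferInstance, s, fun i x => χ i (g i x), g, hg, h1, h2, fun i => (h3 i).comp (g i), hg', ?_⟩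
  intro F bF
  rw [h5 F bF]
  apply Finset.sum_congr rfl
  intro i _
  congr 1
  exact (extV_comp hμ (hinv _ (hg i)) (((h3 i).toQB hl1).mul bF).nice).symm

theorem exists_clamp (R : ℝ) (hR : 0 < R) : ∃ (ψ : ℝ → ℝ) (C : ℝ), 0 ≤ C ∧ (∀ t, |t| ≤ R → ψ t = t) ∧
    ∀ s, |ψ s| ≤ C ∧ |deriv ψ s| ≤ C ∧ ∀ t, |ψ t - ψ s - deriv ψ s * (t - s)| ≤ C * (t - s) ^ 2 := by
  let b : ContDiffBump (0 : ℝ) := ⟨R, R + 1, hR, by linarith⟩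
  obtain ⟨C, hC0, hC⟩ := bump_bound (ψ := fun t => t * b t) (contDiff_id.mul b.contDiff)
    (b.hasCompactSupport.mul_left)
  refine ⟨fun t => t * b t, C, hC0, fun t ht => ?_, hC⟩
  have : b t = 1 := b.one_of_mem_closedBall (by
    rw [mem_closedBall, dist_zero_right]; exact ht)
  dsimp only
  rw [this, mul_one]

theorem QR.pow {n : ℕ} {l : ℝ} {f : En n → ℝ} {B : ℝ} (hl : 0 ≤ l) (h : QR l f B) (k : ℕ) :
    QR l (f ^ k) ((6 * B) ^ k) := by
  induction k with
  | zero =>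
    have := QR.const (n := n) l hl 1
    rw [abs_one] at this
    rw [pow_zero, pow_zero]; exact this
  | succ k ih =>
    rw [pow_succ, pow_succ]
    exact (ih.mul h hl).mono (le_of_eq (by ring)) hl

theorem QR.prod {n : ℕ} {l : ℝ} (hl : 0 ≤ l) {y : Fin n → En n → ℝ} {B : ℝ}
    (h : ∀ c, QR l (y c) B) (α : Fin n → ℕ) (S : Finset (Fin n)) :
    QR l (∏ c ∈ S, y c ^ α c) (6 ^ S.card * (6 * B) ^ (∑ c ∈ S, α c)) := by
  classical
  induction S using Finset.induction_on with
  | empty =>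
    have := QR.const (n := n) l hl 1
    rw [abs_one] at this
    simp only [Finset.prod_empty, Finset.card_empty, pow_zero, Finset.sum_empty, mul_one]
    exact this
  | insert a S ha ih =>
    rw [Finset.prod_insert ha, Finset.sum_insert ha, Finset.card_insert_of_notMem ha]
    refine (((h a).pow hl _).mul ih hl).mono (le_of_eq ?_) hl
    rw [pow_add, pow_succ]; ring

/-- monomials in the functions `y` -/
def mon {n : ℕ} (y : Fin n → En n → ℝ) (α : Fin n →₀ ℕ) : En n → ℝ := ∏ c, y c ^ α c

theorem loc_est {n : ℕ} {μ : ConvexBody (En n) → ℝ} (hμ : IsVal μ) (C D B : ℝ) (hC : 0 ≤ C)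
    (hD : 0 ≤ D) (hB : 0 ≤ B) (A s : Finset (Fin n →₀ ℕ)) (hAs : A ⊆ s)
    (hA : ∀ α, α ∉ A → 5 * n + 3 ≤ ∑ c, α c) :
    ∃ K : ℝ, 0 ≤ K ∧ ∃ l0 : ℕ, 1 ≤ l0 ∧ ∀ l : ℕ, l0 ≤ l → ∀ (χ : En n → ℝ) (y : Fin n → En n → ℝ)
      (a : (Fin n →₀ ℕ) → ℝ), QR l χ C → (∀ c, QR l (y c) (D / l)) → (∀ α, |a α| ≤ B) →
      |extV μ (χ * ∑ α ∈ s, a α • mon y α) - extV μ (χ * ∑ α ∈ A, a α • mon y α)| ≤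
        K / (l : ℝ) ^ (n + 1) := by
  classical
  obtain ⟨Λ, hΛ0, hΛ⟩ := extV_lip hμ
  set c0 := 6 * C * ∑ α ∈ A, B * (6 ^ n * (6 * D) ^ (∑ c, α c)) with hc0
  set c1 := 6 * C * (∑ α ∈ s \ A, B * (6 ^ n * (6 * D) ^ (∑ c, α c))) + 1 with hc1
  have h0 : 0 ≤ c0 := by positivity
  have h1 : 1 ≤ c1 := by
    have : 0 ≤ 6 * C * (∑ α ∈ s \ A, B * (6 ^ n * (6 * D) ^ (∑ c, α c))) := by positivity
    linarith
  refine ⟨Λ * (1 + c0) ^ (2 * n) * c1, by positivity, max 1 ⌈c1⌉₊, le_max_left _ _, ?_⟩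
  intro l hl χ y a hχ hy ha
  have hl1 : (1 : ℝ) ≤ l := by exact_mod_cast (le_max_left _ _).trans hl
  have hlc : c1 ≤ l := (Nat.le_ceil c1).trans (by exact_mod_cast (le_max_right _ _).trans hl)
  have hl0 : (0 : ℝ) < l := by linarith
  have q1 : ∀ α, QR l (a α • mon y α) (B * (6 ^ n * (6 * D) ^ (∑ c, α c)) / l ^ (∑ c, α c)) := by
    intro α
    have := (QR.prod hl0.le hy α Finset.univ).smul (a α)
    rw [Finset.card_univ, Fintype.card_fin] at this
    refine this.mono ?_ hl0.le
    rw [← mul_div_assoc, div_pow, mul_div_assoc, mul_div_assoc]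
    gcongr
    exact ha α
  have qA : QR l (χ * ∑ α ∈ A, a α • mon y α) c0 := by
    refine (hχ.mul (QR.sum hl0.le A _ _ fun α _ => q1 α) hl0.le).mono ?_ hl0.le
    rw [hc0]
    gcongr
    apply div_le_self (by positivity)
    exact one_le_pow₀ hl1
  have qs : QR l (χ * ∑ α ∈ s \ A, a α • mon y α) (c1 / l ^ (5 * n + 3)) := by
    refine (hχ.mul (QR.sum hl0.le (s \ A) _ _ fun α _ => q1 α) hl0.le).mono ?_ hl0.le
    have : ∑ α ∈ s \ A, B * (6 ^ n * (6 * D) ^ (∑ c, α c)) / (l : ℝ) ^ (∑ c, α c) ≤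
        (∑ α ∈ s \ A, B * (6 ^ n * (6 * D) ^ (∑ c, α c))) / l ^ (5 * n + 3) := by
      rw [Finset.sum_div]
      apply Finset.sum_le_sum
      intro α hα
      gcongr
      exact hA α (Finset.mem_sdiff.mp hα).2
    calc _ ≤ 6 * C * ((∑ α ∈ s \ A, B * (6 ^ n * (6 * D) ^ (∑ c, α c))) / l ^ (5 * n + 3)) := by
          gcongr
      _ ≤ _ := by
        rw [← mul_div_assoc]
        gcongr
        rw [hc1]; linarith
  have qA' := qA.to_one hl1
  have qs' := qs.to_one hl1
  have e1 : c1 / (l : ℝ) ^ (5 * n + 3) * l ^ 2 = c1 / l ^ (5 * n + 1) := by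
    rw [show 5 * n + 3 = 5 * n + 1 + 2 by ring, pow_add (l : ℝ) (5 * n + 1) 2]
    field_simp
  rw [e1] at qs'
  have hs : χ * ∑ α ∈ s, a α • mon y α =
      χ * ∑ α ∈ A, a α • mon y α + χ * ∑ α ∈ s \ A, a α • mon y α := by
    rw [← mul_add, add_comm, Finset.sum_sdiff hAs]
  rw [hs]
  have hε1 : c1 / (l : ℝ) ^ (5 * n + 1) ≤ 1 := by
    rw [div_le_one (by positivity)]
    exact hlc.trans (le_self_pow₀ hl1 (by omega))
  refine (hΛ _ _ _ _ qA' qs' (by positivity) hε1).trans ?_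
  have e2 : (1 + c0 * (l : ℝ) ^ 2) ^ (2 * n) ≤ (1 + c0) ^ (2 * n) * l ^ (4 * n) := by
    rw [show (l : ℝ) ^ (4 * n) = ((l : ℝ) ^ 2) ^ (2 * n) by rw [← pow_mul]; congr 1; ring, ← mul_pow]
    gcongr
    have : (1 : ℝ) ≤ (l : ℝ) ^ 2 := one_le_pow₀ hl1
    nlinarith
  calc Λ * (1 + c0 * (l : ℝ) ^ 2) ^ (2 * n) * (c1 / l ^ (5 * n + 1)) ≤
      Λ * ((1 + c0) ^ (2 * n) * l ^ (4 * n)) * (c1 / l ^ (5 * n + 1)) := by gcongr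
    _ = _ := by
      rw [show 5 * n + 1 = 4 * n + (n + 1) by ring, pow_add (l : ℝ) (4 * n) (n + 1)]
      field_simp

/-- products of Lagrange polynomials -/
def lagProd {n : ℕ} (A : Finset (Fin n →₀ ℕ)) (k : (Fin n →₀ ℕ) → Fin (4 * n + 1))
    (a : (Fin n →₀ ℕ) → ℝ) : ℝ := ∏ α ∈ A, (lag (4 * n) (k α)).eval (a α)

theorem extV_multi {n : ℕ} {μ : ConvexBody (En n) → ℝ} (hμ : IsVal μ)
    (e : (Fin n →₀ ℕ) → En n → ℝ) (he : ∀ α, QB (e α)) (A : Finset (Fin n →₀ ℕ)) :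
    ∀ e0 : En n → ℝ, QB e0 →
      (fun a : (Fin n →₀ ℕ) → ℝ => extV μ (e0 + ∑ α ∈ A, a α • e α)) ∈
        Submodule.span ℝ (Set.range (lagProd A)) := by
  classical
  induction A using Finset.induction_on with
  | empty =>
    intro e0 _
    have : (fun a : (Fin n →₀ ℕ) → ℝ => extV μ (e0 + ∑ α ∈ (∅ : Finset (Fin n →₀ ℕ)), a α • e α)) =
        (extV μ e0) • lagProd ∅ (fun _ => 0) := by
      funext a; simp [lagProd]
    rw [this]
    exact Submodule.smul_mem _ _ (Submodule.subset_span ⟨_, rfl⟩)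
  | insert β A hβ ih =>
    intro e0 h0
    have key : (fun a : (Fin n →₀ ℕ) → ℝ => extV μ (e0 + ∑ α ∈ insert β A, a α • e α)) =
        ∑ k ∈ Finset.range (4 * n + 1), (fun a : (Fin n →₀ ℕ) → ℝ => (lag (4 * n) k).eval (a β)) *
          (fun a : (Fin n →₀ ℕ) → ℝ => extV μ ((e0 + (k : ℝ) • e β) + ∑ α ∈ A, a α • e α)) := by
      funext a
      rw [Finset.sum_insert hβ, show e0 + (a β • e β + ∑ α ∈ A, a α • e α) =
        (e0 + ∑ α ∈ A, a α • e α) + a β • e β by abel,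
        extV_all hμ (h0.add (QB.sum _ _ fun α _ => (he α).smul _)) (he β), Finset.sum_apply]
      apply Finset.sum_congr rfl
      intro k _
      rw [Pi.mul_apply, mul_comm]
      congr 2
      abel
    rw [key]
    apply Submodule.sum_mem
    intro k hk
    have hm := ih (e0 + (k : ℝ) • e β) (h0.add ((he β).smul _))
    generalize (fun a : (Fin n →₀ ℕ) → ℝ => extV μ ((e0 + (k : ℝ) • e β) + ∑ α ∈ A, a α • e α)) = φ
      at hm
    induction hm using Submodule.span_induction with
    | mem x hx =>
      obtain ⟨k', rfl⟩ := hx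
      apply Submodule.subset_span
      refine ⟨Function.update k' β ⟨k, Finset.mem_range.mp hk⟩, ?_⟩
      funext a
      rw [Pi.mul_apply]
      unfold lagProd
      rw [Finset.prod_insert hβ, Function.update_self]
      congr 1
      apply Finset.prod_congr rfl
      intro α hα
      rw [Function.update_of_ne (by rintro rfl; exact hβ hα)]
    | zero => rw [mul_zero]; exact Submodule.zero_mem _
    | add x y _ _ hx hy => rw [mul_add]; exact Submodule.add_mem _ hx hy
    | smul c x _ hx => rw [mul_smul_comm]; exact Submodule.smul_mem _ _ hx

/-! ### Averaging over the group -/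

/-- continuous families of polynomials -/
def CF {n : ℕ} {Γ : Type*} [TopologicalSpace Γ] (F : Γ → MvPolynomial (Fin n) ℝ) : Prop :=
  (∃ s : Finset (Fin n →₀ ℕ), ∀ g, (F g).support ⊆ s) ∧ ∀ α, Continuous fun g => (F g).coeff α

theorem CF.add {n : ℕ} {Γ : Type*} [TopologicalSpace Γ] {F F' : Γ → MvPolynomial (Fin n) ℝ}
    (h : CF F) (h' : CF F') : CF fun g => F g + F' g := by
  classical
  obtain ⟨⟨s, hs⟩, hc⟩ := h
  obtain ⟨⟨s', hs'⟩, hc'⟩ := h'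
  refine ⟨⟨s ∪ s', fun g => MvPolynomial.support_add.trans (Finset.union_subset_union (hs g) (hs' g))⟩,
    fun α => ?_⟩
  simp only [MvPolynomial.coeff_add]
  exact (hc α).add (hc' α)

theorem CF.mul {n : ℕ} {Γ : Type*} [TopologicalSpace Γ] {F F' : Γ → MvPolynomial (Fin n) ℝ}
    (h : CF F) (h' : CF F') : CF fun g => F g * F' g := by
  classical
  obtain ⟨⟨s, hs⟩, hc⟩ := h
  obtain ⟨⟨s', hs'⟩, hc'⟩ := h'
  refine ⟨⟨s + s', fun g => (MvPolynomial.support_mul _ _).trans (Finset.add_subset_add (hs g) (hs' g))⟩,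
    fun α => ?_⟩
  simp only [MvPolynomial.coeff_mul]
  exact continuous_finsetSum _ fun x _ => (hc _).mul (hc' _)

theorem CF.C {n : ℕ} {Γ : Type*} [TopologicalSpace Γ] {c : Γ → ℝ} (hc : Continuous c) :
    CF fun g => (MvPolynomial.C (c g) : MvPolynomial (Fin n) ℝ) := by
  classical
  refine ⟨⟨{0}, fun g => ?_⟩, fun α => ?_⟩
  · dsimp only; rw [MvPolynomial.C_apply]; exact MvPolynomial.support_monomial_subset
  · simp only [MvPolynomial.coeff_C]
    split_ifs
    · exact hc
    · exact continuous_const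

theorem CF.X {n : ℕ} {Γ : Type*} [TopologicalSpace Γ] (j : Fin n) :
    CF fun _ : Γ => (MvPolynomial.X j : MvPolynomial (Fin n) ℝ) :=
  ⟨⟨_, fun _ => subset_rfl⟩, fun _ => continuous_const⟩

theorem CF.sum {n : ℕ} {Γ : Type*} [TopologicalSpace Γ] {ι : Type*} (S : Finset ι)
    (F : ι → Γ → MvPolynomial (Fin n) ℝ) (h : ∀ i, CF (F i)) : CF fun g => ∑ i ∈ S, F i g := by
  classical
  induction S using Finset.induction_on with
  | empty =>
    have := CF.C (n := n) (Γ := Γ) (c := fun _ => 0) continuous_const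
    simpa using this
  | insert a S ha ih =>
    simp only [Finset.sum_insert ha]
    exact (h a).add ih

/-- the polynomial as a function on Euclidean space -/
def pf {n : ℕ} (p : MvPolynomial (Fin n) ℝ) : En n → ℝ := fun x => MvPolynomial.eval (fun i => x i) p

theorem QB.coord {n : ℕ} (c : Fin n) : QB fun x : En n => x c := by
  refine ⟨1, zero_le_one, fun w hw => ⟨?_, EuclideanSpace.single c (1 : ℝ), ?_, fun u hu => ?_⟩⟩
  · have := PiLp.norm_apply_le w c
    rwa [hw] at this
  · simp
  · rw [EuclideanSpace.inner_single_left]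
    simp only [map_one, one_mul, PiLp.sub_apply, sub_self, abs_zero]
    positivity

theorem QB.pf {n : ℕ} (p : MvPolynomial (Fin n) ℝ) : QB (pf p) := by
  induction p using MvPolynomial.induction_on with
  | C a =>
    have := QB.const (n := n) a
    unfold _root_.pf
    simpa using this
  | add p q hp hq =>
    have := hp.add hq
    unfold _root_.pf at *
    simp only [map_add]
    exact this
  | mul_X p i hp =>
    have := hp.mul (QB.coord i)
    unfold _root_.pf at *
    simp only [map_mul, MvPolynomial.eval_X]
    exact this

theorem exists_fam {n : ℕ} {Γ : Type*} [Group Γ] [TopologicalSpace Γ] [IsTopologicalGroup Γ]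
    (ρ : Γ →* (En n ≃ₗᵢ[ℝ] En n)) (hρ : ∀ x, Continuous fun g => ρ g x) (o : En n)
    (p : MvPolynomial (Fin n) ℝ) : ∃ F : Γ → MvPolynomial (Fin n) ℝ, CF F ∧
      ∀ g x, pf p (ρ g⁻¹ x) = MvPolynomial.eval (fun i => x i - o i) (F g) := by
  induction p using MvPolynomial.induction_on with
  | C a =>
    exact ⟨fun _ => MvPolynomial.C a, CF.C continuous_const, fun g x => by simp [pf]⟩
  | add p q hp hq =>
    obtain ⟨F, h1, h2⟩ := hp
    obtain ⟨F', h1', h2'⟩ := hq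
    refine ⟨_, h1.add h1', fun g x => ?_⟩
    rw [map_add, ← h2, ← h2']
    simp [pf]
  | mul_X p i hp =>
    obtain ⟨F, h1, h2⟩ := hp
    refine ⟨_, h1.mul (CF.sum Finset.univ (fun j g =>
      MvPolynomial.C (ρ g⁻¹ (EuclideanSpace.single j (1 : ℝ)) i) *
        (MvPolynomial.X j + MvPolynomial.C (o j))) fun j => ?_), fun g x => ?_⟩
    · refine (CF.C ?_).mul ((CF.X j).add (CF.C continuous_const))
      have h3 := (hρ (EuclideanSpace.single j (1 : ℝ))).comp (continuous_inv (G := Γ))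
      exact (PiLp.continuous_apply 2 (fun _ : Fin n => ℝ) i).comp h3
    · rw [map_mul, ← h2, map_sum]
      have h : x = ∑ c, x c • EuclideanSpace.single c (1 : ℝ) := by
        have := (EuclideanSpace.basisFun (Fin n) ℝ).sum_repr x
        simpa using this.symm
      have h4 : (ρ g⁻¹ x) i = ∑ j, (ρ g⁻¹ (EuclideanSpace.single j (1 : ℝ)) i) * x j := by
        conv_lhs => rw [h, map_sum]
        rw [WithLp.ofLp_sum, Finset.sum_apply]
        apply Finset.sum_congr rfl
        intro j _
        rw [map_smul, PiLp.smul_apply, smul_eq_mul, mul_comm]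
      unfold pf
      rw [map_mul, MvPolynomial.eval_X, h4]
      congr 1
      apply Finset.sum_congr rfl
      intro j _
      simp

theorem exists_index (n M : ℕ) : ∃ A : Finset (Fin n →₀ ℕ), ∀ α, α ∉ A → M ≤ ∑ c, α c := by
  refine ⟨Finset.Iic (Finsupp.equivFunOnFinite.symm fun _ => M), fun α hα => ?_⟩
  rw [Finset.mem_Iic, Finsupp.le_def] at hα
  push Not at hα
  obtain ⟨c, hc⟩ := hα
  have : M < α c := hc
  exact this.le.trans (Finset.single_le_sum (f := fun c => α c) (fun _ _ => Nat.zero_le _)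
    (Finset.mem_univ c))

theorem lagProd_finite {n : ℕ} (A : Finset (Fin n →₀ ℕ)) : (Set.range (lagProd A)).Finite := by
  have : Set.range (lagProd A) ⊆ Set.range fun (k : A → Fin (4 * n + 1)) (a : (Fin n →₀ ℕ) → ℝ) =>
      ∏ α : A, (lag (4 * n) (k α)).eval (a α) := by
    rintro _ ⟨k, rfl⟩
    refine ⟨fun α => k α, ?_⟩
    funext a
    unfold lagProd
    exact Finset.prod_coe_sort A fun α => (lag (4 * n) (k α)).eval (a α)
  exact (Set.finite_range _).subset this

theorem continuous_of_span {n : ℕ} {Γ : Type*} [TopologicalSpace Γ] (A : Finset (Fin n →₀ ℕ))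
    {φ : ((Fin n →₀ ℕ) → ℝ) → ℝ} (hφ : φ ∈ Submodule.span ℝ (Set.range (lagProd A)))
    (a : Γ → (Fin n →₀ ℕ) → ℝ) (ha : ∀ α, Continuous fun g => a g α) :
    Continuous fun g => φ (a g) := by
  induction hφ using Submodule.span_induction with
  | mem x hx =>
    obtain ⟨k, rfl⟩ := hx
    unfold lagProd
    exact continuous_finsetProd _ fun α _ => (Polynomial.continuous _).comp (ha α)
  | zero => exact continuous_const
  | add x y _ _ hx hy => exact hx.add hy
  | smul c x _ hx => exact hx.const_smul c

theorem QB.mon {n : ℕ} {y : Fin n → En n → ℝ} (h : ∀ c, QB (y c)) (α : Fin n →₀ ℕ) : QB (mon y α) := by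
  classical
  have hp : ∀ c, ∀ k : ℕ, QB (y c ^ k) := by
    intro c k
    induction k with
    | zero => simp only [pow_zero, Finset.prod_empty]; exact QB.const (n := n) 1
    | succ k ih => rw [pow_succ]; exact ih.mul (h c)
  unfold _root_.mon
  have : ∀ s : Finset (Fin n), QB (∏ c ∈ s, y c ^ α c) := by
    intro s
    induction s using Finset.induction_on with
    | empty => simp only [pow_zero, Finset.prod_empty]; exact QB.const (n := n) 1
    | insert a s ha ih => rw [Finset.prod_insert ha]; exact (hp a _).mul ih
  exact this _

theorem mul_sum_mon {n : ℕ} (χ : En n → ℝ) (y : Fin n → En n → ℝ) (s : Finset (Fin n →₀ ℕ))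
    (a : (Fin n →₀ ℕ) → ℝ) :
    χ * ∑ α ∈ s, a α • mon y α = 0 + ∑ α ∈ s, a α • (χ * mon y α) := by
  rw [zero_add, Finset.mul_sum]
  apply Finset.sum_congr rfl
  intro α _
  rw [mul_smul_comm]

/-- local coordinate functions -/
theorem exists_y (n : ℕ) (o : En n) : ∃ D : ℝ, 0 ≤ D ∧ ∀ l : ℕ, 1 ≤ l → ∃ y : Fin n → En n → ℝ,
    (∀ c, QR l (y c) (D / l)) ∧ ∀ c x, |x c - o c| ≤ 3 * n / l → y c x = x c - o c := by
  obtain ⟨ψ, C, hC, h1, h2⟩ := exists_clamp (3 * n + 1) (by positivity)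
  refine ⟨C, hC, fun l hl => ⟨fun c => (l : ℝ)⁻¹ • fun x => ψ (l * x c + (-(l * o c))), ?_, ?_⟩⟩
  · intro c
    have := (QR.of_bump (n := n) hC h2 (l := l) (by positivity) (-(l * o c)) c).smul (l : ℝ)⁻¹
    rw [abs_of_nonneg (by positivity : (0:ℝ) ≤ (l : ℝ)⁻¹)] at this
    rwa [div_eq_inv_mul]
  · intro c x hx
    have hl0 : (0 : ℝ) < l := by exact_mod_cast hl
    have : (l : ℝ) * x c + (-(l * o c)) = l * (x c - o c) := by ring
    simp only [Pi.smul_apply, smul_eq_mul, this]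
    rw [h1, inv_mul_cancel_left₀ hl0.ne']
    rw [abs_mul, abs_of_pos hl0]
    calc (l : ℝ) * |x c - o c| ≤ l * (3 * n / l) := by gcongr
      _ = 3 * n := by field_simp
      _ ≤ _ := by linarith

theorem mem_J {n : ℕ} {Γ : Type*} [TopologicalSpace Γ] [CompactSpace Γ] [MeasurableSpace Γ] [BorelSpace Γ]
    (ν : Measure Γ) [IsProbabilityMeasure ν] (A : Finset (Fin n →₀ ℕ)) {ι : Type*}
    (a : ι → Γ → (Fin n →₀ ℕ) → ℝ) (ha : ∀ p α, Continuous fun g => a p g α)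
    {φ : ((Fin n →₀ ℕ) → ℝ) → ℝ} (hφ : φ ∈ Submodule.span ℝ (Set.range (lagProd A))) :
    (fun p => ∫ g, φ (a p g) ∂ν) ∈
      Submodule.span ℝ (Set.range fun (ψ : Set.range (lagProd A)) (p : ι) => ∫ g, ψ.1 (a p g) ∂ν) := by
  have hIntg : ∀ {φ : ((Fin n →₀ ℕ) → ℝ) → ℝ}, φ ∈ Submodule.span ℝ (Set.range (lagProd A)) →
      ∀ p, Integrable (fun g => φ (a p g)) ν := by
    intro φ h p
    have hc := continuous_of_span A h (a p) (ha p)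
    exact hc.integrable_of_hasCompactSupport (HasCompactSupport.of_compactSpace _)
  induction hφ using Submodule.span_induction with
  | mem x hx => exact Submodule.subset_span ⟨⟨x, hx⟩, rfl⟩
  | zero =>
    convert Submodule.zero_mem _ using 1
    funext p
    simp
  | add x y hx hy h1 h2 =>
    convert Submodule.add_mem _ h1 h2 using 1
    funext p
    rw [Pi.add_apply, ← integral_add (hIntg hx p) (hIntg hy p)]
    rfl
  | smul c x hx h =>
    convert Submodule.smul_mem _ c h using 1
    funext p
    rw [Pi.smul_apply, smul_eq_mul, ← integral_const_mul]
    rfl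

theorem span_main {n : ℕ} {Γ : Type*} [Group Γ] [TopologicalSpace Γ] [IsTopologicalGroup Γ]
    [CompactSpace Γ] [MeasurableSpace Γ] [BorelSpace Γ] (ν : Measure Γ) [IsProbabilityMeasure ν]
    [ν.IsMulLeftInvariant]
    (ρ : Γ →* (En n ≃ₗᵢ[ℝ] En n)) (hρ : ∀ x, Continuous fun g => ρ g x) (o : En n)
    (htrans : ∀ x, ‖x‖ = 1 → ∃ g, ρ g o = x) :
    ∃ W : Submodule ℝ (MvPolynomial (Fin n) ℝ → ℝ), FiniteDimensional ℝ W ∧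
      ∀ μ : ConvexBody (En n) → ℝ, IsVal μ → (∀ g, InvUnder μ (ρ g)) → (fun p => extV μ (pf p)) ∈ W := by
  classical
  choose F hCF hF using fun p => exists_fam ρ hρ o p
  obtain ⟨A, hA⟩ := exists_index n (5 * n + 3)
  set a : MvPolynomial (Fin n) ℝ → Γ → (Fin n →₀ ℕ) → ℝ := fun p g α => (F p g).coeff α with ha
  have hac : ∀ p α, Continuous fun g => a p g α := fun p => (hCF p).2
  set W := Submodule.span ℝ (Set.range fun (ψ : Set.range (lagProd A)) (p : MvPolynomial (Fin n) ℝ) =>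
    ∫ g, ψ.1 (a p g) ∂ν) with hW
  have hfin : FiniteDimensional ℝ W := by
    have : Finite (Set.range (lagProd A)) := (lagProd_finite A)
    exact FiniteDimensional.span_of_finite ℝ (Set.finite_range _)
  refine ⟨W, hfin, fun μ hμ hinv => ?_⟩
  obtain ⟨C, hC, hloc⟩ := loc_group hμ (Set.range ρ) (by rintro _ ⟨g, rfl⟩; exact hinv g) o
    (fun x hx => by obtain ⟨g, hg⟩ := htrans x hx; exact ⟨_, ⟨g, rfl⟩, hg⟩) ⟨_, ⟨1, rfl⟩⟩
  obtain ⟨D, hD, hy⟩ := exists_y n o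
  -- the approximations
  have key : ∀ l : ℕ, 1 ≤ l → ∃ S ∈ W, ∀ p K, 0 ≤ K → ∀ s : Finset (Fin n →₀ ℕ), A ⊆ s →
      (∀ g, (F p g).support ⊆ s) →
      (∀ (χ : En n → ℝ) (y : Fin n → En n → ℝ) g, QR l χ C → (∀ c, QR l (y c) (D / l)) →
        |extV μ (χ * ∑ α ∈ s, a p g α • mon y α) - extV μ (χ * ∑ α ∈ A, a p g α • mon y α)| ≤
        K / (l : ℝ) ^ (n + 1)) → |extV μ (pf p) - S p| ≤ C * K / l := by
    intro l hl
    have hl1 : (1 : ℝ) ≤ l := by exact_mod_cast hl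
    obtain ⟨ι, _, s, χ, g, hgT, hcard, hs, hχ, hsupp, hsum⟩ := hloc l hl
    obtain ⟨y, hyQ, hyx⟩ := hy l hl
    choose γ hγ using hgT
    have hyB : ∀ c, QB (y c) := fun c => (hyQ c).toQB hl1
    have hχB : ∀ i, QB (χ i) := fun i => (hχ i).toQB hl1
    have hmem : ∀ i t, (fun a : (Fin n →₀ ℕ) → ℝ => extV μ (χ i * ∑ α ∈ t, a α • mon y α)) ∈
        Submodule.span ℝ (Set.range (lagProd t)) := by
      intro i t
      have := extV_multi hμ (fun α => χ i * mon y α) (fun α => (hχB i).mul (QB.mon hyB α)) t 0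
        (QB.const 0)
      simpa only [mul_sum_mon] using this
    refine ⟨∑ i, s i • fun p => ∫ g, extV μ (χ i * ∑ α ∈ A, a p g α • mon y α) ∂ν, ?_, ?_⟩
    · exact Submodule.sum_mem _ fun i _ => Submodule.smul_mem _ _ (mem_J ν A a hac (hmem i A))
    intro p K hK t hAt hFt hest
    set U : ι → Γ → ℝ := fun i g => extV μ (χ i * ∑ α ∈ t, a p g α • mon y α) with hU
    set V : ι → Γ → ℝ := fun i g => extV μ (χ i * ∑ α ∈ A, a p g α • mon y α) with hV
    have hUc : ∀ i, Continuous (U i) := fun i => continuous_of_span t (hmem i t) (a p) (hac p)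
    have hVc : ∀ i, Continuous (V i) := fun i => continuous_of_span A (hmem i A) (a p) (hac p)
    have int : ∀ {f : Γ → ℝ}, Continuous f → Integrable f ν := fun hf =>
      hf.integrable_of_hasCompactSupport (HasCompactSupport.of_compactSpace _)
    have hUe : ∀ i g, U i g = extV μ (χ i * fun x => pf p (ρ g⁻¹ x)) := by
      intro i g
      apply extV_congr
      intro x hx
      by_cases h0 : χ i x = 0
      · simp [h0]
      · rw [Pi.mul_apply, Pi.mul_apply]
        congr 1
        rw [hF, MvPolynomial.eval_eq', Finset.sum_apply]
        symm
        have : ∀ α, (a p g α • mon y α) x = (F p g).coeff α * ∏ i, (x i - o i) ^ α i := by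
          intro α
          rw [Pi.smul_apply, smul_eq_mul]
          unfold mon
          rw [Finset.prod_apply]
          congr 1
          apply Finset.prod_congr rfl
          intro c _
          rw [Pi.pow_apply, hyx c x (hsupp i x hx h0 c)]
        rw [Finset.sum_congr rfl fun α _ => this α]
        apply Finset.sum_subset (hFt g)
        intro α _ hα
        rw [MvPolynomial.notMem_support_iff.mp hα, zero_mul]
    have hP : ∀ g, extV μ (pf p) = ∑ i, s i * U i ((γ i)⁻¹ * g) := by
      intro h
      have h1 : extV μ (fun x => pf p (ρ h⁻¹ x)) = extV μ (pf p) :=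
        extV_comp hμ (hinv h⁻¹) (QB.pf p).nice
      have h2 : QB (fun x => pf p (ρ h⁻¹ x)) := by
        obtain ⟨c, hc⟩ := QB.pf p
        exact ⟨c, hc.comp _⟩
      rw [← h1, hsum _ h2]
      apply Finset.sum_congr rfl
      intro i _
      rw [hUe]
      congr 3
      funext x
      rw [← hγ i, mul_inv_rev, inv_inv, map_mul]
      rfl
    have hPi : extV μ (pf p) = ∑ i, s i * ∫ g, U i g ∂ν := by
      calc extV μ (pf p) = ∫ g, ∑ i, s i * U i ((γ i)⁻¹ * g) ∂ν := by
            rw [← integral_congr_ae (Filter.Eventually.of_forall hP)]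
            simp
        _ = ∑ i, s i * ∫ g, U i ((γ i)⁻¹ * g) ∂ν := by
            rw [integral_finsetSum]
            · simp only [integral_const_mul]
            · intro i _
              exact (int ((hUc i).comp (continuous_const.mul continuous_id))).const_mul _
        _ = _ := by
            apply Finset.sum_congr rfl
            intro i _
            rw [integral_mul_left_eq_self]
    have hd : ∀ i, |(∫ g, U i g ∂ν) - ∫ g, V i g ∂ν| ≤ K / (l : ℝ) ^ (n + 1) := by
      intro i
      rw [← integral_sub (int (hUc i)) (int (hVc i))]
      have := norm_integral_le_of_norm_le_const (μ := ν) (f := fun g => U i g - V i g)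
        (C := K / (l : ℝ) ^ (n + 1)) (Filter.Eventually.of_forall fun g => hest (χ i) y g (hχ i) hyQ)
      simpa using this
    rw [hPi, Finset.sum_apply, ← Finset.sum_sub_distrib]
    calc |∑ i, (s i * ∫ g, U i g ∂ν - (s i • fun p => ∫ g, extV μ (χ i * ∑ α ∈ A, a p g α • mon y α) ∂ν) p)|
        ≤ ∑ i : ι, K / (l : ℝ) ^ (n + 1) := by
          refine (Finset.abs_sum_le_sum_abs _ _).trans (Finset.sum_le_sum fun i _ => ?_)
          rw [Pi.smul_apply, smul_eq_mul, ← mul_sub, abs_mul]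
          calc _ ≤ 1 * (K / (l : ℝ) ^ (n + 1)) := by
                gcongr
                · exact hs i
                · exact hd i
            _ = _ := one_mul _
      _ = Fintype.card ι * (K / (l : ℝ) ^ (n + 1)) := by simp
      _ ≤ (C * (l : ℝ) ^ n) * (K / (l : ℝ) ^ (n + 1)) := by gcongr
      _ = C * K / l := by field_simp; ring
  choose S hS hSp using fun l : ℕ => key (l + 1) (by omega)
  have hcl : IsClosed (W : Set (MvPolynomial (Fin n) ℝ → ℝ)) := W.closed_of_finiteDimensional
  refine hcl.mem_of_tendsto (f := S) (b := Filter.atTop) ?_ (Filter.Eventually.of_forall hS)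
  rw [tendsto_pi_nhds]
  intro p
  obtain ⟨s, hs⟩ := (hCF p).1
  have hBex : ∃ B : ℝ, 0 ≤ B ∧ ∀ g α, |a p g α| ≤ B := by
    have : ∀ α, ∃ B : ℝ, 0 ≤ B ∧ ∀ g, |a p g α| ≤ B := by
      intro α
      obtain ⟨B, hB⟩ := isCompact_univ.exists_bound_of_continuousOn (f := fun g => a p g α)
        (hac p α).continuousOn
      exact ⟨|B|, abs_nonneg _, fun g => (hB g (mem_univ _)).trans (le_abs_self _)⟩
    choose B hB0 hB using this
    refine ⟨∑ α ∈ s, B α, Finset.sum_nonneg fun α _ => hB0 α, fun g α => ?_⟩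
    by_cases hα : α ∈ s
    · exact (hB α g).trans (Finset.single_le_sum (fun α _ => hB0 α) hα)
    · have : a p g α = 0 := MvPolynomial.notMem_support_iff.mp fun h => hα (hs g h)
      rw [this, abs_zero]
      exact Finset.sum_nonneg fun α _ => hB0 α
  obtain ⟨B, hB0, hB⟩ := hBex
  obtain ⟨K, hK0, l0, _, hK⟩ := loc_est hμ C D B hC hD hB0 A (s ∪ A) Finset.subset_union_right hA
  rw [tendsto_iff_norm_sub_tendsto_zero]
  refine squeeze_zero' (g := fun l : ℕ => C * K / ((l + 1 : ℕ) : ℝ))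
    (Filter.Eventually.of_forall fun _ => norm_nonneg _) ?_ ?_
  · filter_upwards [Filter.eventually_ge_atTop l0] with l hl
    rw [norm_sub_rev]
    exact hSp l p K hK0 (s ∪ A) Finset.subset_union_right
      (fun g => (hs g).trans Finset.subset_union_left)
      fun χ y g h1 h2 => hK (l + 1) (by omega) χ y (a p g) h1 h2 (hB g)
  · have := (tendsto_const_div_atTop_nhds_zero_nat (C * K)).comp (Filter.tendsto_add_atTop_nat 1)
    exact this

/-! ### Polynomials determine the valuation -/

theorem QR.of_c2 {n : ℕ} {a b : ℝ} (hab : a ≤ b) {f f' f'' : ℝ → ℝ} {ε : ℝ} (hε : 0 ≤ ε)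
    (h : ∀ x ∈ Icc a b, HasDerivWithinAt f (f' x) (Icc a b) x)
    (h' : ∀ x ∈ Icc a b, HasDerivWithinAt f' (f'' x) (Icc a b) x)
    (h0 : |f a| ≤ ε) (h1 : |f' a| ≤ ε) (h2 : ∀ x ∈ Icc a b, |f'' x| ≤ ε)
    {q : En n → ℝ} {B : ℝ} (hq : QR 1 q B) (hqS : ∀ u, ‖u‖ = 1 → q u ∈ Icc a b) :
    QR 1 (fun u => f (q u)) (ε * ((1 + (b - a)) ^ 2 * (1 + B + 4 * B ^ 2))) := by
  set L := b - a with hL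
  have hL0 : 0 ≤ L := sub_nonneg.mpr hab
  have hB := hq.1
  have ha : a ∈ Icc a b := ⟨le_rfl, hab⟩
  have hlip : ∀ x ∈ Icc a b, ∀ y ∈ Icc a b, |f' x - f' y| ≤ ε * |x - y| := by
    intro x hx y hy
    exact Convex.norm_image_sub_le_of_norm_hasDerivWithin_le h' h2 (convex_Icc a b) hy hx
  have hxa : ∀ x ∈ Icc a b, |x - a| ≤ L := by
    intro x hx
    rw [abs_of_nonneg (sub_nonneg.mpr hx.1)]
    linarith [hx.2]
  have b1 : ∀ x ∈ Icc a b, |f' x| ≤ ε * (1 + L) := by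
    intro x hx
    have e1 := hlip x hx a ha
    have e2 : ε * |x - a| ≤ ε * L := mul_le_mul_of_nonneg_left (hxa x hx) hε
    have e3 := abs_sub_abs_le_abs_sub (f' x) (f' a)
    linarith
  have b0 : ∀ x ∈ Icc a b, |f x| ≤ ε * (1 + L) ^ 2 := by
    intro x hx
    have e1 : |f x - f a| ≤ ε * (1 + L) * |x - a| :=
      Convex.norm_image_sub_le_of_norm_hasDerivWithin_le h b1 (convex_Icc a b) ha hx
    have e2 : ε * (1 + L) * |x - a| ≤ ε * (1 + L) * L :=
      mul_le_mul_of_nonneg_left (hxa x hx) (by positivity)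
    have e3 := abs_sub_abs_le_abs_sub (f x) (f a)
    nlinarith [mul_nonneg hε hL0]
  have e12 : (1 + L) ≤ (1 + L) ^ 2 := by nlinarith
  have e11 : 1 ≤ (1 + L) ^ 2 := by nlinarith
  refine ⟨by positivity, fun w hw => ⟨?_, ?_⟩⟩
  · refine (b0 _ (hqS w hw)).trans ?_
    have : 1 ≤ 1 + B + 4 * B ^ 2 := by nlinarith
    have h3 : 0 ≤ ε * (1 + L) ^ 2 := by positivity
    nlinarith
  · obtain ⟨_, v, hv, hr⟩ := hq.2 w hw
    refine ⟨f' (q w) • v, ?_, fun u hu => ?_⟩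
    · rw [norm_smul, Real.norm_eq_abs, mul_one]
      rw [mul_one] at hv
      calc |f' (q w)| * ‖v‖ ≤ (ε * (1 + L)) * B := by
            gcongr
            exact b1 _ (hqS w hw)
        _ ≤ (ε * (1 + L) ^ 2) * B := by gcongr
        _ ≤ (ε * (1 + L) ^ 2) * (1 + B + 4 * B ^ 2) := by
            gcongr
            nlinarith
        _ = _ := by ring
    · have t := taylor_two (convex_Icc a b) hε h hlip (hqS w hw) (hqS u hu)
      have r := hr u hu
      have l := hq.lip zero_le_one hu hw
      rw [one_mul] at l
      have l2 : (q u - q w) ^ 2 ≤ 4 * B ^ 2 * ‖u - w‖ ^ 2 := by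
        rw [← sq_abs]
        calc |q u - q w| ^ 2 ≤ (2 * B * ‖u - w‖) ^ 2 := by gcongr
          _ = _ := by ring
      rw [real_inner_smul_left]
      have e : f (q u) - f (q w) - f' (q w) * inner ℝ v (u - w) =
        (f (q u) - f (q w) - f' (q w) * (q u - q w)) +
          f' (q w) * (q u - q w - inner ℝ v (u - w)) := by ring
      rw [e]
      have r' : |f' (q w) * (q u - q w - inner ℝ v (u - w))| ≤ ε * (1 + L) * (B * ‖u - w‖ ^ 2) := by
        rw [abs_mul]
        refine mul_le_mul (b1 _ (hqS w hw)) (r.trans (by rw [one_pow, mul_one])) (abs_nonneg _)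
          (by positivity)
      refine (abs_add_le _ _).trans ((add_le_add t r').trans ?_)
      rw [one_pow, mul_one]
      calc ε * (q u - q w) ^ 2 + ε * (1 + L) * (B * ‖u - w‖ ^ 2)
          ≤ ε * (1 * (4 * B ^ 2 * ‖u - w‖ ^ 2)) + ε * ((1 + L) ^ 2 * (B * ‖u - w‖ ^ 2)) := by
            rw [one_mul, mul_assoc ε]; gcongr
        _ ≤ ε * ((1 + L) ^ 2 * (4 * B ^ 2 * ‖u - w‖ ^ 2)) + ε * ((1 + L) ^ 2 * ((1 + B) * ‖u - w‖ ^ 2)) := by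
            gcongr
            linarith
        _ = _ := by ring

theorem poly_antideriv (P : Polynomial ℝ) : ∃ Q : Polynomial ℝ, Q.derivative = P := by
  induction P using Polynomial.induction_on' with
  | add p q hp hq =>
    obtain ⟨P, rfl⟩ := hp
    obtain ⟨Q, rfl⟩ := hq
    exact ⟨P + Q, Polynomial.derivative_add⟩
  | monomial k c =>
    refine ⟨Polynomial.monomial (k + 1) (c / (k + 1)), ?_⟩
    rw [Polynomial.derivative_monomial]
    congr 1
    push_cast
    field_simp

theorem poly_antideriv2 (P : Polynomial ℝ) (a x y : ℝ) : ∃ Q : Polynomial ℝ,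
    Q.derivative.derivative = P ∧ Q.derivative.eval a = y ∧ Q.eval a = x := by
  obtain ⟨R, hR⟩ := poly_antideriv P
  obtain ⟨Q, hQ⟩ := poly_antideriv (R + Polynomial.C (y - R.eval a))
  refine ⟨Q + Polynomial.C (x - Q.eval a), ?_, ?_, ?_⟩
  · simp [hQ, hR]
  · simp [hQ]
  · simp

theorem pf_aeval {n : ℕ} (q : MvPolynomial (Fin n) ℝ) (Q : Polynomial ℝ) (x : En n) :
    pf (Polynomial.aeval q Q) x = Q.eval (pf q x) := by
  unfold pf
  induction Q using Polynomial.induction_on' with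
  | add p q hp hq => simp [hp, hq]
  | monomial k c => simp [Polynomial.aeval_monomial, MvPolynomial.algebraMap_eq]

/-- vanishing on polynomials implies vanishing on `C²` functions of polynomials -/
theorem extV_c2 {n : ℕ} {μ : ConvexBody (En n) → ℝ} (hμ : IsVal μ) (h0 : ∀ p, extV μ (pf p) = 0)
    {a b : ℝ} (hab : a ≤ b) {f f' f'' : ℝ → ℝ}
    (h : ∀ x ∈ Icc a b, HasDerivWithinAt f (f' x) (Icc a b) x)
    (h' : ∀ x ∈ Icc a b, HasDerivWithinAt f' (f'' x) (Icc a b) x)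
    (h'' : ContinuousOn f'' (Icc a b)) (q : MvPolynomial (Fin n) ℝ)
    (hq : ∀ u : En n, ‖u‖ = 1 → pf q u ∈ Icc a b) : extV μ (fun u => f (pf q u)) = 0 := by
  obtain ⟨B, hB⟩ := QB.pf q
  obtain ⟨M, hM⟩ := isCompact_Icc.exists_bound_of_continuousOn h''
  obtain ⟨A, hA0, hA⟩ := extV_lip hμ
  obtain ⟨C, hC⟩ : ∃ C, QR 1 (fun u => f (pf q u)) C := by
    refine ⟨_, QR.of_c2 hab (ε := |f a| + |f' a| + |M|) (by positivity) h h' ?_ ?_ ?_ hB hq⟩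
    · linarith [abs_nonneg (f' a), abs_nonneg M]
    · linarith [abs_nonneg (f a), abs_nonneg M]
    · intro x hx
      have := hM x hx
      rw [Real.norm_eq_abs] at this
      linarith [abs_nonneg (f a), abs_nonneg (f' a), le_abs_self M]
  set D := (1 + (b - a)) ^ 2 * (1 + B + 4 * B ^ 2) with hD
  have hD1 : 0 < D := by
    have := hB.1
    have : 0 ≤ b - a := sub_nonneg.mpr hab
    positivity
  have key : ∀ ε : ℝ, 0 < ε → ε ≤ 1 → |extV μ (fun u => f (pf q u))| ≤ A * (1 + C) ^ (2 * n) * ε := by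
    intro ε hε hε1
    obtain ⟨P, hP⟩ := exists_polynomial_near_of_continuousOn a b f'' h'' (ε / D) (by positivity)
    obtain ⟨Q, hQ2, hQ1, hQ0⟩ := poly_antideriv2 P a (f a) (f' a)
    have hd : ∀ (R : Polynomial ℝ) x, HasDerivWithinAt (fun t => R.eval t) (R.derivative.eval x) (Icc a b) x :=
      fun R x => (R.hasDerivAt x).hasDerivWithinAt
    have he := QR.of_c2 (n := n) hab (f := fun x => Q.eval x - f x) (f' := fun x => Q.derivative.eval x - f' x)
      (f'' := fun x => P.eval x - f'' x) (ε := ε / D) (by positivity)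
      (fun x hx => (hd Q x).sub (h x hx))
      (fun x hx => by
        have := (hd Q.derivative x).sub (h' x hx)
        rwa [hQ2] at this)
      (by rw [hQ0, sub_self, abs_zero]; positivity) (by rw [hQ1, sub_self, abs_zero]; positivity)
      (fun x hx => (hP x hx).le) hB hq
    rw [← hD, div_mul_cancel₀ _ hD1.ne'] at he
    have := hA _ _ C ε hC he hε hε1
    have e : extV μ ((fun u => f (pf q u)) + fun u => Polynomial.eval (pf q u) Q - f (pf q u)) = 0 := by
      rw [← h0 (Polynomial.aeval q Q)]
      apply extV_congr
      intro u _
      rw [pf_aeval]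
      simp
    rwa [e, zero_sub, abs_neg] at this
  by_contra hne
  have hpos := abs_pos.mpr hne
  have hCC : 0 ≤ A * (1 + C) ^ (2 * n) := by have := hC.1; positivity
  have hd : (0:ℝ) < 2 * (A * (1 + C) ^ (2 * n) + |extV μ (fun u => f (pf q u))|) := by positivity
  have := key (|extV μ (fun u => f (pf q u))| / (2 * (A * (1 + C) ^ (2 * n) + |extV μ (fun u => f (pf q u))|)))
    (by positivity) (by rw [div_le_one hd]; linarith)
  rw [mul_div_assoc', le_div_iff₀ hd] at this
  nlinarith

theorem extV_rpow {n : ℕ} {μ : ConvexBody (En n) → ℝ} (hμ : IsVal μ) (h0 : ∀ p, extV μ (pf p) = 0)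
    {a b : ℝ} (ha : 0 < a) (hab : a ≤ b) (s : ℝ) (q : MvPolynomial (Fin n) ℝ)
    (hq : ∀ u : En n, ‖u‖ = 1 → pf q u ∈ Icc a b) : extV μ (fun u => pf q u ^ s) = 0 := by
  have hne : ∀ x ∈ Icc a b, x ≠ 0 := fun x hx => (ha.trans_le hx.1).ne'
  refine extV_c2 hμ h0 hab (f := fun x => x ^ s) (f' := fun x => s * x ^ (s - 1))
    (f'' := fun x => s * ((s - 1) * x ^ (s - 1 - 1))) ?_ ?_ ?_ q hq
  · intro x hx
    exact (Real.hasDerivAt_rpow_const (Or.inl (hne x hx))).hasDerivWithinAt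
  · intro x hx
    exact ((Real.hasDerivAt_rpow_const (Or.inl (hne x hx))).const_mul s).hasDerivWithinAt
  · intro x hx
    have : ContinuousAt (fun x : ℝ => x ^ (s - 1 - 1)) x :=
      Real.continuousAt_rpow_const _ _ (Or.inl (hne x hx))
    exact ((this.const_mul (s - 1)).const_mul s).continuousWithinAt

/-- the `L^p` smoothing of the support function of a polytope plus a ball -/
def hLp {n : ℕ} (V : Finset (En n)) (c : ℝ) (p : ℕ) (x : En n) : ℝ :=
  (∑ v ∈ V, (inner ℝ v x + c * ‖x‖) ^ (p : ℝ)) ^ (1 / (p : ℝ))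

theorem lin_nonneg {n : ℕ} {V : Finset (En n)} {c : ℝ} (hc : ∀ v ∈ V, ‖v‖ < c) {v : En n} (hv : v ∈ V)
    (x : En n) : (c - ‖v‖) * ‖x‖ ≤ inner ℝ v x + c * ‖x‖ := by
  have := abs_le.mp (abs_real_inner_le_norm v x)
  nlinarith [norm_nonneg x]

theorem lin_nonneg' {n : ℕ} {V : Finset (En n)} {c : ℝ} (hc : ∀ v ∈ V, ‖v‖ < c) {v : En n} (hv : v ∈ V)
    (x : En n) : 0 ≤ inner ℝ v x + c * ‖x‖ :=
  (mul_nonneg (sub_nonneg.mpr (hc v hv).le) (norm_nonneg x)).trans (lin_nonneg hc hv x)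

theorem sublin_hLp {n : ℕ} {V : Finset (En n)} {c : ℝ} (hc : ∀ v ∈ V, ‖v‖ < c) (hc0 : 0 ≤ c) {p : ℕ}
    (hp : 1 ≤ p) : Sublin (hLp V c p) := by
  have hp1 : (1 : ℝ) ≤ p := by exact_mod_cast hp
  constructor
  · intro r hr x
    unfold hLp
    have e : ∑ v ∈ V, (inner ℝ v (r • x) + c * ‖r • x‖) ^ (p : ℝ) =
        r ^ (p : ℝ) * ∑ v ∈ V, (inner ℝ v x + c * ‖x‖) ^ (p : ℝ) := by
      rw [Finset.mul_sum]
      apply Finset.sum_congr rfl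
      intro v hv
      rw [← Real.mul_rpow hr.le (lin_nonneg' hc hv x), real_inner_smul_right, norm_smul,
        Real.norm_of_nonneg hr.le]
      congr 1
      ring
    rw [e, Real.mul_rpow (by positivity), ← Real.rpow_mul hr.le, mul_one_div_cancel (by positivity),
      Real.rpow_one]
    exact Finset.sum_nonneg fun v hv => Real.rpow_nonneg (lin_nonneg' hc hv x) _
  · intro x y
    unfold hLp
    refine le_trans ?_ (Real.Lp_add_le_of_nonneg V hp1 (fun v hv => lin_nonneg' hc hv x)
      (fun v hv => lin_nonneg' hc hv y))
    apply Real.rpow_le_rpow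
    · exact Finset.sum_nonneg fun v hv => Real.rpow_nonneg (lin_nonneg' hc hv _) _
    · apply Finset.sum_le_sum
      intro v hv
      apply Real.rpow_le_rpow (lin_nonneg' hc hv _) _ (by positivity)
      rw [inner_add_right]
      have := mul_le_mul_of_nonneg_left (norm_add_le x y) hc0
      linarith
    · positivity

theorem hLp_bound {n : ℕ} {V : Finset (En n)} {c : ℝ} (hc : ∀ v ∈ V, ‖v‖ < c) {p : ℕ}
    (hp : 1 ≤ p) {x : En n} {M : ℝ} (hM : ∀ v ∈ V, inner ℝ v x + c * ‖x‖ ≤ M) {v0 : En n} (hv0 : v0 ∈ V)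
    (he : inner ℝ v0 x + c * ‖x‖ = M) : M ≤ hLp V c p x ∧ hLp V c p x ≤ (V.card : ℝ) ^ (1 / (p : ℝ)) * M := by
  have hp0 : (p : ℝ) ≠ 0 := by positivity
  have hM0 : 0 ≤ M := by rw [← he]; exact lin_nonneg' hc hv0 x
  have e : (M ^ (p : ℝ)) ^ (1 / (p : ℝ)) = M := by
    rw [← Real.rpow_mul hM0, mul_one_div_cancel hp0, Real.rpow_one]
  unfold hLp
  constructor
  · conv_lhs => rw [← e]
    apply Real.rpow_le_rpow (by positivity) _ (by positivity)
    rw [← he]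
    exact Finset.single_le_sum (f := fun v => (inner ℝ v x + c * ‖x‖) ^ (p : ℝ))
      (fun v hv => Real.rpow_nonneg (lin_nonneg' hc hv _) _) hv0
  · conv_rhs => rw [← e]
    rw [← Real.mul_rpow (by positivity) (by positivity)]
    apply Real.rpow_le_rpow _ _ (by positivity)
    · exact Finset.sum_nonneg fun v hv => Real.rpow_nonneg (lin_nonneg' hc hv _) _
    · calc _ ≤ ∑ v ∈ V, M ^ (p : ℝ) := Finset.sum_le_sum fun v hv =>
            Real.rpow_le_rpow (lin_nonneg' hc hv _) (hM v hv) (by positivity)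
        _ = _ := by simp

/-- the polynomial `x ↦ ⟨v,x⟩ + c` -/
def linP {n : ℕ} (v : En n) (c : ℝ) : MvPolynomial (Fin n) ℝ :=
  ∑ i, MvPolynomial.C (v i) * MvPolynomial.X i + MvPolynomial.C c

theorem pf_linP {n : ℕ} (v : En n) (c : ℝ) (x : En n) : pf (linP v c) x = inner ℝ v x + c := by
  unfold pf linP
  rw [map_add, map_sum, PiLp.inner_apply]
  simp [mul_comm]

theorem extV_hLp {n : ℕ} {μ : ConvexBody (En n) → ℝ} (hμ : IsVal μ) (h0 : ∀ p, extV μ (pf p) = 0)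
    {V : Finset (En n)} (hV : V.Nonempty) {c : ℝ} (hc : ∀ v ∈ V, ‖v‖ < c) (p : ℕ) :
    extV μ (hLp V c p) = 0 := by
  obtain ⟨v0, hv0⟩ := hV
  set q : MvPolynomial (Fin n) ℝ := ∑ v ∈ V, linP v c ^ p with hq
  have hpf : ∀ x : En n, pf q x = ∑ v ∈ V, (inner ℝ v x + c) ^ p := by
    intro x
    have : ∀ v, MvPolynomial.eval (fun i => x i) (linP v c) = inner ℝ v x + c := fun v => pf_linP v c x
    unfold pf
    rw [hq, map_sum]
    simp [this]
  have hc0 : 0 < c := (norm_nonneg v0).trans_lt (hc v0 hv0)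
  have hlo : ∀ v ∈ V, ∀ x : En n, ‖x‖ = 1 → c - ‖v‖ ≤ inner ℝ v x + c := by
    intro v hv x hx
    have := lin_nonneg hc hv x
    rwa [hx, mul_one, mul_one] at this
  have hhi : ∀ v ∈ V, ∀ x : En n, ‖x‖ = 1 → inner ℝ v x + c ≤ 2 * c := by
    intro v hv x hx
    have := real_inner_le_norm v x
    rw [hx, mul_one] at this
    linarith [hc v hv]
  have hb : ∀ u : En n, ‖u‖ = 1 → pf q u ∈ Icc ((c - ‖v0‖) ^ p) (∑ v ∈ V, (2 * c) ^ p) := by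
    intro u hu
    have hnn : ∀ v ∈ V, 0 ≤ inner ℝ v u + c := fun v hv =>
      (sub_nonneg.mpr (hc v hv).le).trans (hlo v hv u hu)
    rw [hpf]
    constructor
    · refine le_trans ?_ (Finset.single_le_sum (f := fun v => (inner ℝ v u + c) ^ p)
        (fun v hv => pow_nonneg (hnn v hv) _) hv0)
      exact pow_le_pow_left₀ (sub_nonneg.mpr (hc v0 hv0).le) (hlo v0 hv0 u hu) _
    · exact Finset.sum_le_sum fun v hv => pow_le_pow_left₀ (hnn v hv) (hhi v hv u hu) _
  have hapos : 0 < (c - ‖v0‖) ^ p := pow_pos (sub_pos.mpr (hc v0 hv0)) _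
  have hab : (c - ‖v0‖) ^ p ≤ ∑ v ∈ V, (2 * c) ^ p := by
    refine le_trans ?_ (Finset.single_le_sum (f := fun _ => (2 * c) ^ p)
        (fun v hv => by positivity) hv0)
    exact pow_le_pow_left₀ (sub_nonneg.mpr (hc v0 hv0).le) (by linarith [norm_nonneg v0]) _
  rw [← extV_rpow hμ h0 hapos hab (1 / (p : ℝ)) q hb]
  apply extV_congr
  intro u hu
  rw [hpf]
  unfold hLp
  simp only [hu, mul_one, Real.rpow_natCast]

theorem val_hull_ball {n : ℕ} {μ : ConvexBody (En n) → ℝ} (hμ : IsVal μ) (h0 : ∀ p, extV μ (pf p) = 0)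
    {V : Finset (En n)} (hV : V.Nonempty) {c : ℝ} (hc : ∀ v ∈ V, ‖v‖ < c) :
    μ (hullB V hV + c • UB n) = 0 := by
  have hc0 : 0 < c := by
    obtain ⟨v0, hv0⟩ := hV
    exact (norm_nonneg v0).trans_lt (hc v0 hv0)
  choose K hK using fun p : ℕ => (sublin_hLp hc hc0.le (p := p + 1) (by omega)).exists_body
  have hμK : ∀ p, μ (K p) = 0 := by
    intro p
    rw [← extV_body hμ, ← extV_hLp hμ h0 hV hc (p + 1)]
    apply extV_congr
    intro u _
    exact hK p u
  have hd : ∀ p, dist (K p) (hullB V hV + c • UB n) ≤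
      ((V.card : ℝ) ^ (1 / ((p + 1 : ℕ) : ℝ)) - 1) * (2 * c) := by
    intro p
    have hcard : 1 ≤ (V.card : ℝ) := by exact_mod_cast hV.card_pos
    have hge : 1 ≤ (V.card : ℝ) ^ (1 / ((p + 1 : ℕ) : ℝ)) := Real.one_le_rpow hcard (by positivity)
    apply dist_le_of_hs
    · have := sub_nonneg.mpr hge
      positivity
    · intro u hu
      rw [hK, hs_add, hs_smul hc0.le, hs_UB, hu, mul_one]
      obtain ⟨v0, hv0, hmax⟩ := V.exists_max_image (fun v => inner ℝ v u) hV
      have hh : hs (hullB V hV) u = inner ℝ v0 u := by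
        apply le_antisymm
        · rw [hs_hull_le (S := (V : Set (En n))) rfl]
          exact hmax
        · exact le_hs _ _ (subset_convexHull ℝ _ hv0)
      obtain ⟨b1, b2⟩ := hLp_bound hc (p := p + 1) (by omega) (x := u) (M := inner ℝ v0 u + c)
        (fun v hv => by rw [hu, mul_one]; linarith [hmax v hv]) hv0 (by rw [hu, mul_one])
      rw [hh, abs_of_nonneg (sub_nonneg.mpr b1)]
      have hM : inner ℝ v0 u + c ≤ 2 * c := by
        have := real_inner_le_norm v0 u
        rw [hu, mul_one] at this
        linarith [hc v0 hv0]
      have := mul_le_mul_of_nonneg_left hM (sub_nonneg.mpr hge)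
      linarith
  have ht : Filter.Tendsto K Filter.atTop (nhds (hullB V hV + c • UB n)) := by
    rw [tendsto_iff_dist_tendsto_zero]
    refine squeeze_zero (fun _ => dist_nonneg) hd ?_
    have h1 : Filter.Tendsto (fun p : ℕ => 1 / ((p + 1 : ℕ) : ℝ)) Filter.atTop (nhds 0) := by
      have := (tendsto_const_div_atTop_nhds_zero_nat (1 : ℝ)).comp (Filter.tendsto_add_atTop_nat 1)
      exact this
    have hcard : (V.card : ℝ) ≠ 0 := by exact_mod_cast hV.card_pos.ne'
    have h2 := (Real.continuousAt_const_rpow (a := (V.card : ℝ)) (b := 0) hcard).tendsto.comp h1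
    have h3 := (h2.sub_const 1).mul_const (2 * c)
    simpa using h3
  have := (hμ.cont.tendsto _).comp ht
  have h2 : (μ ∘ K) = fun _ => 0 := funext hμK
  rw [h2] at this
  exact tendsto_nhds_unique this tendsto_const_nhds

theorem val_zero {n : ℕ} {μ : ConvexBody (En n) → ℝ} (hμ : IsVal μ) (h0 : ∀ p, extV μ (pf p) = 0)
    (K : ConvexBody (En n)) : μ K = 0 := by
  have hh : ∀ (V : Finset (En n)) (hV : V.Nonempty), μ (hullB V hV) = 0 := by
    intro V hV
    obtain ⟨q, _, hq⟩ := hμ.poly (hullB V hV) (UB n)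
    have : q = 0 := by
      apply poly_eq_of_ge (∑ v ∈ V, ‖v‖ + 1)
      intro r hr
      have hs0 : 0 ≤ ∑ v ∈ V, ‖v‖ := Finset.sum_nonneg fun _ _ => norm_nonneg _
      rw [← hq r (by linarith), Polynomial.eval_zero]
      apply val_hull_ball hμ h0 hV
      intro v hv
      have := Finset.single_le_sum (f := fun v : En n => ‖v‖) (fun _ _ => norm_nonneg _) hv
      linarith
    have h1 := hq 0 le_rfl
    rw [this, Polynomial.eval_zero] at h1
    have e : hullB V hV + (0 : ℝ) • UB n = hullB V hV := by
      apply hs_ext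
      intro u
      rw [hs_add, hs_smul le_rfl, zero_mul, add_zero]
    dsimp only at h1
    rwa [e] at h1
  choose s h hs using fun k : ℕ => exists_hull_near K (ε := 1 / ((k : ℝ) + 1)) (by positivity)
  have ht : Filter.Tendsto (fun k => hullB (s k) (h k)) Filter.atTop (nhds K) := by
    rw [tendsto_iff_dist_tendsto_zero]
    exact squeeze_zero (fun _ => dist_nonneg) hs tendsto_one_div_add_atTop_nhds_zero_nat
  have := (hμ.cont.tendsto _).comp ht
  have h2 : (μ ∘ fun k => hullB (s k) (h k)) = fun _ => 0 := funext fun k => hh _ _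
  rw [h2] at this
  exact tendsto_nhds_unique this tendsto_const_nhds

/-! ### The group action and finite dimensionality -/

theorem matAct_apply {n : ℕ} (g : Matrix.unitaryGroup (Fin n) ℝ) (x : En n) :
    matAct g x = WithLp.toLp 2 ((g : Matrix (Fin n) (Fin n) ℝ).mulVec x.ofLp) := rfl

theorem matAct_mul {n : ℕ} (g h : Matrix.unitaryGroup (Fin n) ℝ) (x : En n) :
    matAct (g * h) x = matAct g (matAct h x) := by
  rw [matAct_apply, matAct_apply, matAct_apply, Matrix.mulVec_mulVec]
  rfl

theorem matAct_one {n : ℕ} (x : En n) : matAct (1 : Matrix.unitaryGroup (Fin n) ℝ) x = x := by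
  rw [matAct_apply]
  simp

theorem inner_matAct {n : ℕ} (g : Matrix.unitaryGroup (Fin n) ℝ) (x y : En n) :
    inner ℝ (matAct g x) y = inner ℝ x (matAct g⁻¹ y) := by
  have : matAct g⁻¹ = LinearMap.adjoint (matAct g) :=
    Matrix.toEuclideanLin_conjTranspose_eq_adjoint _
  rw [this, LinearMap.adjoint_inner_right]

/-- orthogonal matrices as isometries -/
def rhoO (n : ℕ) : Matrix.unitaryGroup (Fin n) ℝ →* (En n ≃ₗᵢ[ℝ] En n) where
  toFun g :=
    { toFun := matAct g
      map_add' := map_add _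
      map_smul' := map_smul _
      invFun := matAct g⁻¹
      left_inv := fun x => by rw [← matAct_mul, inv_mul_cancel, matAct_one]
      right_inv := fun x => by rw [← matAct_mul, mul_inv_cancel, matAct_one]
      norm_map' := fun x => by
        have h : ‖matAct g x‖ ^ 2 = ‖x‖ ^ 2 := by
          rw [← real_inner_self_eq_norm_sq, inner_matAct, ← matAct_mul, inv_mul_cancel, matAct_one,
            real_inner_self_eq_norm_sq]
        exact (sq_eq_sq₀ (norm_nonneg _) (norm_nonneg _)).mp h }
  map_one' := by
    ext1 x
    exact matAct_one x
  map_mul' g h := by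
    ext1 x
    exact matAct_mul g h x

theorem rhoO_apply {n : ℕ} (g : Matrix.unitaryGroup (Fin n) ℝ) (x : En n) : rhoO n g x = matAct g x := rfl

theorem continuous_matAct {n : ℕ} (x : En n) :
    Continuous fun g : Matrix.unitaryGroup (Fin n) ℝ => matAct g x := by
  simp only [matAct_apply]
  refine (PiLp.continuous_toLp 2 _).comp ?_
  exact Continuous.matrix_mulVec continuous_subtype_val continuous_const

theorem coe_add_ptB {n : ℕ} (K : ConvexBody (En n)) (x : En n) :
    ((K + ptB x : ConvexBody (En n)) : Set (En n)) = x +ᵥ (K : Set (En n)) := by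
  rw [ConvexBody.coe_add, coe_ptB, add_comm, Set.singleton_add]
  rfl

theorem invUnder_of {n : ℕ} {μ : ConvexBody (En n) → ℝ} {g : Matrix.unitaryGroup (Fin n) ℝ}
    (h : ∀ K L : ConvexBody (En n), (L : Set (En n)) = (matAct g⁻¹) '' (K : Set (En n)) → μ L = μ K) :
    InvUnder μ (rhoO n g) := by
  intro K L hKL
  apply h
  have hsi : ∀ x u, inner ℝ (matAct g⁻¹ x) u = inner ℝ x (matAct g u) := by
    intro x u; rw [inner_matAct, inv_inv]
  ext y
  rw [mem_body_iff]
  constructor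
  · intro hy
    refine ⟨matAct g y, ?_, by rw [← matAct_mul, inv_mul_cancel, matAct_one]⟩
    rw [mem_body_iff]
    intro u
    have := hy (matAct g⁻¹ u)
    rw [hKL, rhoO_apply, ← matAct_mul, mul_inv_cancel, matAct_one] at this
    rwa [inner_matAct]
  · rintro ⟨x, hx, rfl⟩ u
    rw [hsi, hKL, rhoO_apply]
    exact le_hs K _ hx

/-- the real invariant valuations -/
def ValR {n : ℕ} {Γ : Type*} [Group Γ] (ρ : Γ →* (En n ≃ₗᵢ[ℝ] En n)) :
    Submodule ℝ (ConvexBody (En n) → ℝ) where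
  carrier := {μ | IsVal μ ∧ ∀ g, InvUnder μ (ρ g)}
  zero_mem' := ⟨⟨fun _ _ _ _ _ _ => by simp, continuous_const, fun _ _ => rfl⟩, fun _ _ _ _ => rfl⟩
  add_mem' := by
    rintro μ ν ⟨h1, h2⟩ ⟨k1, k2⟩
    refine ⟨⟨fun K L M N a b => ?_, h1.cont.add k1.cont, fun x K => ?_⟩, fun g K L h => ?_⟩
    · have := h1.val K L M N a b
      have := k1.val K L M N a b
      simp only [Pi.add_apply]
      linarith
    · simp only [Pi.add_apply]; rw [h1.trans, k1.trans]
    · simp only [Pi.add_apply]; rw [h2 g K L h, k2 g K L h]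
  smul_mem' := by
    rintro c μ ⟨h1, h2⟩
    refine ⟨⟨fun K L M N a b => ?_, h1.cont.const_smul c, fun x K => ?_⟩, fun g K L h => ?_⟩
    · simp only [Pi.smul_apply]; rw [← smul_add, h1.val K L M N a b, smul_add]
    · simp only [Pi.smul_apply]; rw [h1.trans]
    · simp only [Pi.smul_apply]; rw [h2 g K L h]

theorem valR_finite {n : ℕ} {Γ : Type*} [Group Γ] [TopologicalSpace Γ] [IsTopologicalGroup Γ]
    [CompactSpace Γ] [MeasurableSpace Γ] [BorelSpace Γ] (ν : Measure Γ) [IsProbabilityMeasure ν]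
    [ν.IsMulLeftInvariant]
    (ρ : Γ →* (En n ≃ₗᵢ[ℝ] En n)) (hρ : ∀ x, Continuous fun g => ρ g x) (o : En n)
    (htrans : ∀ x, ‖x‖ = 1 → ∃ g, ρ g o = x) : FiniteDimensional ℝ (ValR ρ) := by
  obtain ⟨W, hW, h⟩ := span_main ν ρ hρ o htrans
  have hlin : ∀ (a b : ℝ) (μ ν : ValR ρ) p, extV (a • μ + b • ν : ValR ρ).1 (pf p) =
      a * extV μ.1 (pf p) + b * extV ν.1 (pf p) := by
    intro a b μ ν p
    exact extV_linear μ.2.1 ν.2.1 a b (a • μ + b • ν : ValR ρ).2.1 (QB.pf p).nice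
  let Φ : ValR ρ →ₗ[ℝ] W :=
    { toFun := fun μ => ⟨fun p => extV μ.1 (pf p), h μ.1 μ.2.1 μ.2.2⟩
      map_add' := fun μ ν => by
        ext p
        have := hlin 1 1 μ ν p
        rw [one_smul, one_smul, one_mul, one_mul] at this
        exact this
      map_smul' := fun c μ => by
        ext p
        have := hlin c 0 μ μ p
        rw [zero_smul, add_zero, zero_mul, add_zero] at this
        exact this }
  apply FiniteDimensional.of_injective Φ
  rw [injective_iff_map_eq_zero]
  intro μ hμ
  have h0 : ∀ p, extV μ.1 (pf p) = 0 := fun p => congrFun (congrArg Subtype.val hμ) p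
  apply Subtype.ext
  funext K
  exact val_zero μ.2.1 h0 K

theorem re_im_mem {n : ℕ} {G : Subgroup (Matrix.unitaryGroup (Fin n) ℝ)} {μ : ConvexBody (En n) → ℂ}
    (h : MemValG G μ) (T : ℂ →ₗ[ℝ] ℝ) (hT : Continuous T) :
    (fun K => T (μ K)) ∈ ValR ((rhoO n).comp G.subtype) := by
  obtain ⟨h1, h2, h3, h4⟩ := h
  refine ⟨⟨fun K L M N a b => ?_, hT.comp h2, fun x K => ?_⟩, fun g => ?_⟩
  · rw [← map_add, h1 K L M N a b, map_add]
  · rw [h3 x K _ (coe_add_ptB K x)]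
  · apply invUnder_of
    intro K L hKL
    rw [h4 _ (G.inv_mem g.2) K L hKL]

theorem dir_fin (n : ℕ) (hn : 2 ≤ n) (G : Subgroup (Matrix.unitaryGroup (Fin n) ℝ))
    (hGcompact : IsCompact (G : Set (Matrix.unitaryGroup (Fin n) ℝ)))
    (htr : ∀ x y : En n, ‖x‖ = 1 → ‖y‖ = 1 → ∃ g ∈ G, matAct g x = y) :
    ∃ (d : ℕ) (φ : Fin d → (ConvexBody (En n) → ℂ)), ∀ μ, MemValG G μ →
      ∃ c : Fin d → ℂ, ∀ K, μ K = ∑ i, c i * φ i K := by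
  have : CompactSpace G := isCompact_iff_compactSpace.mp hGcompact
  let _ : MeasurableSpace G := borel G
  have : BorelSpace G := ⟨rfl⟩
  let ν : Measure G := Measure.haarMeasure ⊤
  have : IsProbabilityMeasure ν := ⟨Measure.haarMeasure_self⟩
  set ρ : G →* (En n ≃ₗᵢ[ℝ] En n) := (rhoO n).comp G.subtype with hρ
  have hfin : FiniteDimensional ℝ (ValR ρ) := by
    refine valR_finite ν ρ (fun x => (continuous_matAct x).comp continuous_subtype_val)
      (EuclideanSpace.single ⟨0, by omega⟩ 1) fun x hx => ?_
    obtain ⟨g, hg, h⟩ := htr (EuclideanSpace.single ⟨0, by omega⟩ 1) x (by simp) hx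
    exact ⟨⟨g, hg⟩, h⟩
  let b := Module.finBasis ℝ (ValR ρ)
  refine ⟨_, fun i K => (((b i).1 K : ℝ) : ℂ), fun μ hμ => ?_⟩
  set r : ValR ρ := ⟨_, re_im_mem hμ Complex.reLm Complex.continuous_re⟩ with hr
  set s : ValR ρ := ⟨_, re_im_mem hμ Complex.imLm Complex.continuous_im⟩ with hs
  refine ⟨fun i => (b.repr r i : ℂ) + (b.repr s i : ℂ) * Complex.I, fun K => ?_⟩
  have e : ∀ t : ValR ρ, t.1 K = ∑ i, b.repr t i * (b i).1 K := by
    intro t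
    conv_lhs => rw [← b.sum_repr t]
    rw [AddSubmonoidClass.coe_finset_sum, Finset.sum_apply]
    rfl
  have e1 := e r
  have e2 := e s
  have e1' : (μ K).re = ∑ i, b.repr r i * (b i).1 K := e1
  have e2' : (μ K).im = ∑ i, b.repr s i * (b i).1 K := e2
  rw [← Complex.re_add_im (μ K), e1', e2']
  push_cast
  rw [Finset.sum_mul, ← Finset.sum_add_distrib]
  apply Finset.sum_congr rfl
  intro i _
  ring

/-! ### Non-transitive groups -/

/-- averaged width -/
def avgW {n : ℕ} {Γ : Type*} [Group Γ] [MeasurableSpace Γ] (ν : Measure Γ)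
    (ρ : Γ →* (En n ≃ₗᵢ[ℝ] En n)) (x : En n) (K : ConvexBody (En n)) : ℝ :=
  ∫ g, (hs K (ρ g x) + hs K (-ρ g x)) ∂ν

theorem avgW_integrable {n : ℕ} {Γ : Type*} [Group Γ] [TopologicalSpace Γ]
    [CompactSpace Γ] [MeasurableSpace Γ] [BorelSpace Γ] (ν : Measure Γ) [IsProbabilityMeasure ν]
    (ρ : Γ →* (En n ≃ₗᵢ[ℝ] En n)) (hρ : ∀ x, Continuous fun g => ρ g x) (x : En n) (K : ConvexBody (En n)) :
    Integrable (fun g => hs K (ρ g x) + hs K (-ρ g x)) ν := by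
  have : Continuous fun g => hs K (ρ g x) + hs K (-ρ g x) :=
    ((continuous_hs K).comp (hρ x)).add ((continuous_hs K).comp (hρ x).neg)
  exact this.integrable_of_hasCompactSupport (HasCompactSupport.of_compactSpace _)

theorem avgW_val {n : ℕ} {Γ : Type*} [Group Γ] [TopologicalSpace Γ]
    [CompactSpace Γ] [MeasurableSpace Γ] [BorelSpace Γ] (ν : Measure Γ) [IsProbabilityMeasure ν]
    (ρ : Γ →* (En n ≃ₗᵢ[ℝ] En n)) (hρ : ∀ x, Continuous fun g => ρ g x) (x : En n) :
    IsVal (avgW ν ρ x) := by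
  have hi := avgW_integrable ν ρ hρ x
  refine ⟨fun K L M N hM hN => ?_, ?_, fun t K => ?_⟩
  · unfold avgW
    rw [← integral_add (hi M) (hi N), ← integral_add (hi K) (hi L)]
    congr 1
    funext g
    rw [hs_union hM, hs_union hM, hs_inter hM hN, hs_inter hM hN]
    have h1 := max_add_min (hs K (ρ g x)) (hs L (ρ g x))
    have h2 := max_add_min (hs K (-ρ g x)) (hs L (-ρ g x))
    linarith
  · apply LipschitzWith.continuous (K := (⟨2 * ‖x‖, by positivity⟩ : NNReal))
    apply LipschitzWith.of_dist_le_mul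
    intro K L
    rw [Real.dist_eq]
    unfold avgW
    rw [← integral_sub (hi K) (hi L)]
    have := norm_integral_le_of_norm_le_const (μ := ν)
      (f := fun g => hs K (ρ g x) + hs K (-ρ g x) - (hs L (ρ g x) + hs L (-ρ g x)))
      (C := 2 * ‖x‖ * dist K L) (Filter.Eventually.of_forall fun g => by
        rw [Real.norm_eq_abs]
        have h1 := abs_hs_sub_le K L (ρ g x)
        have h2 := abs_hs_sub_le K L (-ρ g x)
        rw [norm_neg] at h2
        rw [LinearIsometryEquiv.norm_map] at h1 h2
        have e : hs K (ρ g x) + hs K (-ρ g x) - (hs L (ρ g x) + hs L (-ρ g x)) =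
          (hs K (ρ g x) - hs L (ρ g x)) + (hs K (-ρ g x) - hs L (-ρ g x)) := by ring
        rw [e]
        refine (abs_add_le _ _).trans ?_
        linarith)
    rw [probReal_univ, mul_one] at this
    exact this
  · unfold avgW
    congr 1
    funext g
    rw [hs_add, hs_add, hs_ptB, hs_ptB, inner_neg_right]
    ring

theorem avgW_inv {n : ℕ} {Γ : Type*} [Group Γ] [TopologicalSpace Γ] [IsTopologicalGroup Γ]
    [MeasurableSpace Γ] [BorelSpace Γ] (ν : Measure Γ)
    [ν.IsMulLeftInvariant] (ρ : Γ →* (En n ≃ₗᵢ[ℝ] En n)) (x : En n) (g : Γ) (K L : ConvexBody (En n))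
    (h : ∀ u, hs L u = hs K (ρ g u)) : avgW ν ρ x L = avgW ν ρ x K := by
  unfold avgW
  rw [← integral_mul_left_eq_self (μ := ν) (fun γ => hs K (ρ γ x) + hs K (-ρ γ x)) g]
  congr 1
  funext γ
  rw [h, h, map_neg, map_mul]
  rfl

/-- the test bodies -/
def testB {n : ℕ} {Γ : Type*} [Group Γ] (ρ : Γ →* (En n ≃ₗᵢ[ℝ] En n)) (x : En n) (c : ℝ) (hc : 0 ≤ c) :
    ConvexBody (En n) where
  carrier := closedBall 0 1 ∩ ⋂ g : Γ, {y | |inner ℝ y (ρ g x)| ≤ c}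
  convex' := by
    refine (convex_closedBall 0 1).inter (convex_iInter fun g => ?_)
    intro y hy z hz a b ha hb hab
    simp only [mem_setOf_eq] at *
    rw [inner_add_left, real_inner_smul_left, real_inner_smul_left]
    calc |a * inner ℝ y (ρ g x) + b * inner ℝ z (ρ g x)|
        ≤ a * |inner ℝ y (ρ g x)| + b * |inner ℝ z (ρ g x)| := by
          refine (abs_add_le _ _).trans (le_of_eq ?_)
          rw [abs_mul, abs_mul, abs_of_nonneg ha, abs_of_nonneg hb]
      _ ≤ a * c + b * c := by gcongr
      _ = c := by rw [← add_mul, hab, one_mul]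
  isCompact' := by
    refine (isCompact_closedBall 0 1).inter_right (isClosed_iInter fun g => ?_)
    exact isClosed_le (by fun_prop) continuous_const
  nonempty' := ⟨0, by simp, by simp [hc]⟩

theorem mem_testB {n : ℕ} {Γ : Type*} [Group Γ] (ρ : Γ →* (En n ≃ₗᵢ[ℝ] En n)) (x : En n) (c : ℝ) (hc : 0 ≤ c)
    (y : En n) : y ∈ (testB ρ x c hc : Set (En n)) ↔ ‖y‖ ≤ 1 ∧ ∀ g, |inner ℝ y (ρ g x)| ≤ c := by
  show y ∈ closedBall 0 1 ∩ ⋂ g : Γ, {y | |inner ℝ y (ρ g x)| ≤ c} ↔ _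
  simp

theorem hs_testB_le {n : ℕ} {Γ : Type*} [Group Γ] (ρ : Γ →* (En n ≃ₗᵢ[ℝ] En n)) (x : En n) (c : ℝ) (hc : 0 ≤ c)
    (g : Γ) : hs (testB ρ x c hc) (ρ g x) ≤ c ∧ hs (testB ρ x c hc) (-ρ g x) ≤ c := by
  constructor
  · rw [hs_le_iff]
    intro y hy
    exact (abs_le.mp (((mem_testB ρ x c hc y).mp hy).2 g)).2
  · rw [hs_le_iff]
    intro y hy
    rw [inner_neg_right]
    linarith [(abs_le.mp (((mem_testB ρ x c hc y).mp hy).2 g)).1]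

theorem hs_testB_eq {n : ℕ} {Γ : Type*} [Group Γ] (ρ : Γ →* (En n ≃ₗᵢ[ℝ] En n)) (x : En n) (c : ℝ) (hc : 0 ≤ c)
    (y : En n) (hy : ‖y‖ = 1) (h : ∀ g, |inner ℝ y (ρ g x)| ≤ c) :
    hs (testB ρ x c hc) y = 1 ∧ hs (testB ρ x c hc) (-y) = 1 := by
  have key : ∀ y : En n, ‖y‖ = 1 → (∀ g, |inner ℝ y (ρ g x)| ≤ c) → hs (testB ρ x c hc) y = 1 := by
    intro y hy h
    apply hs_eq_of
    · intro z hz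
      have h1 := ((mem_testB ρ x c hc z).mp hz).1
      have := real_inner_le_norm z y
      rw [hy, mul_one] at this
      linarith
    · refine ⟨y, (mem_testB ρ x c hc y).mpr ⟨hy.le, h⟩, ?_⟩
      rw [real_inner_self_eq_norm_sq, hy, one_pow]
  exact ⟨key y hy h, key (-y) (by rw [norm_neg, hy]) fun g => by rw [inner_neg_left, abs_neg]; exact h g⟩

/-- infinitely many separated orbits -/
theorem exists_orbits {n : ℕ} (hn : 2 ≤ n) {Γ : Type*} [Group Γ] [TopologicalSpace Γ]
    [CompactSpace Γ] (ρ : Γ →* (En n ≃ₗᵢ[ℝ] En n)) (hρ : ∀ x, Continuous fun g => ρ g x)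
    {x0 y0 : En n} (hx0 : ‖x0‖ = 1) (hy0 : ‖y0‖ = 1) (h : ∀ g, ρ g x0 ≠ y0) :
    ∃ x : ℕ → En n, (∀ i, ‖x i‖ = 1) ∧ ∀ i j, i ≠ j → ∀ g, ρ g (x j) ≠ x i ∧ ρ g (x j) ≠ -x i := by
  classical
  set O : Set (En n) := Set.range fun g => ρ g x0 with hO
  have hOc : IsClosed O := (isCompact_range (hρ x0)).isClosed
  have hOn : O.Nonempty := ⟨_, 1, rfl⟩
  set F : En n → ℝ := fun y => infDist y O with hF
  have hFc : Continuous F := continuous_infDist_pt O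
  have hinv : ∀ g y, F (ρ g y) = F y := by
    intro g y
    have : ρ g '' O = O := by
      ext z
      constructor
      · rintro ⟨_, ⟨γ, rfl⟩, rfl⟩
        exact ⟨g * γ, by dsimp only; rw [map_mul]; rfl⟩
      · rintro ⟨γ, rfl⟩
        refine ⟨ρ (g⁻¹ * γ) x0, ⟨_, rfl⟩, ?_⟩
        have : ρ γ = ρ g * ρ (g⁻¹ * γ) := by rw [← map_mul, mul_inv_cancel_left]
        exact (congrArg (fun f : En n ≃ₗᵢ[ℝ] En n => f x0) this).symm
    have h2 := infDist_image (ρ g).isometry (t := O) (x := y)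
    rwa [this] at h2
  have hFx : F x0 = 0 := (hOc.mem_iff_infDist_zero hOn).mp ⟨1, by simp⟩
  have hFy : 0 < F y0 := by
    refine lt_of_le_of_ne infDist_nonneg fun h0 => ?_
    obtain ⟨g, hg⟩ := (hOc.mem_iff_infDist_zero hOn).mpr h0.symm
    exact h g hg
  have hconn : IsPreconnected (sphere (0 : En n) 1) := by
    apply isPreconnected_sphere
    rw [← Module.finrank_eq_rank, finrank_euclideanSpace_fin]
    exact_mod_cast hn
  have hiv : Icc 0 (F y0) ⊆ F '' sphere (0 : En n) 1 := by
    have := hconn.intermediate_value (a := x0) (b := y0) (by simpa using hx0) (by simpa using hy0)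
      hFc.continuousOn
    rwa [hFx] at this
  obtain ⟨x, hx1, hx2⟩ := exists_seq_of_forall_finset_exists (fun x : En n => ‖x‖ = 1)
    (fun x y => F x ≠ F y ∧ F (-x) ≠ F y) (by
      intro s _
      obtain ⟨t, ht, hts⟩ := (Set.Icc_infinite hFy).exists_notMem_finset
        (s.image F ∪ s.image fun x => F (-x))
      obtain ⟨y, hy, rfl⟩ := hiv ht
      refine ⟨y, by simpa using hy, fun x hx => ⟨fun e => hts ?_, fun e => hts ?_⟩⟩
      · rw [← e]
        exact Finset.mem_union_left _ (Finset.mem_image_of_mem _ hx)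
      · rw [← e]
        exact Finset.mem_union_right _ (Finset.mem_image_of_mem (fun x => F (-x)) hx))
  refine ⟨x, hx1, ?_⟩
  have key : ∀ i j, j < i → ∀ g, ρ g (x j) ≠ x i ∧ ρ g (x j) ≠ -x i := by
    intro i j hij g
    obtain ⟨h1, h2⟩ := hx2 j i hij
    refine ⟨fun e => h1 ?_, fun e => h2 ?_⟩
    · rw [← e, hinv]
    · have : ρ g (-x j) = x i := by rw [map_neg, e, neg_neg]
      rw [← this, hinv]
  intro i j hij g
  rcases lt_or_gt_of_ne hij with hlt | hlt
  · have hi : ∀ y, ρ g⁻¹ (ρ g y) = y := by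
      intro y
      have : ρ g⁻¹ * ρ g = 1 := by rw [← map_mul, inv_mul_cancel, map_one]
      exact congrArg (fun f : En n ≃ₗᵢ[ℝ] En n => f y) this
    obtain ⟨h1, h2⟩ := key j i hlt g⁻¹
    refine ⟨fun e => h1 ?_, fun e => h2 ?_⟩
    · rw [← e, hi]
    · have : x i = -ρ g (x j) := by rw [e, neg_neg]
      rw [this, map_neg, hi]
  · exact key i j hlt g

theorem inner_lt_one {n : ℕ} {x y : En n} (hx : ‖x‖ = 1) (hy : ‖y‖ = 1) (h1 : x ≠ y) (h2 : x ≠ -y) :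
    |inner ℝ x y| < 1 := by
  have := abs_real_inner_le_norm x y
  rw [hx, hy, one_mul] at this
  refine lt_of_le_of_ne this fun e => ?_
  rcases (abs_eq zero_le_one).mp e with e | e
  · exact h1 ((inner_eq_one_iff_of_norm_eq_one hx hy).mp e)
  · apply h2
    apply (inner_eq_one_iff_of_norm_eq_one (𝕜 := ℝ) hx (by rw [norm_neg, hy])).mp
    rw [inner_neg_right, e, neg_neg]

/-- diagonal systems of averaged widths -/
theorem exists_diag {n : ℕ} (hn : 2 ≤ n) {Γ : Type*} [Group Γ] [TopologicalSpace Γ] [IsTopologicalGroup Γ]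
    [CompactSpace Γ] [MeasurableSpace Γ] [BorelSpace Γ] (ν : Measure Γ) [IsProbabilityMeasure ν]
    (ρ : Γ →* (En n ≃ₗᵢ[ℝ] En n)) (hρ : ∀ x, Continuous fun g => ρ g x)
    {x0 y0 : En n} (hx0 : ‖x0‖ = 1) (hy0 : ‖y0‖ = 1) (h : ∀ g, ρ g x0 ≠ y0) (m : ℕ) :
    ∃ (x : Fin m → En n) (K : Fin m → ConvexBody (En n)),
      (∀ i, avgW ν ρ (x i) (K i) < avgW ν ρ (x i) (UB n)) ∧
      ∀ i j, i ≠ j → avgW ν ρ (x j) (K i) = avgW ν ρ (x j) (UB n) := by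
  obtain ⟨x, hx1, hx2⟩ := exists_orbits hn ρ hρ hx0 hy0 h
  have ex : ∀ i : Fin m, ∃ c : ℝ, 0 ≤ c ∧ c < 1 ∧ ∀ j : Fin m, j ≠ i → ∀ g, |inner ℝ (ρ g (x j)) (x i)| ≤ c := by
    intro i
    have : ∀ j : Fin m, ∃ c : ℝ, 0 ≤ c ∧ c < 1 ∧ (j ≠ i → ∀ g, |inner ℝ (ρ g (x j)) (x i)| ≤ c) := by
      intro j
      by_cases hji : j = i
      · exact ⟨0, le_rfl, zero_lt_one, fun h => absurd hji h⟩
      · have hc : Continuous fun g => |inner ℝ (ρ g (x j)) (x i)| :=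
          ((hρ (x j)).inner continuous_const).abs
        obtain ⟨g0, _, hg0⟩ := isCompact_univ.exists_isMaxOn ⟨1, mem_univ _⟩ hc.continuousOn
        refine ⟨_, abs_nonneg _, ?_, fun _ g => hg0 (mem_univ g)⟩
        have hne : (i : ℕ) ≠ j := fun e => hji (Fin.ext e.symm)
        exact inner_lt_one (by rw [LinearIsometryEquiv.norm_map, hx1]) (hx1 i) (hx2 i j hne g0).1
          (hx2 i j hne g0).2
    choose c h0 h1 h2 using this
    have : Nonempty (Fin m) := ⟨i⟩
    obtain ⟨j0, hj0⟩ := Finite.exists_max c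
    exact ⟨c j0, h0 _, h1 _, fun j hj g => (h2 j hj g).trans (hj0 j)⟩
  choose c hc0 hc1 hc using ex
  have hU : ∀ y : En n, ‖y‖ = 1 → avgW ν ρ y (UB n) = 2 := by
    intro y hy
    unfold avgW
    simp only [hs_UB, norm_neg, LinearIsometryEquiv.norm_map, hy]
    simp
    norm_num
  refine ⟨fun i => x i, fun i => testB ρ (x i) (c i) (hc0 i), fun i => ?_, fun i j hij => ?_⟩
  · rw [hU _ (hx1 i)]
    calc avgW ν ρ (x i) (testB ρ (x i) (c i) (hc0 i)) ≤ ∫ _, 2 * c i ∂ν := by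
          apply integral_mono (avgW_integrable ν ρ hρ _ _) (integrable_const _)
          intro g
          have := hs_testB_le ρ (x i) (c i) (hc0 i) g
          dsimp only
          linarith [this.1, this.2]
      _ = 2 * c i := by simp
      _ < 2 := by linarith [hc1 i]
  · rw [hU _ (hx1 j)]
    have : ∀ g, hs (testB ρ (x i) (c i) (hc0 i)) (ρ g (x j)) + hs (testB ρ (x i) (c i) (hc0 i)) (-ρ g (x j)) = 2 := by
      intro g
      obtain ⟨h1, h2⟩ := hs_testB_eq ρ (x i) (c i) (hc0 i) (ρ g (x j))
        (by rw [LinearIsometryEquiv.norm_map, hx1]) (fun γ => by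
          have h3 := hc i j (Ne.symm hij) (γ⁻¹ * g)
          have h4 : ρ g (x j) = ρ γ (ρ (γ⁻¹ * g) (x j)) := by
            have : ρ g = ρ γ * ρ (γ⁻¹ * g) := by rw [← map_mul, mul_inv_cancel_left]
            exact congrArg (fun f : En n ≃ₗᵢ[ℝ] En n => f (x j)) this
          rw [h4, LinearIsometryEquiv.inner_map_map]
          exact h3)
      rw [h1, h2]; norm_num
    unfold avgW
    simp only [this]
    simp

theorem avgW_memValG {n : ℕ} {G : Subgroup (Matrix.unitaryGroup (Fin n) ℝ)} [CompactSpace G]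
    [MeasurableSpace G] [BorelSpace G] (ν : Measure G) [IsProbabilityMeasure ν] [ν.IsMulLeftInvariant]
    (x : En n) : MemValG G fun K => ((avgW ν ((rhoO n).comp G.subtype) x K : ℝ) : ℂ) := by
  have hv := avgW_val ν ((rhoO n).comp G.subtype)
    (fun x => (continuous_matAct x).comp continuous_subtype_val) x
  refine ⟨fun K L M N hM hN => ?_, Complex.continuous_ofReal.comp hv.cont, fun t K L hL => ?_,
    fun g hg K L hL => ?_⟩
  · dsimp only
    exact_mod_cast hv.val K L M N hM hN
  · have : L = K + ptB t := by
      apply ConvexBody.ext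
      rw [hL, coe_add_ptB]
    dsimp only
    rw [this, hv.trans]
  · dsimp only
    congr 1
    apply avgW_inv ν _ x (⟨g, hg⟩⁻¹ : G)
    intro u
    show hs L u = hs K (matAct g⁻¹ u)
    apply hs_eq_of
    · intro y hy
      rw [hL] at hy
      obtain ⟨z, hz, rfl⟩ := hy
      rw [inner_matAct]
      exact le_hs K _ hz
    · obtain ⟨z, hz, e⟩ := hs_exists K (matAct g⁻¹ u)
      refine ⟨matAct g z, ?_, by rw [inner_matAct, e]⟩
      rw [hL]
      exact ⟨z, hz, rfl⟩

theorem dir_trans (n : ℕ) (hn : 2 ≤ n) (G : Subgroup (Matrix.unitaryGroup (Fin n) ℝ))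
    (hGcompact : IsCompact (G : Set (Matrix.unitaryGroup (Fin n) ℝ)))
    (hfin : ∃ (d : ℕ) (φ : Fin d → (ConvexBody (En n) → ℂ)), ∀ μ, MemValG G μ →
      ∃ c : Fin d → ℂ, ∀ K, μ K = ∑ i, c i * φ i K) (x0 y0 : En n) (hx0 : ‖x0‖ = 1) (hy0 : ‖y0‖ = 1) :
    ∃ g ∈ G, matAct g x0 = y0 := by
  by_contra hcon
  push Not at hcon
  have : CompactSpace G := isCompact_iff_compactSpace.mp hGcompact
  let _ : MeasurableSpace G := borel G
  have : BorelSpace G := ⟨rfl⟩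
  let ν : Measure G := Measure.haarMeasure ⊤
  have : IsProbabilityMeasure ν := ⟨Measure.haarMeasure_self⟩
  obtain ⟨d, φ, hφ⟩ := hfin
  set ρ : G →* (En n ≃ₗᵢ[ℝ] En n) := (rhoO n).comp G.subtype with hρ
  obtain ⟨x, K, h1, h2⟩ := exists_diag hn ν ρ (fun x => (continuous_matAct x).comp continuous_subtype_val)
    hx0 hy0 (fun g => hcon g.1 g.2) (d + 1)
  choose c hc using fun j : Fin (d + 1) => hφ _ (avgW_memValG ν (x j))
  have hker : LinearMap.ker (Matrix.mulVecLin (Matrix.of fun i j => c j i)) ≠ ⊥ :=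
    LinearMap.ker_ne_bot_of_finrank_lt (by simp)
  obtain ⟨a, ha, ha0⟩ := (Submodule.ne_bot_iff _).mp hker
  have hai : ∀ i, ∑ j, c j i * a j = 0 := by
    intro i
    have := congrFun (LinearMap.mem_ker.mp ha) i
    simpa [Matrix.mulVec, dotProduct] using this
  have hsum : ∀ L, ∑ j, a j * ((avgW ν ρ (x j) L : ℝ) : ℂ) = 0 := by
    intro L
    calc ∑ j, a j * ((avgW ν ρ (x j) L : ℝ) : ℂ) = ∑ j, ∑ i, (c j i * a j) * φ i L := by
          apply Finset.sum_congr rfl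
          intro j _
          rw [hc j L, Finset.mul_sum]
          apply Finset.sum_congr rfl
          intro i _
          ring
      _ = ∑ i, (∑ j, c j i * a j) * φ i L := by
          rw [Finset.sum_comm]
          simp only [Finset.sum_mul]
      _ = 0 := by simp [hai]
  apply ha0
  funext i
  have e : ∑ j, a j * (((avgW ν ρ (x j) (UB n) : ℝ) : ℂ) - ((avgW ν ρ (x j) (K i) : ℝ) : ℂ)) = 0 := by
    simp only [mul_sub, Finset.sum_sub_distrib, hsum, sub_self]
  rw [Finset.sum_eq_single i] at e
  · rcases mul_eq_zero.mp e with e | e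
    · exact e
    · have := h1 i
      rw [sub_eq_zero] at e
      have e' : avgW ν ρ (x i) (UB n) = avgW ν ρ (x i) (K i) := by exact_mod_cast e
      linarith
  · intro j _ hj
    rw [h2 i j hj.symm, sub_self, mul_zero]
  · intro h; exact absurd (Finset.mem_univ i) h

/-- the abstract Hadwiger-type theorem: for a compact subgroup `G ≤ SO(n)`,
`n ≥ 2`, the space `Val^G` is finite-dimensional if and only if `G` acts transitively on the
unit sphere. -/
theorem statement15 (n : ℕ) (hn : 2 ≤ n)
    (G : Subgroup (Matrix.unitaryGroup (Fin n) ℝ)) (hG : G ≤ SO n)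
    (hGcompact : IsCompact (G : Set (Matrix.unitaryGroup (Fin n) ℝ))) :
    (∃ (d : ℕ) (φ : Fin d → (ConvexBody (En n) → ℂ)),
      ∀ μ : ConvexBody (En n) → ℂ, MemValG G μ →
        ∃ c : Fin d → ℂ, ∀ K : ConvexBody (En n), μ K = ∑ i : Fin d, c i * φ i K)
    ↔ (∀ x y : En n, ‖x‖ = 1 → ‖y‖ = 1 → ∃ g ∈ G, matAct g x = y) := by
  exact ⟨fun h x y hx hy => dir_trans n hn G hGcompact h x y hx hy,
    fun h => dir_fin n hn G hGcompact h⟩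

end
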